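/- Let p be a prime, k an algebraically closed field of characteristic p, and let n ≥ 1, ℓ ≥ 1 with d := n − ℓ ≥ 2. Let f_1,…,f_ℓ ∈ k[[x_1,…,x_n]] be a regular sequence with each f_i lying in the square of the maximal ideal (the ideal generated by the variables), and set R := k[[x_1,…,x_n]]/(f_1,…,f_ℓ), a non-regular complete intersection of dimension d, with Hilbert–Kunz function HK_e(R) := dim_k k[[x_1,…,x_n]]/((f_1,…,f_ℓ) + (x_1^{p^e},…,x_n^{p^e})). Then either there is a ring isomorphism R ≅ k[[y_0,…,y_d]]/(Q_d), or there exist real numbers L_S and L_R such that: the sequence e ↦ dim_k( k[y_0,…,y_d]/(y_0^{p^e},…,y_d^{p^e}, P_d) )/p^{d·e} converges to L_S, the sequence e ↦ dim_k( k[y_0,…,y_d]/(y_0^{p^e},…,y_d^{p^e}, Q_d) )/p^{d·e} converges to L_R, L_S > L_R, and the liminf as e → ∞ of HK_e(R)/p^{d·e} is at least L_S. (That is, e_HK(R) ≥ e_HK(S_{p,d}) > e_HK(R_{p,d}) whenever R is not isomorphic to the A_1 singularity.) -/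

import Mathlib

/-- The Hilbert–Kunz function of the hypersurface defined by the polynomial `f` in `n`
variables, in characteristic `p`, at level `e`. -/
noncomputable def HKfun (k : Type*) [Field k] (n p e : ℕ)
    (f : MvPolynomial (Fin n) k) : ℕ :=
  Module.finrank k
    (MvPolynomial (Fin n) k ⧸
      Ideal.span
        (Set.range
          (fun i : Fin n => (MvPolynomial.X i : MvPolynomial (Fin n) k) ^ p ^ e) ∪ {f}))

/-- The defining equation `Q_d` of the `A₁` singularity:
`Q_d = y_0y_1 + y_2y_3 + ⋯ + y_{d−1}y_d` for `d` odd and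
`Q_d = y_0y_1 + ⋯ + y_{d−2}y_{d−1} + y_d²` for `d` even. -/
noncomputable def A1poly (k : Type*) [Field k] (d : ℕ) : MvPolynomial (Fin (d + 1)) k :=
  (∑ i : Fin ((d + 1) / 2),
      MvPolynomial.X (⟨2 * i, by omega⟩ : Fin (d + 1)) *
        MvPolynomial.X (⟨2 * i + 1, by omega⟩ : Fin (d + 1))) +
    if Even d then MvPolynomial.X (⟨d, by omega⟩ : Fin (d + 1)) ^ 2 else 0

/-- The defining equation `P_d` of the `A₂` singularity:
`P_d = y_0y_1 + ⋯ + y_{d−3}y_{d−2} + y_{d−1}² + y_d³` for `d` odd and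
`P_d = y_0y_1 + ⋯ + y_{d−2}y_{d−1} + y_d³` for `d` even. -/
noncomputable def A2poly (k : Type*) [Field k] (d : ℕ) : MvPolynomial (Fin (d + 1)) k :=
  (∑ i : Fin (d / 2),
      MvPolynomial.X (⟨2 * i, by omega⟩ : Fin (d + 1)) *
        MvPolynomial.X (⟨2 * i + 1, by omega⟩ : Fin (d + 1))) +
    (if Odd d then MvPolynomial.X (⟨d - 1, by omega⟩ : Fin (d + 1)) ^ 2 else 0) +
    MvPolynomial.X (⟨d, by omega⟩ : Fin (d + 1)) ^ 3

section
namespace SWY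

open MvPowerSeries

section basics

variable {k : Type*} [Field k] {N : ℕ}

/-- the maximal ideal -/
noncomputable def mI (N : ℕ) (k : Type*) [Field k] : Ideal (MvPowerSeries (Fin N) k) :=
  Ideal.span (Set.range X)

theorem isHausdorff_mI : IsHausdorff (mI N k) (MvPowerSeries (Fin N) k) := by
  unfold mI; infer_instance

theorem isAdicComplete_mI : IsAdicComplete (mI N k) (MvPowerSeries (Fin N) k) := by
  unfold mI; infer_instance

theorem X_mem_mI (i : Fin N) : (X i : MvPowerSeries (Fin N) k) ∈ mI N k :=
  Ideal.subset_span ⟨i, rfl⟩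

/-- the q-th bracket power -/
noncomputable def fr (N : ℕ) (k : Type*) [Field k] (q : ℕ) : Ideal (MvPowerSeries (Fin N) k) :=
  Ideal.span (Set.range (fun i => X i ^ q))

theorem mem_fr_iff (q : ℕ) (g : MvPowerSeries (Fin N) k) :
    g ∈ fr N k q ↔ ∀ α : Fin N →₀ ℕ, (∀ i, α i < q) → coeff α g = 0 := by
  classical
  constructor
  · intro h α hα
    obtain ⟨c, hc⟩ := (Ideal.mem_span_range_iff_exists_fun).1 h
    rw [← hc, map_sum]
    exact Finset.sum_eq_zero fun i _ =>
      X_pow_dvd_iff.1 (Dvd.intro_left _ rfl) α (hα i)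
  · intro h
    let c : (Fin N →₀ ℕ) → Option (Fin N) := fun α =>
      if hα : ∃ i, q ≤ α i then some hα.choose else none
    let G : Fin N → MvPowerSeries (Fin N) k := fun i α => if c α = some i then coeff α g else 0
    have hG : ∀ i α, coeff α (G i) = if c α = some i then coeff α g else 0 := fun i α => rfl
    have hg : g = ∑ i, G i := by
      ext α
      rw [map_sum]
      simp only [hG]
      by_cases hα : ∃ i, q ≤ α i
      · have : c α = some hα.choose := by simp only [c]; rw [dif_pos hα]
        rw [this]; simp
      · have : c α = none := by simp only [c]; rw [dif_neg hα]
        rw [this]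
        push Not at hα
        simp [h α hα]
    rw [hg]
    refine Ideal.sum_mem _ fun i _ => ?_
    have : (X i : MvPowerSeries (Fin N) k) ^ q ∣ G i := by
      rw [X_pow_dvd_iff]
      intro α hα
      rw [hG, if_neg]
      intro hc
      simp only [c] at hc
      split_ifs at hc with h1
      · have := h1.choose_spec
        simp only [Option.some.injEq] at hc
        rw [hc] at this
        omega
    obtain ⟨b, hb⟩ := this
    rw [hb]
    exact Ideal.mul_mem_right _ _ (Ideal.subset_span ⟨i, rfl⟩)

theorem mem_mI_iff (g : MvPowerSeries (Fin N) k) : g ∈ mI N k ↔ constantCoeff g = 0 := by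
  have h := mem_fr_iff 1 g
  have : fr N k 1 = mI N k := by unfold fr mI; simp
  rw [this] at h
  rw [h]
  constructor
  · intro h; simpa using h 0 (by simp)
  · intro h α hα
    have : α = 0 := by ext i; simpa using hα i
    rw [this]; simpa using h

theorem isUnit_iff_notMem (g : MvPowerSeries (Fin N) k) : IsUnit g ↔ g ∉ mI N k := by
  rw [mem_mI_iff, MvPowerSeries.isUnit_iff_constantCoeff, isUnit_iff_ne_zero]

theorem mI_eq_max : mI N k = IsLocalRing.maximalIdeal (MvPowerSeries (Fin N) k) := by
  ext g
  rw [IsLocalRing.mem_maximalIdeal, mem_nonunits_iff, isUnit_iff_notMem, not_not]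

instance mI_isMaximal : (mI N k).IsMaximal := by
  rw [mI_eq_max]; infer_instance

theorem sub_C_mem (g : MvPowerSeries (Fin N) k) : g - C (constantCoeff g) ∈ mI N k := by
  rw [mem_mI_iff]; simp

/-- truncation -/
theorem exists_trunc (q : ℕ) (g : MvPowerSeries (Fin N) k) :
    ∃ P : MvPolynomial (Fin N) k, g - (P : MvPowerSeries (Fin N) k) ∈ fr N k q ∧
      P ∈ MvPolynomial.restrictSupport k
        {α : Fin N →₀ ℕ | ∀ i, α i < q} := by
  classical
  have hfin : {α : Fin N →₀ ℕ | ∀ i, α i < q}.Finite := by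
    refine (Set.finite_Iic (Finsupp.equivFunOnFinite.symm (fun _ => q) : Fin N →₀ ℕ)).subset ?_
    intro α hα i
    exact (hα i).le
  refine ⟨truncFinset k hfin.toFinset g, ?_, ?_⟩
  · rw [mem_fr_iff]
    intro α hα
    rw [map_sub, MvPolynomial.coeff_coe, coeff_truncFinset_of_mem _ (by simpa using hα), sub_self]
  · have := support_truncFinset_subset (s := hfin.toFinset) g
    rw [MvPolynomial.mem_restrictSupport_iff]
    intro α hα
    have := this hα
    simpa using this

/-- bracket power in the polynomial ring -/
noncomputable def frP (σ : Type*) (k : Type*) [Field k] (q : ℕ) : Ideal (MvPolynomial σ k) :=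
  Ideal.span (Set.range (fun i => MvPolynomial.X i ^ q))

theorem mem_frP_iff {σ : Type*} (q : ℕ) (g : MvPolynomial σ k) :
    g ∈ frP σ k q ↔ ∀ α : σ →₀ ℕ, (∀ i, α i < q) → MvPolynomial.coeff α g = 0 := by
  classical
  have : frP σ k q = Ideal.span ((fun s => MvPolynomial.monomial s (1 : k)) ''
      (Set.range fun i => Finsupp.single i q)) := by
    unfold frP
    congr 1
    rw [← Set.range_comp]
    congr 1
    ext1 i
    simp [MvPolynomial.X_pow_eq_monomial]
  rw [this, MvPolynomial.mem_ideal_span_monomial_image]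
  constructor
  · intro h α hα
    by_contra hne
    obtain ⟨_, ⟨i, rfl⟩, hi⟩ := h α (MvPolynomial.mem_support_iff.2 hne)
    have := hi i
    simp only [Finsupp.single_eq_same] at this
    exact absurd (hα i) (by omega)
  · intro h α hα
    by_contra hne
    push Not at hne
    refine (MvPolynomial.mem_support_iff.1 hα) (h α fun i => ?_)
    by_contra hi
    exact hne (Finsupp.single i q) ⟨i, rfl⟩ (by simpa using hi)

theorem finite_box (σ : Type*) [Finite σ] (q : ℕ) : {α : σ →₀ ℕ | ∀ i, α i < q}.Finite := by
  classical
  cases nonempty_fintype σ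
  refine (Set.finite_Iic (Finsupp.equivFunOnFinite.symm (fun _ => q) : σ →₀ ℕ)).subset ?_
  intro α hα i
  exact (hα i).le

theorem exists_truncP {σ : Type*} [Finite σ] (q : ℕ) (g : MvPolynomial σ k) :
    ∃ P : MvPolynomial σ k, g - P ∈ frP σ k q ∧
      P ∈ MvPolynomial.restrictSupport k {α : σ →₀ ℕ | ∀ i, α i < q} := by
  classical
  have hfin := finite_box σ q
  refine ⟨truncFinset k hfin.toFinset (g : MvPowerSeries σ k), ?_, ?_⟩
  · rw [mem_frP_iff]
    intro α hα
    rw [MvPolynomial.coeff_sub, coeff_truncFinset_of_mem _ (by simpa using hα),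
      MvPolynomial.coeff_coe, sub_self]
  · have := support_truncFinset_subset (s := hfin.toFinset) (g : MvPowerSeries σ k)
    rw [MvPolynomial.mem_restrictSupport_iff]
    intro α hα
    have := this hα
    simpa using this

theorem finite_restrict (σ : Type*) [Finite σ] (q : ℕ) : Module.Finite k
    (MvPolynomial.restrictSupport k {α : σ →₀ ℕ | ∀ i, α i < q}) := by
  have := finite_box σ q
  have : Finite {α : σ →₀ ℕ | ∀ i, α i < q} := this
  exact Module.Finite.of_basis (MvPolynomial.basisRestrictSupport k _)

theorem finite_frP (σ : Type*) [Finite σ] (q : ℕ) :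
    Module.Finite k (MvPolynomial σ k ⧸ frP σ k q) := by
  have := finite_restrict (k := k) σ q
  refine Module.Finite.of_surjective (((Ideal.Quotient.mkₐ k (frP σ k q)).toLinearMap).comp
    (MvPolynomial.restrictSupport k {α : σ →₀ ℕ | ∀ i, α i < q}).subtype) ?_
  intro x
  obtain ⟨g, rfl⟩ := Ideal.Quotient.mk_surjective x
  obtain ⟨P, h1, h2⟩ := exists_truncP q g
  refine ⟨⟨P, h2⟩, ?_⟩
  exact (Ideal.Quotient.eq.2 h1).symm

theorem finite_quotP {σ : Type*} [Finite σ] {q : ℕ} {I : Ideal (MvPolynomial σ k)}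
    (h : frP σ k q ≤ I) :
    Module.Finite k (MvPolynomial σ k ⧸ I) := by
  have := finite_frP (k := k) σ q
  exact Module.Finite.of_surjective (Ideal.Quotient.factorₐ k h).toLinearMap
    (Ideal.Quotient.factor_surjective h)

theorem finite_fr (N q : ℕ) : Module.Finite k (MvPowerSeries (Fin N) k ⧸ fr N k q) := by
  have := finite_restrict (k := k) (Fin N) q
  refine Module.Finite.of_surjective (((Ideal.Quotient.mkₐ k (fr N k q)).toLinearMap).comp
    ((MvPolynomial.coeToMvPowerSeries.algHom k).toLinearMap.comp
    (MvPolynomial.restrictSupport k {α : Fin N →₀ ℕ | ∀ i, α i < q}).subtype)) ?_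
  intro x
  obtain ⟨g, rfl⟩ := Ideal.Quotient.mk_surjective x
  obtain ⟨P, h1, h2⟩ := exists_trunc q g
  refine ⟨⟨P, h2⟩, ?_⟩
  symm
  simpa [Ideal.Quotient.eq] using h1

theorem finite_quot {q : ℕ} {I : Ideal (MvPowerSeries (Fin N) k)} (h : fr N k q ≤ I) :
    Module.Finite k (MvPowerSeries (Fin N) k ⧸ I) := by
  have := finite_fr (k := k) N q
  exact Module.Finite.of_surjective (Ideal.Quotient.factorₐ k h).toLinearMap
    (Ideal.Quotient.factor_surjective h)

/-- length -/
noncomputable def len (q : ℕ) (I : Ideal (MvPowerSeries (Fin N) k)) : ℕ :=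
  Module.finrank k (MvPowerSeries (Fin N) k ⧸ (I ⊔ fr N k q))

theorem len_le_of_le {q : ℕ} {I J : Ideal (MvPowerSeries (Fin N) k)} (h : I ≤ J) :
    len q J ≤ len q I := by
  have := finite_quot (q := q) (I := I ⊔ fr N k q) le_sup_right
  have h' := sup_le_sup_right h (fr N k q)
  exact LinearMap.finrank_le_finrank_of_surjective
    (f := (Ideal.Quotient.factorₐ k h').toLinearMap)
    (Ideal.Quotient.factor_surjective h')

theorem coe_mem_fr {q : ℕ} {P : MvPolynomial (Fin N) k} :
    (P : MvPowerSeries (Fin N) k) ∈ fr N k q ↔ P ∈ frP (Fin N) k q := by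
  rw [mem_fr_iff, mem_frP_iff]; simp

theorem len_coe (q : ℕ) (f : MvPolynomial (Fin N) k) :
    len q (Ideal.span {(f : MvPowerSeries (Fin N) k)}) =
      Module.finrank k (MvPolynomial (Fin N) k ⧸ (Ideal.span {f} ⊔ frP (Fin N) k q)) := by
  unfold len
  set J := Ideal.span {(f : MvPowerSeries (Fin N) k)} ⊔ fr N k q with hJ
  set φ : MvPolynomial (Fin N) k →ₐ[k] (MvPowerSeries (Fin N) k ⧸ J) :=
    (Ideal.Quotient.mkₐ k J).comp (MvPolynomial.coeToMvPowerSeries.algHom k) with hφ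
  have hφa : ∀ P, φ P = Ideal.Quotient.mk J (P : MvPowerSeries (Fin N) k) := by
    intro P; simp [hφ]
  have hs : Function.Surjective φ := by
    intro x
    obtain ⟨g, rfl⟩ := Ideal.Quotient.mk_surjective x
    obtain ⟨P, h1, h2⟩ := exists_trunc q g
    refine ⟨P, ?_⟩
    rw [hφa, eq_comm, Ideal.Quotient.eq]
    exact (le_sup_right : fr N k q ≤ J) h1
  have hk : RingHom.ker φ = Ideal.span {f} ⊔ frP (Fin N) k q := by
    ext P
    rw [RingHom.mem_ker, hφa, Ideal.Quotient.eq_zero_iff_mem, hJ]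
    constructor
    · intro h
      obtain ⟨a, ha, b, hb, hab⟩ := Submodule.mem_sup.1 h
      obtain ⟨c, rfl⟩ := Ideal.mem_span_singleton'.1 ha
      obtain ⟨Q, hQ, -⟩ := exists_trunc q c
      have : ((P - Q * f : MvPolynomial (Fin N) k) : MvPowerSeries (Fin N) k) ∈ fr N k q := by
        have e : ((P - Q * f : MvPolynomial (Fin N) k) : MvPowerSeries (Fin N) k)
            = b + (c - Q) * f := by
          have : ((P - Q * f : MvPolynomial (Fin N) k) : MvPowerSeries (Fin N) k)
            = (P : MvPowerSeries (Fin N) k) - Q * f := by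
            rw [← MvPolynomial.coe_mul]
            exact map_sub (MvPolynomial.coeToMvPowerSeries.ringHom (R := k) (σ := Fin N)) P (Q * f)
          rw [this, ← hab]; ring
        rw [e]
        exact Ideal.add_mem _ hb (Ideal.mul_mem_right _ _ hQ)
      have h2 := coe_mem_fr.1 this
      have : P = Q * f + (P - Q * f) := by ring
      rw [this]
      exact Ideal.add_mem _ (Ideal.mem_sup_left (Ideal.mem_span_singleton'.2 ⟨Q, rfl⟩))
        (Ideal.mem_sup_right h2)
    · intro h
      obtain ⟨a, ha, b, hb, hab⟩ := Submodule.mem_sup.1 h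
      obtain ⟨c, rfl⟩ := Ideal.mem_span_singleton'.1 ha
      rw [← hab, MvPolynomial.coe_add, MvPolynomial.coe_mul]
      exact Ideal.add_mem _ (Ideal.mem_sup_left (Ideal.mem_span_singleton'.2 ⟨_, rfl⟩))
        (Ideal.mem_sup_right (coe_mem_fr.2 hb))
  have e := (Ideal.quotientKerAlgEquivOfSurjective hs).toLinearEquiv.finrank_eq
  rw [← e]
  exact ((Ideal.quotientEquivAlgOfEq k hk).toLinearEquiv.finrank_eq)

end basics

section autom

variable {k : Type*} [Field k] {N : ℕ}

theorem noeth_inj {R : Type*} [CommRing R] [IsNoetherianRing R] (φ : R →+* R)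
    (h : Function.Surjective φ) : Function.Injective φ := by
  let c : ℕ →o Ideal R := ⟨fun n => RingHom.ker (φ ^ n), by
    refine monotone_nat_of_le_succ fun n x hx => ?_
    rw [RingHom.mem_ker] at hx ⊢
    rw [pow_succ']
    change φ ((φ ^ n) x) = 0
    rw [hx, map_zero]⟩
  obtain ⟨n, hn⟩ := monotone_stabilizes_iff_noetherian.2 ‹IsNoetherian R R› c
  rw [injective_iff_map_eq_zero]
  intro x hx
  have hs : Function.Surjective (φ ^ n) := by
    have : ((φ ^ n : R →+* R) : R → R) = φ^[n] := by
      exact RingHom.coe_pow φ n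
    rw [this]; exact h.iterate n
  obtain ⟨y, rfl⟩ := hs x
  have hy : y ∈ c (n + 1) := by
    change y ∈ RingHom.ker (φ ^ (n + 1))
    rw [RingHom.mem_ker, pow_succ']; exact hx
  rw [← hn (n + 1) (by omega)] at hy
  exact hy

theorem exists_aut (y : Fin N → MvPowerSeries (Fin N) k)
    (hy : Ideal.span (Set.range y) = mI N k) :
    ∃ e : MvPowerSeries (Fin N) k ≃ₐ[k] MvPowerSeries (Fin N) k, ∀ i, e (X i) = y i := by
  have h0 : ∀ i, constantCoeff (y i) = 0 := fun i => by
    rw [← mem_mI_iff, ← hy]; exact Ideal.subset_span ⟨i, rfl⟩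
  have hs := hasSubst_of_constantCoeff_zero h0
  let φ : MvPowerSeries (Fin N) k →ₐ[k] MvPowerSeries (Fin N) k := substAlgHom hs
  have hX : ∀ i, φ (X i) = y i := fun i => substAlgHom_X hs i
  have hmap : (mI N k).map φ.toRingHom = mI N k := by
    conv_lhs => unfold mI
    rw [Ideal.map_span, ← hy, ← Set.range_comp]
    congr 1
    congr 1
    ext1 i
    exact hX i
  have hsurj : Function.Surjective φ.toRingHom := by
    have i1 := isAdicComplete_mI (N := N) (k := k)
    have i2 : IsHausdorff ((mI N k).map φ.toRingHom) (MvPowerSeries (Fin N) k) := by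
      rw [hmap]; exact isHausdorff_mI
    refine surjective_of_mk_map_comp_surjective (I := mI N k) φ.toRingHom ?_
    intro x
    obtain ⟨g, rfl⟩ := Ideal.Quotient.mk_surjective x
    refine ⟨C (constantCoeff g), ?_⟩
    rw [RingHom.comp_apply, eq_comm, Ideal.Quotient.eq, hmap]
    have : φ.toRingHom (C (constantCoeff g)) = C (constantCoeff g) := by
      exact φ.commutes (constantCoeff g)
    rw [this]
    exact sub_C_mem g
  have hinj := noeth_inj φ.toRingHom hsurj
  exact ⟨AlgEquiv.ofBijective φ ⟨hinj, hsurj⟩, hX⟩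

theorem map_mI (e : MvPowerSeries (Fin N) k ≃ₐ[k] MvPowerSeries (Fin N) k) :
    (mI N k).map (e : MvPowerSeries (Fin N) k →+* MvPowerSeries (Fin N) k) = mI N k := by
  have key : ∀ x, e x ∈ mI N k ↔ x ∈ mI N k := by
    intro x
    rw [← not_iff_not, ← isUnit_iff_notMem, ← isUnit_iff_notMem]
    exact isUnit_map_iff e x
  ext x
  rw [Ideal.mem_map_iff_of_surjective (e : MvPowerSeries (Fin N) k →+* MvPowerSeries (Fin N) k)
    e.surjective]
  constructor
  · rintro ⟨y, hy, rfl⟩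
    exact (key y).2 hy
  · intro hx
    refine ⟨e.symm x, (key _).1 (by simpa using hx), by simp⟩

theorem fr_eq_map (p e : ℕ) [Fact p.Prime] [CharP k p] :
    haveI : ExpChar (MvPowerSeries (Fin N) k) p := by
      have : CharP (MvPowerSeries (Fin N) k) p := charP_of_injective_algebraMap
        (algebraMap k (MvPowerSeries (Fin N) k)).injective p
      exact ExpChar.prime Fact.out
    fr N k (p ^ e) = (mI N k).map (iterateFrobenius (MvPowerSeries (Fin N) k) p e) := by
  unfold fr mI
  rw [Ideal.map_span, ← Set.range_comp]
  rfl

theorem map_fr (p e : ℕ) [Fact p.Prime] [CharP k p]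
    (φ : MvPowerSeries (Fin N) k ≃ₐ[k] MvPowerSeries (Fin N) k) :
    (fr N k (p ^ e)).map (φ : MvPowerSeries (Fin N) k →+* MvPowerSeries (Fin N) k)
      = fr N k (p ^ e) := by
  have : CharP (MvPowerSeries (Fin N) k) p := charP_of_injective_algebraMap
        (algebraMap k (MvPowerSeries (Fin N) k)).injective p
  have : ExpChar (MvPowerSeries (Fin N) k) p := ExpChar.prime Fact.out
  rw [fr_eq_map, Ideal.map_map]
  conv_rhs => rw [← map_mI φ, Ideal.map_map]
  congr 1
  ext1 x
  simp [iterateFrobenius_def]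

theorem len_map (p e : ℕ) [Fact p.Prime] [CharP k p]
    (φ : MvPowerSeries (Fin N) k ≃ₐ[k] MvPowerSeries (Fin N) k)
    (I : Ideal (MvPowerSeries (Fin N) k)) :
    len (p ^ e) (I.map (φ : MvPowerSeries (Fin N) k →+* MvPowerSeries (Fin N) k)) =
      len (p ^ e) I := by
  unfold len
  symm
  refine (Ideal.quotientEquivAlg _ _ φ ?_).toLinearEquiv.finrank_eq
  conv_lhs => rw [← map_fr p e φ]
  rw [← Ideal.map_sup]

end autom

section semicont

variable {k : Type*} [Field k] {V W : Type*} [AddCommGroup V] [Module k V] [AddCommGroup W]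
  [Module k W]

theorem rank_semicont [FiniteDimensional k V] [FiniteDimensional k W] (A B : V →ₗ[k] W) :
    {t : k | Module.finrank k (LinearMap.range (A + t • B)) <
      Module.finrank k (LinearMap.range A)}.Finite := by
  classical
  set r := Module.finrank k (LinearMap.range A) with hr
  -- section
  obtain ⟨s, hs⟩ := (LinearMap.rangeRestrict A).exists_rightInverse_of_surjective
    (LinearMap.range_rangeRestrict A)
  obtain ⟨π, hπ⟩ := (LinearMap.range A).subtype.exists_leftInverse_of_injective
    (Submodule.ker_subtype _)
  let b := Module.finBasis k (LinearMap.range A)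
  let D : LinearMap.range A →ₗ[k] LinearMap.range A := π ∘ₗ B ∘ₗ s
  have hA : π ∘ₗ A ∘ₗ s = LinearMap.id := by
    ext x
    have h1 : (LinearMap.rangeRestrict A) (s x) = x := LinearMap.congr_fun hs x
    have h2 : A (s x) = (x : W) := congrArg Subtype.val h1
    have h3 := LinearMap.congr_fun hπ x
    simp only [LinearMap.comp_apply] at h3 ⊢
    rw [h2]
    exact congrArg Subtype.val h3
  let M := LinearMap.toMatrix b b D
  let P : Polynomial k := (1 + (Polynomial.X : Polynomial k) • M.map Polynomial.C).det
  have hP : ∀ t, P.eval t = (1 + t • M).det := by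
    intro t
    have : P.eval t = (Polynomial.evalRingHom t) P := rfl
    rw [this, RingHom.map_det]
    congr 1
    ext i j
    simp [Matrix.one_apply, apply_ite]
    exact mul_comm _ _
  have hP0 : P ≠ 0 := by
    intro h
    have := hP 0
    rw [h] at this
    simp at this
  refine (P.roots.toFinset.finite_toSet).subset ?_
  intro t ht
  simp only [Finset.mem_coe, Multiset.mem_toFinset, Polynomial.mem_roots hP0, Polynomial.IsRoot.def]
  by_contra hne
  rw [hP] at hne
  have hdet : LinearMap.det (π ∘ₗ (A + t • B) ∘ₗ s) ≠ 0 := by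
    have : π ∘ₗ (A + t • B) ∘ₗ s = LinearMap.id + t • D := by
      rw [← hA]
      ext x
      simp [D]
    rw [this, ← LinearMap.det_toMatrix b]
    convert hne using 2
    simp [M]
  have hinj : Function.Injective (π ∘ₗ (A + t • B) ∘ₗ s) := by
    have := LinearEquiv.ofIsUnitDet (f := π ∘ₗ (A + t • B) ∘ₗ s) (v := b) (v' := b)
      (by rw [LinearMap.det_toMatrix]; exact isUnit_iff_ne_zero.2 hdet)
    rw [← LinearMap.ker_eq_bot]
    by_contra hk
    exact hdet (LinearMap.det_eq_zero_iff_ker_ne_bot.2 hk)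
  have : r ≤ Module.finrank k (LinearMap.range (A + t • B)) := by
    let g : LinearMap.range A →ₗ[k] LinearMap.range (A + t • B) :=
      (LinearMap.rangeRestrict (A + t • B)) ∘ₗ s
    have hg : Function.Injective g := by
      intro x y hxy
      apply hinj
      have := congrArg Subtype.val hxy
      simp only [LinearMap.comp_apply]
      exact congrArg π this
    exact LinearMap.finrank_le_finrank_of_injective hg
  exact absurd ht (by simpa using this)

variable {N ℓ : ℕ}

/-- the map `C^ℓ → C` -/
noncomputable def colin (q : ℕ) (F : Fin ℓ → MvPowerSeries (Fin N) k) :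
    (Fin ℓ → (MvPowerSeries (Fin N) k ⧸ fr N k q)) →ₗ[k] (MvPowerSeries (Fin N) k ⧸ fr N k q) :=
  ∑ i, (LinearMap.mulLeft k (Ideal.Quotient.mk (fr N k q) (F i))) ∘ₗ LinearMap.proj i

theorem range_colin (q : ℕ) (F : Fin ℓ → MvPowerSeries (Fin N) k) :
    LinearMap.range (colin q F) =
      ((Ideal.span (Set.range F)).map (Ideal.Quotient.mk (fr N k q))).restrictScalars k := by
  ext x
  rw [Submodule.restrictScalars_mem, Ideal.map_span, ← Set.range_comp,
    Ideal.mem_span_range_iff_exists_fun, LinearMap.mem_range]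
  simp [colin, mul_comm]

theorem len_add_rank (q : ℕ) (F : Fin ℓ → MvPowerSeries (Fin N) k) :
    len q (Ideal.span (Set.range F)) + Module.finrank k (LinearMap.range (colin q F)) =
      Module.finrank k (MvPowerSeries (Fin N) k ⧸ fr N k q) := by
  have := finite_fr (k := k) N q
  rw [← Submodule.finrank_quotient_add_finrank (LinearMap.range (colin q F))]
  congr 1
  unfold len
  rw [range_colin, sup_comm]
  exact ((DoubleQuot.quotQuotEquivQuotSupₐ k (fr N k q)
    (Ideal.span (Set.range F))).toLinearEquiv.finrank_eq).symm

theorem len_semicont (q : ℕ) (F G : Fin ℓ → MvPowerSeries (Fin N) k) :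
    {t : k | len q (Ideal.span (Set.range F)) <
      len q (Ideal.span (Set.range (fun i => F i + C t * G i)))}.Finite := by
  have := finite_fr (k := k) N q
  refine (rank_semicont (colin q F) (colin q G)).subset ?_
  intro t ht
  have h1 := len_add_rank q F
  have h2 := len_add_rank q (fun i => F i + C t * G i)
  have h3 : colin q (fun i => F i + C t * G i) = colin q F + t • colin q G := by
    refine LinearMap.ext fun x => ?_
    have hC : ∀ y : MvPowerSeries (Fin N) k ⧸ fr N k q,
        Ideal.Quotient.mk (fr N k q) (C t) * y = t • y := fun y =>
      (Algebra.smul_def t y).symm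
    simp only [colin, LinearMap.add_apply, LinearMap.smul_apply, LinearMap.sum_apply,
      LinearMap.comp_apply, LinearMap.proj_apply, LinearMap.mulLeft_apply, map_add, map_mul,
      add_mul, Finset.sum_add_distrib, Finset.smul_sum, hC,
      smul_mul_assoc]
  simp only [Set.mem_ofPred_eq] at ht ⊢
  rw [← h3]
  omega

end semicont

end SWY

end

section
namespace SWY

section gens
variable {S : Type*} [CommRing S]

/-- generated by `M` elements -/
def Gen (M : ℕ) (J : Ideal S) : Prop := ∃ u : Fin M → S, Ideal.span (Set.range u) = J

theorem Gen.zero : Gen 0 (⊥ : Ideal S) := ⟨Fin.elim0, by simp⟩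

theorem Gen.eq_bot {J : Ideal S} (h : Gen 0 J) : J = ⊥ := by
  obtain ⟨u, rfl⟩ := h; simp

theorem span_cons {M : ℕ} (x : S) (u : Fin M → S) :
    Ideal.span (Set.range (Fin.cons x u : Fin (M + 1) → S)) =
      Ideal.span {x} ⊔ Ideal.span (Set.range u) := by
  rw [Fin.range_cons, Ideal.span_insert]

theorem span_succAbove {M : ℕ} (v : Fin (M + 1) → S) (i : Fin (M + 1)) :
    Ideal.span {v i} ⊔ Ideal.span (Set.range (v ∘ i.succAbove)) = Ideal.span (Set.range v) := by
  apply le_antisymm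
  · refine sup_le (Ideal.span_mono (by simp)) (Ideal.span_mono (Set.range_comp_subset_range _ _))
  · rw [Ideal.span_le]
    rintro _ ⟨j, rfl⟩
    rcases eq_or_ne j i with rfl | h
    · exact Ideal.mem_sup_left (Ideal.subset_span rfl)
    · obtain ⟨l, rfl⟩ := Fin.exists_succAbove_eq h
      exact Ideal.mem_sup_right (Ideal.subset_span ⟨l, rfl⟩)

theorem Gen.cons {M : ℕ} {J : Ideal S} (h : Gen M J) (x : S) : Gen (M + 1) (Ideal.span {x} ⊔ J) := by
  obtain ⟨u, rfl⟩ := h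
  exact ⟨Fin.cons x u, span_cons x u⟩

theorem Gen.uncons {M : ℕ} {J : Ideal S} (h : Gen (M + 1) J) :
    ∃ x J', Gen M J' ∧ Ideal.span {x} ⊔ J' = J := by
  obtain ⟨u, rfl⟩ := h
  exact ⟨u 0, _, ⟨_, rfl⟩, span_succAbove u 0⟩

theorem Gen.sup {M M' : ℕ} {J J' : Ideal S} (h : Gen M J) (h' : Gen M' J') :
    Gen (M + M') (J ⊔ J') := by
  induction M generalizing J with
  | zero => rw [h.eq_bot]; simpa using h'
  | succ M ih =>
    obtain ⟨x, J1, h1, rfl⟩ := h.uncons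
    have := (ih h1).cons x
    rw [sup_assoc]
    convert this using 1
    omega

theorem Gen.split {M M' : ℕ} {J : Ideal S} (h : Gen (M + M') J) :
    ∃ J1 J2, Gen M J1 ∧ Gen M' J2 ∧ J1 ⊔ J2 = J := by
  induction M generalizing J with
  | zero => exact ⟨⊥, J, Gen.zero, by simpa using h, by simp⟩
  | succ M ih =>
    have h' : Gen (M + M' + 1) J := by convert h using 1; omega
    obtain ⟨x, J1, h1, rfl⟩ := h'.uncons
    obtain ⟨J2, J3, h2, h3, rfl⟩ := ih h1
    exact ⟨_, J3, h2.cons x, h3, by rw [sup_assoc]⟩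

theorem exists_matrix {M : ℕ} (v : Fin M → S) {g : S} (hg : g ∈ Ideal.span (Set.range v) ^ 2) :
    ∃ a : Fin M → Fin M → S, g = ∑ i, ∑ j, a i j * (v i * v j) := by
  rw [pow_two] at hg
  refine Submodule.mul_induction_on hg ?_ ?_
  · intro x hx y hy
    obtain ⟨c, rfl⟩ := (Ideal.mem_span_range_iff_exists_fun).1 hx
    obtain ⟨d, rfl⟩ := (Ideal.mem_span_range_iff_exists_fun).1 hy
    refine ⟨fun i j => c i * d j, ?_⟩
    rw [Finset.sum_mul_sum]
    exact Finset.sum_congr rfl fun i _ => Finset.sum_congr rfl fun j _ => by ring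
  · rintro x y ⟨a, rfl⟩ ⟨b, rfl⟩
    refine ⟨fun i j => a i j + b i j, ?_⟩
    simp only [add_mul, Finset.sum_add_distrib]

theorem mem_mul_sq {M : ℕ} (𝔪 J : Ideal S) (v : Fin M → S) (hv : ∀ i, v i ∈ J)
    (a : Fin M → Fin M → S) (h1 : ∀ i, a i i ∈ 𝔪) (h2 : ∀ i j, i ≠ j → a i j + a j i ∈ 𝔪) :
    ∑ i, ∑ j, a i j * (v i * v j) ∈ 𝔪 * J ^ 2 := by
  induction M with
  | zero => simp
  | succ M ih =>
    have key : ∀ c ∈ 𝔪, ∀ x ∈ J, ∀ y ∈ J, c * (x * y) ∈ 𝔪 * J ^ 2 := by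
      intro c hc x hx y hy
      rw [pow_two]
      exact Ideal.mul_mem_mul hc (Ideal.mul_mem_mul hx hy)
    have := ih (fun i => v i.succ) (fun i => hv _) (fun i j => a i.succ j.succ)
      (fun i => h1 _) (fun i j hij => h2 _ _ (by simpa using hij))
    have e : ∑ i, ∑ j, a i j * (v i * v j) = a 0 0 * (v 0 * v 0) +
        (∑ j : Fin M, (a 0 j.succ + a j.succ 0) * (v 0 * v j.succ)) +
        ∑ i : Fin M, ∑ j : Fin M, a i.succ j.succ * (v i.succ * v j.succ) := by
      rw [Fin.sum_univ_succ, Fin.sum_univ_succ]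
      simp only [Fin.sum_univ_succ (n := M), Finset.sum_add_distrib, add_mul]
      have : ∀ j : Fin M, a j.succ 0 * (v j.succ * v 0) = a j.succ 0 * (v 0 * v j.succ) :=
        fun j => by ring
      simp only [this]
      ring
    rw [e]
    refine Ideal.add_mem _ (Ideal.add_mem _ (key _ (h1 0) _ (hv 0) _ (hv 0))
      (Ideal.sum_mem _ fun j _ => key _ (h2 _ _ (Fin.succ_ne_zero j).symm) _ (hv 0) _ (hv _))) this

end gens

section quad
variable {S : Type*} [CommRing S] [IsLocalRing S]

/-- assumptions for normal forms -/
class Good (S : Type*) [CommRing S] [IsLocalRing S] : Prop where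
  hh : ∀ α β γ : S, IsUnit (β ^ 2 - 4 * α * γ) → ∃ w, IsUnit w ∧ w ^ 2 - β * w + α * γ = 0
  two : IsUnit (2 : S) ∨ ((2 : S) ∈ IsLocalRing.maximalIdeal S ∧
    ∀ a : S, ∃ s, a - s ^ 2 ∈ IsLocalRing.maximalIdeal S)

open IsLocalRing

theorem isUnit_or_mem (a : S) : IsUnit a ∨ a ∈ maximalIdeal S := by
  by_cases h : IsUnit a
  · exact Or.inl h
  · exact Or.inr h

theorem isUnit_add_mem {a b : S} (ha : IsUnit a) (hb : b ∈ maximalIdeal S) : IsUnit (a + b) := by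
  rcases isUnit_or_mem (a + b) with h | h
  · exact h
  · exfalso
    have : a ∈ maximalIdeal S := by
      have := Ideal.sub_mem _ h hb
      simpa using this
    exact (IsLocalRing.mem_maximalIdeal a).1 this ha

theorem not_unit_iff (a : S) : ¬ IsUnit a ↔ a ∈ maximalIdeal S := by
  rw [mem_maximalIdeal, mem_nonunits_iff]

/-- pivot data -/
def Piv (M : ℕ) (J : Ideal S) (g : S) : Prop :=
  ∃ M'' x y K, M = M'' + 2 ∧ Gen M'' K ∧ Ideal.span {x, y} ⊔ K = J ∧
    ∃ α β γ ρ₁ ρ₂ g₃ : S, ρ₁ ∈ K ∧ ρ₂ ∈ K ∧ g₃ ∈ K ^ 2 ∧ IsUnit (β ^ 2 - 4 * α * γ) ∧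
      g = α * x ^ 2 + β * (x * y) + γ * y ^ 2 + x * ρ₁ + y * ρ₂ + g₃

theorem pivot_of {M : ℕ} (v : Fin M → S) (a : Fin M → Fin M → S) (i j : Fin M) (hij : i ≠ j)
    (hu : IsUnit ((a i j + a j i) ^ 2 - 4 * a i i * a j j)) :
    Piv M (Ideal.span (Set.range v)) (∑ i, ∑ j, a i j * (v i * v j)) := by
  obtain _ | _ | M := M
  · exact i.elim0
  · exact absurd (Fin.ext (by omega)) hij
  obtain ⟨j, rfl⟩ := Fin.exists_succAbove_eq hij.symm
  set x := v i
  set y := v (i.succAbove j)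
  set τ : Fin M → Fin (M + 2) := fun l => i.succAbove (j.succAbove l)
  refine ⟨M, x, y, Ideal.span (Set.range (fun l => v (τ l))), rfl, ⟨_, rfl⟩, ?_,
    a i i, a i (i.succAbove j) + a (i.succAbove j) i, a (i.succAbove j) (i.succAbove j),
    ∑ l, (a i (τ l) + a (τ l) i) * v (τ l),
    ∑ l, (a (i.succAbove j) (τ l) + a (τ l) (i.succAbove j)) * v (τ l),
    ∑ l, ∑ l', a (τ l) (τ l') * (v (τ l) * v (τ l')), ?_, ?_, ?_, hu, ?_⟩
  · rw [Ideal.span_insert, sup_assoc]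
    have h1 := span_succAbove (v ∘ i.succAbove) j
    have h2 := span_succAbove v i
    rw [← h1] at h2
    exact h2
  · exact Ideal.sum_mem _ fun l _ => Ideal.mul_mem_left _ _ (Ideal.subset_span ⟨l, rfl⟩)
  · exact Ideal.sum_mem _ fun l _ => Ideal.mul_mem_left _ _ (Ideal.subset_span ⟨l, rfl⟩)
  · refine Ideal.sum_mem _ fun l _ => Ideal.sum_mem _ fun l' _ => Ideal.mul_mem_left _ _ ?_
    rw [pow_two]
    exact Ideal.mul_mem_mul (Ideal.subset_span ⟨l, rfl⟩) (Ideal.subset_span ⟨l', rfl⟩)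
  · have ex : ∀ F : Fin (M + 2) → S, ∑ l, F l = F i + (F (i.succAbove j) + ∑ l, F (τ l)) := by
      intro F
      rw [Fin.sum_univ_succAbove F i, Fin.sum_univ_succAbove _ j]
    simp only [ex, Finset.sum_add_distrib, Finset.mul_sum, add_mul, mul_add]
    have c1 : ∀ l, x * (a i (τ l) * v (τ l)) = a i (τ l) * (x * v (τ l)) := fun l => by ring
    have c2 : ∀ l, x * (a (τ l) i * v (τ l)) = a (τ l) i * (v (τ l) * x) := fun l => by ring
    have c3 : ∀ l, y * (a (i.succAbove j) (τ l) * v (τ l))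
      = a (i.succAbove j) (τ l) * (y * v (τ l)) := fun l => by ring
    have c4 : ∀ l, y * (a (τ l) (i.succAbove j) * v (τ l))
      = a (τ l) (i.succAbove j) * (v (τ l) * y) := fun l => by ring
    simp only [c1, c2, c3, c4]
    change _ * (x * x) + (_ * (x * y) + _) + _ = _
    ring

theorem claim [Good S] {M : ℕ} {J : Ideal S} (hJ : Gen M J) {g : S} (hg : g ∈ J ^ 2) :
    Piv M J g ∨ g ∈ maximalIdeal S * J ^ 2 ∨
    ∃ M'' c z U, M = M'' + 1 ∧ Gen M'' U ∧ Ideal.span {z} ⊔ U = J ∧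
      g - c * z ^ 2 ∈ maximalIdeal S * J ^ 2 := by
  obtain ⟨v, rfl⟩ := hJ
  obtain ⟨a, rfl⟩ := exists_matrix v hg
  have hv : ∀ i, v i ∈ Ideal.span (Set.range v) := fun i => Ideal.subset_span ⟨i, rfl⟩
  by_cases hp : ∃ i j, i ≠ j ∧ IsUnit ((a i j + a j i) ^ 2 - 4 * a i i * a j j)
  · obtain ⟨i, j, hij, hu⟩ := hp
    exact Or.inl (pivot_of v a i j hij hu)
  have hp' : ∀ i j, i ≠ j → (a i j + a j i) ^ 2 - 4 * a i i * a j j ∈ maximalIdeal S := by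
    intro i j hij
    rw [← not_unit_iff]
    intro hu
    exact hp ⟨i, j, hij, hu⟩
  have hsq : ∀ x y : S, x ^ 2 - y ∈ maximalIdeal S → y ∈ maximalIdeal S →
      x ∈ maximalIdeal S := by
    intro x y h1 h2
    have := Ideal.add_mem _ h1 h2
    rw [sub_add_cancel] at this
    exact Ideal.IsPrime.mem_of_pow_mem inferInstance _ this
  by_cases hdiag : ∀ i, a i i ∈ maximalIdeal S
  · right; left
    refine mem_mul_sq _ _ v hv a hdiag fun i j hij => ?_
    exact hsq _ _ (hp' i j hij) (Ideal.mul_mem_left _ _ (hdiag j))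
  push Not at hdiag
  obtain ⟨i, hi⟩ := hdiag
  rw [← not_unit_iff, not_not] at hi
  obtain _ | M := M
  · exact i.elim0
  rcases (Good.two (S := S)) with h2 | ⟨h2, hs⟩
  · -- odd characteristic
    obtain ⟨τ, hτ⟩ : ∃ τ : S, τ * 2 = 1 := h2.exists_left_inv
    obtain ⟨b, hb⟩ : ∃ b : S, b * a i i = 1 := hi.exists_left_inv
    set s : Fin M → S := fun j => a i (i.succAbove j) + a (i.succAbove j) i with hsdef
    set u : Fin M → S := fun j => v (i.succAbove j) with hudef
    set z := v i + τ * b * ∑ j, s j * u j with hz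
    set B : Fin M → Fin M → S := fun j l => a (i.succAbove j) (i.succAbove l)
      - τ ^ 2 * b * (s j * s l) with hB
    have hsum : ∑ i, ∑ j, a i j * (v i * v j) = a i i * z ^ 2 + ∑ j, ∑ l, B j l * (u j * u l) := by
      have e1 : ∑ i, ∑ j, a i j * (v i * v j) = a i i * (v i * v i) + v i * ∑ j, s j * u j +
          ∑ j, ∑ l, a (i.succAbove j) (i.succAbove l) * (u j * u l) := by
        simp only [Fin.sum_univ_succAbove _ i, Finset.sum_add_distrib, hsdef, hudef, add_mul,
          Finset.mul_sum, mul_add]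
        have c1 : ∀ j, v i * (a i (i.succAbove j) * v (i.succAbove j)) =
          a i (i.succAbove j) * (v i * v (i.succAbove j)) := fun j => by ring
        have c2 : ∀ j, v i * (a (i.succAbove j) i * v (i.succAbove j)) =
          a (i.succAbove j) i * (v (i.succAbove j) * v i) := fun j => by ring
        simp only [c1, c2]
        ring
      have e2 : ∑ j, ∑ l, B j l * (u j * u l) =
          ∑ j, ∑ l, a (i.succAbove j) (i.succAbove l) * (u j * u l) -
            τ ^ 2 * b * ((∑ j, s j * u j) * (∑ j, s j * u j)) := by
        simp only [hB, sub_mul, Finset.sum_sub_distrib]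
        rw [Finset.sum_mul_sum]
        simp only [Finset.mul_sum]
        congr 1
        exact Finset.sum_congr rfl fun i _ => Finset.sum_congr rfl fun j _ => by ring
      rw [e1, e2, hz]
      generalize ∑ j, s j * u j = W
      linear_combination (- v i * W * a i i * b) * hτ - (τ ^ 2 * b * W ^ 2 + v i * W) * hb
    have hspan : Ideal.span {z} ⊔ Ideal.span (Set.range u) = Ideal.span (Set.range v) := by
      rw [← span_succAbove v i]
      have hW : ∑ j, s j * u j ∈ Ideal.span (Set.range u) :=
        Ideal.sum_mem _ fun l _ => Ideal.mul_mem_left _ _ (Ideal.subset_span ⟨l, rfl⟩)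
      apply le_antisymm
      · refine sup_le ?_ le_sup_right
        rw [Ideal.span_singleton_le_iff_mem]
        exact Ideal.add_mem _ (Ideal.mem_sup_left (Ideal.subset_span rfl))
          (Ideal.mem_sup_right (Ideal.mul_mem_left _ _ hW))
      · refine sup_le ?_ le_sup_right
        rw [Ideal.span_singleton_le_iff_mem]
        have : v i = z - τ * b * ∑ j, s j * u j := by rw [hz]; ring
        rw [this]
        exact Ideal.sub_mem _ (Ideal.mem_sup_left (Ideal.subset_span rfl))
          (Ideal.mem_sup_right (Ideal.mul_mem_left _ _ hW))
    set a' : Fin (M + 1) → Fin (M + 1) → S := Fin.cons (Fin.cons (a i i) (fun _ => 0))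
      (fun j => Fin.cons 0 (B j)) with ha'
    have hsum' : ∑ i, ∑ j, a i j * (v i * v j) =
        ∑ i, ∑ j, a' i j * ((Fin.cons z u : Fin (M + 1) → S) i *
          (Fin.cons z u : Fin (M + 1) → S) j) := by
      rw [hsum]
      simp only [ha', Fin.sum_univ_succ, Fin.cons_zero, Fin.cons_succ]
      simp
      ring
    by_cases hp2 : ∃ j l, j ≠ l ∧ IsUnit ((a' j l + a' l j) ^ 2 - 4 * a' j j * a' l l)
    · obtain ⟨j, l, hjl, hu⟩ := hp2
      have := pivot_of (Fin.cons z u : Fin (M + 1) → S) a' j l hjl hu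
      rw [span_cons, hspan, ← hsum'] at this
      exact Or.inl this
    · have hp2' : ∀ j l, j ≠ l → (a' j l + a' l j) ^ 2 - 4 * a' j j * a' l l ∈ maximalIdeal S := by
        intro j l hij
        rw [← not_unit_iff]
        intro hu
        exact hp2 ⟨j, l, hij, hu⟩
      have hBd : ∀ j, B j j ∈ maximalIdeal S := by
        intro j
        have := hp2' 0 j.succ (Fin.succ_ne_zero j).symm
        simp only [ha', Fin.cons_zero, Fin.cons_succ] at this
        have h4 : (0 + 0 : S) ^ 2 - 4 * a i i * B j j = (- (2 * 2 * a i i)) * B j j := by ring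
        rw [h4] at this
        have hun : IsUnit (-(2 * 2 * a i i)) := ((h2.mul h2).mul hi).neg
        rcases isUnit_or_mem (B j j) with h | h
        · exact absurd ((hun.mul h)) ((not_unit_iff _).2 this)
        · exact h
      right; right
      refine ⟨M, a i i, z, Ideal.span (Set.range u), rfl, ⟨u, rfl⟩, hspan, ?_⟩
      rw [hsum, add_sub_cancel_left]
      refine mem_mul_sq _ _ u (fun j => hv _) B hBd fun j l hjl => ?_
      have := hp2' j.succ l.succ (by simpa using hjl)
      simp only [ha', Fin.cons_succ] at this
      exact hsq _ _ this (Ideal.mul_mem_left _ _ (hBd l))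
  · choose s hs using fun j => hs (a j j)
    right; right
    set z := ∑ j, s j * v j with hz
    refine ⟨M, 1, z, Ideal.span (Set.range (v ∘ i.succAbove)), rfl, ⟨_, rfl⟩, ?_, ?_⟩
    · have hsi : IsUnit (s i) := by
        rcases isUnit_or_mem (s i) with h | h
        · exact h
        · exfalso
          have h3 : a i i ∈ maximalIdeal S := by
            have := Ideal.add_mem _ (hs i) (Ideal.pow_mem_of_mem _ h 2 (by norm_num))
            rwa [sub_add_cancel] at this
          exact (not_unit_iff _).2 h3 hi
      obtain ⟨b, hb⟩ := hsi.exists_left_inv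
      rw [← span_succAbove v i]
      have hzz : z = s i * v i + ∑ j, s (i.succAbove j) * v (i.succAbove j) := by
        rw [hz, Fin.sum_univ_succAbove _ i]
      have hW : ∑ j, s (i.succAbove j) * v (i.succAbove j) ∈
          Ideal.span (Set.range (v ∘ i.succAbove)) :=
        Ideal.sum_mem _ fun l _ => Ideal.mul_mem_left _ _ (Ideal.subset_span ⟨l, rfl⟩)
      apply le_antisymm
      · refine sup_le ?_ le_sup_right
        rw [Ideal.span_singleton_le_iff_mem, hzz]
        exact Ideal.add_mem _ (Ideal.mem_sup_left (Ideal.mul_mem_left _ _ (Ideal.subset_span rfl)))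
          (Ideal.mem_sup_right hW)
      · refine sup_le ?_ le_sup_right
        rw [Ideal.span_singleton_le_iff_mem]
        have : v i = b * z - b * ∑ j, s (i.succAbove j) * v (i.succAbove j) := by
          rw [hzz]; linear_combination (- v i) * hb
        rw [this]
        exact Ideal.sub_mem _ (Ideal.mem_sup_left (Ideal.mul_mem_left _ _ (Ideal.subset_span rfl)))
          (Ideal.mem_sup_right (Ideal.mul_mem_left _ _ hW))
    · have : ∑ i, ∑ j, a i j * (v i * v j) - 1 * z ^ 2 =
          ∑ i, ∑ j, (a i j - s i * s j) * (v i * v j) := by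
        simp only [sub_mul, Finset.sum_sub_distrib]
        congr 1
        rw [one_mul, hz, pow_two, Finset.sum_mul_sum]
        exact Finset.sum_congr rfl fun i _ => Finset.sum_congr rfl fun j _ => by ring
      rw [this]
      refine mem_mul_sq _ _ v hv _ (fun j => ?_) (fun j l hjl => ?_)
      · have := hs j; rwa [pow_two] at this
      · have h5 : a j l + a l j ∈ maximalIdeal S := by
          refine hsq _ _ (hp' j l hjl) ?_
          have : 4 * a j j * a l l = 2 * (2 * a j j * a l l) := by ring
          rw [this]
          exact Ideal.mul_mem_right _ _ h2
        have : a j l - s j * s l + (a l j - s l * s j) = a j l + a l j - 2 * (s j * s l) := by ring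
        rw [this]
        exact Ideal.sub_mem _ h5 (Ideal.mul_mem_right _ _ h2)

end quad
end SWY

end

section
namespace SWY
section hyp
variable {S : Type*} [CommRing S]

/-- hyperbolic sums -/
inductive Hy : ℕ → Ideal S → S → Prop
  | nil : Hy 0 ⊥ 0
  | cons {r : ℕ} {H : Ideal S} {h : S} (a b : S) (hh : Hy r H h) :
      Hy (r + 1) (Ideal.span {a, b} ⊔ H) (a * b + h)

theorem Hy.gen {r : ℕ} {H : Ideal S} {h : S} (hh : Hy r H h) : Gen (2 * r) H := by
  induction hh with
  | nil => exact Gen.zero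
  | cons a b _ ih =>
    have := (ih.cons b).cons a
    rw [Ideal.span_insert, sup_assoc]
    exact this

theorem Hy.mem {r : ℕ} {H : Ideal S} {h : S} (hh : Hy r H h) : h ∈ H ^ 2 := by
  induction hh with
  | nil => simp
  | cons a b _ ih =>
    refine Ideal.add_mem _ ?_ (Ideal.pow_right_mono le_sup_right 2 ih)
    rw [pow_two]
    exact Ideal.mul_mem_mul (Ideal.mem_sup_left (Ideal.subset_span (by simp)))
      (Ideal.mem_sup_left (Ideal.subset_span (by simp)))

theorem Hy.smul {r : ℕ} {H : Ideal S} {h : S} (hh : Hy r H h) {u : S} (hu : IsUnit u) :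
    Hy r H (u * h) := by
  induction hh with
  | nil => rw [mul_zero]; exact Hy.nil
  | @cons r H h a b _ ih =>
    have := ih.cons (u * a) b
    have e : Ideal.span {u * a, b} = Ideal.span {a, b} := by
      rw [Ideal.span_insert, Ideal.span_insert, Ideal.span_singleton_mul_left_unit hu]
    rw [e] at this
    convert this using 1
    ring

theorem Hy.absorb {r : ℕ} {H : Ideal S} {h : S} (hh : Hy r H h) (𝔞 : Ideal S) {ρ : S}
    (hρ : ρ ∈ H * 𝔞) (e : S) :
    ∃ H' h' s, Hy r H' h' ∧ s ∈ 𝔞 ^ 2 ∧ h + ρ * e = h' + s * e ^ 2 ∧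
      ∀ L : Ideal S, e ∈ L → H' ⊔ L = H ⊔ L := by
  induction hh generalizing ρ with
  | nil =>
    refine ⟨⊥, 0, 0, Hy.nil, by simp, ?_, fun _ _ => rfl⟩
    have : ρ = 0 := by simpa using hρ
    simp [this]
  | @cons r H h a b hh ih =>
    rw [Ideal.sup_mul, Ideal.span_insert, Ideal.sup_mul] at hρ
    obtain ⟨x, hx, ρ', hρ', rfl⟩ := Submodule.mem_sup.1 hρ
    obtain ⟨y, hy, z, hz, rfl⟩ := Submodule.mem_sup.1 hx
    obtain ⟨c, hc, rfl⟩ := Ideal.mem_span_singleton_mul.1 hy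
    obtain ⟨d, hd, rfl⟩ := Ideal.mem_span_singleton_mul.1 hz
    obtain ⟨H', h', s, h1, h2, h3, h4⟩ := ih hρ'
    refine ⟨_, _, s - c * d, h1.cons (a + d * e) (b + c * e), ?_, ?_, ?_⟩
    · refine Ideal.sub_mem _ h2 ?_
      rw [pow_two]; exact Ideal.mul_mem_mul hc hd
    · linear_combination h3
    · intro L hL
      rw [sup_assoc, h4 L hL, sup_assoc]
      have hde : ∀ c, c * e ∈ H ⊔ L := fun c => Ideal.mem_sup_right (Ideal.mul_mem_left _ _ hL)
      apply le_antisymm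
      · refine sup_le ?_ le_sup_right
        rw [Ideal.span_le]
        rintro x (rfl | rfl)
        · exact Ideal.add_mem _ (Ideal.mem_sup_left (Ideal.subset_span (by simp)))
            (Ideal.mem_sup_right (hde _))
        · exact Ideal.add_mem _ (Ideal.mem_sup_left (Ideal.subset_span (by simp)))
            (Ideal.mem_sup_right (hde _))
      · refine sup_le ?_ le_sup_right
        rw [Ideal.span_le]
        have ea : a = (a + d * e) - d * e := by ring
        have eb : b = (b + c * e) - c * e := by ring
        rintro x (rfl | rfl)
        · rw [ea]
          exact Ideal.sub_mem _ (Ideal.mem_sup_left (Ideal.subset_span (by simp)))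
            (Ideal.mem_sup_right (hde _))
        · rw [eb]
          exact Ideal.sub_mem _ (Ideal.mem_sup_left (Ideal.subset_span (by simp)))
            (Ideal.mem_sup_right (hde _))

theorem Hy.tuple {r : ℕ} {H : Ideal S} {h : S} (hh : Hy r H h) :
    ∃ Y : ℕ → S, Ideal.span (Y '' Set.Iio (2 * r)) = H ∧
      h = ∑ i ∈ Finset.range r, Y (2 * i) * Y (2 * i + 1) := by
  induction hh with
  | nil => exact ⟨0, by simp, by simp⟩
  | @cons r H h a b _ ih =>
    obtain ⟨Y, rfl, rfl⟩ := ih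
    let Y' : ℕ → S := fun n => if n = 0 then a else if n = 1 then b else Y (n - 2)
    refine ⟨Y', ?_, ?_⟩
    · rw [← Ideal.span_union]
      congr 1
      ext x
      constructor
      · rintro ⟨n, hn, rfl⟩
        simp only [Set.mem_Iio] at hn
        by_cases h0 : n = 0
        · simp [Y', h0]
        by_cases h1 : n = 1
        · simp [Y', h1]
        · right
          exact ⟨n - 2, by simp; omega, by simp [Y', h0, h1]⟩
      · rintro ((rfl | rfl) | ⟨n, hn, rfl⟩)
        · exact ⟨0, by simp, by simp [Y']⟩
        · exact ⟨1, by simp; omega, by simp [Y']⟩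
        · simp only [Set.mem_Iio] at hn
          exact ⟨n + 2, by simp; omega, by simp [Y']⟩
    · rw [Finset.sum_range_succ', add_comm]
      congr 1

end hyp

section split
variable {S : Type*} [CommRing S] [IsLocalRing S]
open IsLocalRing

theorem hsplit [Good S] (x y : S) (K 𝔞 : Ideal S) (α β γ ρ₁ ρ₂ : S) (h1 : ρ₁ ∈ 𝔞 * K)
    (h2 : ρ₂ ∈ 𝔞 * K) (hu : IsUnit (β ^ 2 - 4 * α * γ)) :
    ∃ a b s, s ∈ (𝔞 * K) ^ 2 ∧ Ideal.span {a, b} ⊔ K = Ideal.span {x, y} ⊔ K ∧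
      α * x ^ 2 + β * (x * y) + γ * y ^ 2 + x * ρ₁ + y * ρ₂ = a * b + s := by
  obtain ⟨w, hw, hw2⟩ := Good.hh α β γ hu
  have hδ : IsUnit (w ^ 2 - α * γ) := by
    have e : (β ^ 2 - 4 * α * γ) * w ^ 2 = (w ^ 2 - α * γ) ^ 2 := by
      linear_combination (-β * w - w ^ 2 + (- α * γ) ) * hw2
    have := hu.mul (hw.pow 2)
    rw [e] at this
    exact isUnit_of_mul_isUnit_left (by rwa [pow_two] at this)
  obtain ⟨ω, hω⟩ := hw.exists_left_inv
  obtain ⟨δ, hδ'⟩ := hδ.exists_left_inv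
  -- a₁ = x + ω γ y, b₁ = α x + w y
  -- x = δ (w * w * a₁ - γ b₁), y = δ (w b₁ - α w a₁)
  obtain ⟨a₁, ha⟩ : ∃ c, c = x + ω * γ * y := ⟨_, rfl⟩
  obtain ⟨b₁, hb⟩ : ∃ c, c = α * x + w * y := ⟨_, rfl⟩
  have hx : x = δ * (w ^ 2 * a₁ - γ * b₁) := by
    rw [ha, hb]; linear_combination (- x) * hδ' - δ * w * γ * y * hω
  have hy : y = δ * (w * b₁ - α * w * a₁) := by
    rw [ha, hb]; linear_combination (- y) * hδ' + α * γ * y * δ * hω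
  obtain ⟨σ₁, hσ1⟩ : ∃ c, c = δ * (w ^ 2 * ρ₁ - α * w * ρ₂) := ⟨_, rfl⟩
  obtain ⟨σ₂, hσ2⟩ : ∃ c, c = δ * (w * ρ₂ - γ * ρ₁) := ⟨_, rfl⟩
  have m1 : σ₁ ∈ 𝔞 * K := by
    rw [hσ1]
    refine Ideal.mul_mem_left _ _ ?_
    exact (Ideal.sub_mem _ (Ideal.mul_mem_left _ _ h1) (Ideal.mul_mem_left _ _ h2))
  have m2 : σ₂ ∈ 𝔞 * K := by
    rw [hσ2]
    refine Ideal.mul_mem_left _ _ ?_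
    exact (Ideal.sub_mem _ (Ideal.mul_mem_left _ _ h2) (Ideal.mul_mem_left _ _ h1))
  have k1 : σ₁ ∈ K := (Ideal.mul_le_right : 𝔞 * K ≤ K) m1
  have k2 : σ₂ ∈ K := (Ideal.mul_le_right : 𝔞 * K ≤ K) m2
  refine ⟨a₁ + σ₂, b₁ + σ₁, -(σ₁ * σ₂), ?_, ?_, ?_⟩
  · rw [pow_two]; exact neg_mem (Ideal.mul_mem_mul m1 m2)
  · have mx : x ∈ Ideal.span {x, y} ⊔ K := Ideal.mem_sup_left (Ideal.subset_span (by simp))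
    have my : y ∈ Ideal.span {x, y} ⊔ K := Ideal.mem_sup_left (Ideal.subset_span (by simp))
    have ma : a₁ + σ₂ ∈ Ideal.span {a₁ + σ₂, b₁ + σ₁} ⊔ K :=
      Ideal.mem_sup_left (Ideal.subset_span (by simp))
    have mb : b₁ + σ₁ ∈ Ideal.span {a₁ + σ₂, b₁ + σ₁} ⊔ K :=
      Ideal.mem_sup_left (Ideal.subset_span (by simp))
    have ma' : a₁ ∈ Ideal.span {a₁ + σ₂, b₁ + σ₁} ⊔ K := by
      have := Ideal.sub_mem _ ma (Ideal.mem_sup_right k2)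
      rwa [add_sub_cancel_right] at this
    have mb' : b₁ ∈ Ideal.span {a₁ + σ₂, b₁ + σ₁} ⊔ K := by
      have := Ideal.sub_mem _ mb (Ideal.mem_sup_right k1)
      rwa [add_sub_cancel_right] at this
    apply le_antisymm
    · refine sup_le ?_ le_sup_right
      rw [Ideal.span_le]
      rintro t (rfl | rfl)
      · rw [ha]; exact Ideal.add_mem _ (Ideal.add_mem _ mx (Ideal.mul_mem_left _ _ my))
          (Ideal.mem_sup_right k2)
      · rw [hb]; exact Ideal.add_mem _ (Ideal.add_mem _ (Ideal.mul_mem_left _ _ mx)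
          (Ideal.mul_mem_left _ _ my)) (Ideal.mem_sup_right k1)
    · refine sup_le ?_ le_sup_right
      rw [Ideal.span_le]
      rintro t (rfl | rfl)
      · rw [hx]
        exact Ideal.mul_mem_left _ _ (Ideal.sub_mem _ (Ideal.mul_mem_left _ _ ma')
          (Ideal.mul_mem_left _ _ mb'))
      · rw [hy]
        exact Ideal.mul_mem_left _ _ (Ideal.sub_mem _ (Ideal.mul_mem_left _ _ mb')
          (Ideal.mul_mem_left _ _ ma'))
  · have e1 : α * x ^ 2 + β * (x * y) + γ * y ^ 2 = a₁ * b₁ := by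
      rw [ha, hb]
      linear_combination (- γ * y ^ 2 - x * y * β + x * y * w) * hω - x * y * ω * hw2
    have e2 : x * ρ₁ + y * ρ₂ = a₁ * σ₁ + b₁ * σ₂ := by
      conv_lhs => rw [hx, hy]
      rw [hσ1, hσ2]; ring
    linear_combination e1 + e2

/-- Lemma G -/
theorem lemG [Good S] {M : ℕ} {J : Ideal S} (hJ : Gen M J) {g : S} (hg : g ∈ J ^ 2) :
    ∃ r H h Z g', Hy r H h ∧ H ⊔ Z = J ∧ g = h + g' ∧
      ((∃ M', 2 * r + M' = M ∧ Gen M' Z ∧ g' ∈ maximalIdeal S * Z ^ 2) ∨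
       (∃ M' c z U, 2 * r + M' + 1 = M ∧ Gen M' U ∧ Ideal.span {z} ⊔ U = Z ∧
          g' - c * z ^ 2 ∈ maximalIdeal S * Z ^ 2)) := by
  induction M using Nat.strong_induction_on generalizing J g with
  | _ M ih =>
  rcases claim hJ hg with h | h | ⟨M', c, z, U, hM, hU, hz, h⟩
  · obtain ⟨M'', x, y, K, rfl, hK, hxy, α, β, γ, ρ₁, ρ₂, g₃, h1, h2, h3, hu, rfl⟩ := h
    obtain ⟨a, b, s, hs, hab, e⟩ := hsplit x y K ⊤ α β γ ρ₁ ρ₂ (by rwa [Ideal.top_mul])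
      (by rwa [Ideal.top_mul]) hu
    rw [Ideal.top_mul] at hs
    obtain ⟨r, H, h, Z, g', i1, i2, i3, i4⟩ := ih M'' (by omega) hK (Ideal.add_mem _ hs h3)
    refine ⟨r + 1, _, _, Z, g', i1.cons a b, ?_, ?_, ?_⟩
    · rw [sup_assoc, i2, hab, hxy]
    · rw [e, add_assoc, i3]; ring
    · rcases i4 with ⟨M', j1, j2⟩ | ⟨M', c, z, U, j1, j2⟩
      · exact Or.inl ⟨M', by omega, j2⟩
      · exact Or.inr ⟨M', c, z, U, by omega, j2⟩
  · exact ⟨0, ⊥, 0, J, g, Hy.nil, by simp, by simp, Or.inl ⟨M, by simp, hJ, h⟩⟩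
  · exact ⟨0, ⊥, 0, J, g, Hy.nil, by simp, by simp, Or.inr ⟨M', c, z, U, by omega, hU, hz, h⟩⟩

end split
end SWY

end

section
namespace SWY
section degen
variable {S : Type*} [CommRing S]

theorem sq_le_of {𝔪 H L : Ideal S} (h : H ⊔ L = 𝔪) : 𝔪 ^ 2 ≤ H * 𝔪 ⊔ L ^ 2 := by
  have h1 : 𝔪 ^ 2 = H * 𝔪 ⊔ L * 𝔪 := by rw [pow_two, ← Ideal.sup_mul, h]
  have h2 : L * 𝔪 = L * H ⊔ L * L := by rw [← Ideal.mul_sup, h]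
  rw [h1, h2]
  refine sup_le le_sup_left (sup_le ?_ (by rw [pow_two]; exact le_sup_right))
  refine le_trans ?_ le_sup_left
  rw [mul_comm]
  exact Ideal.mul_mono_right (h ▸ le_sup_right)

theorem mem_span_sq {x a : S} (h : a ∈ Ideal.span {x} ^ 2) : ∃ s, a = s * x ^ 2 := by
  rw [Ideal.span_singleton_pow] at h
  obtain ⟨s, hs⟩ := Ideal.mem_span_singleton'.1 h
  exact ⟨s, hs.symm⟩

theorem dec_sq {𝔞 K : Ideal S} {x y δ : S} (h : δ ∈ 𝔞 * (Ideal.span {x} ⊔ (Ideal.span {y} ⊔ K)) ^ 2) :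
    ∃ α β γ ρ₁ ρ₂ g₃ : S, α ∈ 𝔞 ∧ β ∈ 𝔞 ∧ γ ∈ 𝔞 ∧ ρ₁ ∈ 𝔞 * K ∧ ρ₂ ∈ 𝔞 * K ∧ g₃ ∈ 𝔞 * K ^ 2 ∧
      δ = α * x ^ 2 + β * (x * y) + γ * y ^ 2 + x * ρ₁ + y * ρ₂ + g₃ := by
  have hadd : ∀ a b : S, (∃ α β γ ρ₁ ρ₂ g₃ : S, α ∈ 𝔞 ∧ β ∈ 𝔞 ∧ γ ∈ 𝔞 ∧ ρ₁ ∈ 𝔞 * K ∧ ρ₂ ∈ 𝔞 * K ∧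
      g₃ ∈ 𝔞 * K ^ 2 ∧ a = α * x ^ 2 + β * (x * y) + γ * y ^ 2 + x * ρ₁ + y * ρ₂ + g₃) →
      (∃ α β γ ρ₁ ρ₂ g₃ : S, α ∈ 𝔞 ∧ β ∈ 𝔞 ∧ γ ∈ 𝔞 ∧ ρ₁ ∈ 𝔞 * K ∧ ρ₂ ∈ 𝔞 * K ∧
      g₃ ∈ 𝔞 * K ^ 2 ∧ b = α * x ^ 2 + β * (x * y) + γ * y ^ 2 + x * ρ₁ + y * ρ₂ + g₃) →
      (∃ α β γ ρ₁ ρ₂ g₃ : S, α ∈ 𝔞 ∧ β ∈ 𝔞 ∧ γ ∈ 𝔞 ∧ ρ₁ ∈ 𝔞 * K ∧ ρ₂ ∈ 𝔞 * K ∧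
      g₃ ∈ 𝔞 * K ^ 2 ∧ a + b = α * x ^ 2 + β * (x * y) + γ * y ^ 2 + x * ρ₁ + y * ρ₂ + g₃) := by
    rintro a b ⟨α, β, γ, ρ₁, ρ₂, g₃, h1, h2, h3, h4, h5, h6, rfl⟩
      ⟨α', β', γ', ρ₁', ρ₂', g₃', h1', h2', h3', h4', h5', h6', rfl⟩
    exact ⟨α + α', β + β', γ + γ', ρ₁ + ρ₁', ρ₂ + ρ₂', g₃ + g₃', add_mem h1 h1', add_mem h2 h2',
      add_mem h3 h3', add_mem h4 h4', add_mem h5 h5', add_mem h6 h6', by ring⟩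
  refine Submodule.mul_induction_on h ?_ hadd
  intro c hc n hn
  rw [pow_two] at hn
  refine Submodule.mul_induction_on hn ?_ ?_
  · intro s hs t ht
    obtain ⟨s1, hs1, s', hs', rfl⟩ := Submodule.mem_sup.1 hs
    obtain ⟨s2, hs2, κ, hκ, rfl⟩ := Submodule.mem_sup.1 hs'
    obtain ⟨t1, ht1, t', ht', rfl⟩ := Submodule.mem_sup.1 ht
    obtain ⟨t2, ht2, κ', hκ', rfl⟩ := Submodule.mem_sup.1 ht'
    obtain ⟨s1, rfl⟩ := Ideal.mem_span_singleton'.1 hs1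
    obtain ⟨s2, rfl⟩ := Ideal.mem_span_singleton'.1 hs2
    obtain ⟨t1, rfl⟩ := Ideal.mem_span_singleton'.1 ht1
    obtain ⟨t2, rfl⟩ := Ideal.mem_span_singleton'.1 ht2
    refine ⟨c * (s1 * t1), c * (s1 * t2 + s2 * t1), c * (s2 * t2), c * (s1 * κ' + t1 * κ),
      c * (s2 * κ' + t2 * κ), c * (κ * κ'), Ideal.mul_mem_right _ _ hc, Ideal.mul_mem_right _ _ hc,
      Ideal.mul_mem_right _ _ hc, ?_, ?_, ?_, ?_⟩
    · exact Ideal.mul_mem_mul hc (add_mem (Ideal.mul_mem_left _ _ hκ') (Ideal.mul_mem_left _ _ hκ))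
    · exact Ideal.mul_mem_mul hc (add_mem (Ideal.mul_mem_left _ _ hκ') (Ideal.mul_mem_left _ _ hκ))
    · rw [pow_two]
      exact Ideal.mul_mem_mul hc (Ideal.mul_mem_mul hκ hκ')
    · ring
  · intro a b ha hb
    rw [mul_add]
    exact hadd _ _ ha hb

variable [IsLocalRing S]
open IsLocalRing

variable {k : Type*} [Field k] [Algebra k S]

/-- residue field assumption -/
theorem exists_bad (hres : ∀ a : S, ∃ t : k, a - algebraMap k S t ∈ maximalIdeal S) (a : S) :
    ∃ t0 : k, ∀ t, t ≠ t0 → IsUnit (a + algebraMap k S t) := by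
  obtain ⟨t, ht⟩ := hres a
  refine ⟨-t, fun t' ht' => ?_⟩
  have : a + algebraMap k S t' = algebraMap k S (t + t') + (a - algebraMap k S t) := by
    rw [map_add]; ring
  rw [this]
  refine isUnit_add_mem (RingHom.isUnit_map _ (isUnit_iff_ne_zero.2 ?_)) ht
  intro h
  exact ht' (eq_neg_of_add_eq_zero_right h)

theorem degen_E1 (hres : ∀ a : S, ∃ t : k, a - algebraMap k S t ∈ maximalIdeal S)
    (P : S → Prop)
    (hdef : ∀ f G : S, ∀ B : Set k, B.Finite → (∀ t, t ∉ B → P (f + algebraMap k S t * G)) → P f)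
    (r : ℕ)
    (hf1 : ∀ H h w V, Hy r H h → H ⊔ Ideal.span {w} = maximalIdeal S → IsUnit V →
      P (h + V * w ^ 3))
    (H : Ideal S) (h w : S) (hH : Hy r H h) (hm : H ⊔ Ideal.span {w} = maximalIdeal S)
    (h'' : S) (hh : h'' ∈ maximalIdeal S ^ 2) : P (h + w * h'') := by
  obtain ⟨ρ, hρ, s', hs', rfl⟩ := Submodule.mem_sup.1 (sq_le_of hm hh)
  obtain ⟨s, rfl⟩ := mem_span_sq hs'
  obtain ⟨H1, h1, s1, hH1, hs1, e1, hL1⟩ := hH.absorb _ hρ w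
  have hm1 := hL1 _ (Ideal.mem_span_singleton_self w)
  rw [hm] at hm1
  obtain ⟨ρ', hρ', s2', hs2', rfl⟩ := Submodule.mem_sup.1 (sq_le_of hm1 hs1)
  obtain ⟨s2, rfl⟩ := mem_span_sq hs2'
  obtain ⟨H2, h2, s3, hH2, -, e2, hL2⟩ := hH1.absorb _ hρ' (w ^ 2)
  have hm2 := hL2 (Ideal.span {w})
    (Ideal.pow_mem_of_mem _ (Ideal.mem_span_singleton_self w) 2 (by norm_num))
  rw [hm1] at hm2
  have hw : w ∈ maximalIdeal S := by
    rw [← hm]; exact Ideal.mem_sup_right (Ideal.mem_span_singleton_self w)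
  obtain ⟨t0, ht0⟩ := exists_bad hres (s + s2 * w + s3 * w)
  refine hdef _ (w ^ 3) {t0} (Set.finite_singleton _) fun t ht => ?_
  have := hf1 H2 h2 w _ hH2 hm2 (ht0 t ht)
  convert this using 1
  linear_combination e1 + e2

theorem degen_E2 (hres : ∀ a : S, ∃ t : k, a - algebraMap k S t ∈ maximalIdeal S)
    (h23 : IsUnit (2 : S) ∨ IsUnit (3 : S))
    (P : S → Prop)
    (hdef : ∀ f G : S, ∀ B : Set k, B.Finite → (∀ t, t ∉ B → P (f + algebraMap k S t * G)) → P f)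
    (r : ℕ)
    (hf1 : ∀ H h z w U V, Hy r H h → H ⊔ (Ideal.span {z} ⊔ Ideal.span {w}) = maximalIdeal S →
      IsUnit U → IsUnit V → P (h + U * z ^ 2 + V * w ^ 3))
    (H : Ideal S) (h z w : S) (hH : Hy r H h)
    (hm : H ⊔ (Ideal.span {z} ⊔ Ideal.span {w}) = maximalIdeal S)
    (c h'' : S) (hh : h'' ∈ maximalIdeal S ^ 2) : P (h + c * z ^ 2 + w * h'') := by
  have hdec : ∀ a ∈ (Ideal.span {z} ⊔ Ideal.span {w}) ^ 2, ∃ α β γ : S,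
      a = α * z ^ 2 + β * (z * w) + γ * w ^ 2 := by
    intro a ha
    have : a ∈ (⊤ : Ideal S) * (Ideal.span {z} ⊔ (Ideal.span {w} ⊔ ⊥)) ^ 2 := by
      rw [Ideal.top_mul, sup_bot_eq]; exact ha
    obtain ⟨α, β, γ, ρ₁, ρ₂, g₃, -, -, -, h1, h2, h3, e⟩ := dec_sq this
    refine ⟨α, β, γ, ?_⟩
    have e1 : ρ₁ = 0 := by simpa using h1
    have e2 : ρ₂ = 0 := by simpa using h2
    have e3 : g₃ = 0 := by simpa [pow_two] using h3
    rw [e, e1, e2, e3]; ring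
  have hwL : w ∈ Ideal.span {z} ⊔ Ideal.span {w} :=
    Ideal.mem_sup_right (Ideal.mem_span_singleton_self w)
  have hzL : z ∈ Ideal.span {z} ⊔ Ideal.span {w} :=
    Ideal.mem_sup_left (Ideal.mem_span_singleton_self z)
  have hw : w ∈ maximalIdeal S := by rw [← hm]; exact Ideal.mem_sup_right hwL
  have hz : z ∈ maximalIdeal S := by rw [← hm]; exact Ideal.mem_sup_right hzL
  obtain ⟨ρ, hρ, s', hs', rfl⟩ := Submodule.mem_sup.1 (sq_le_of hm hh)
  obtain ⟨α, β, s, rfl⟩ := hdec _ hs'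
  obtain ⟨H1, h1, s1, hH1, hs1, e1, hL1⟩ := hH.absorb _ hρ w
  have hm1 := hL1 _ hwL
  rw [hm] at hm1
  obtain ⟨ρ', hρ', s2', hs2', rfl⟩ := Submodule.mem_sup.1 (sq_le_of hm1 hs1)
  obtain ⟨α1, β1, γ1, rfl⟩ := hdec _ hs2'
  obtain ⟨H2, h2, s3, hH2, -, e2, hL2⟩ := hH1.absorb _ hρ' (w ^ 2)
  have hm2 := hL2 _ (Ideal.pow_mem_of_mem _ hwL 2 (by norm_num))
  rw [hm1] at hm2
  obtain ⟨t1, ht1⟩ := exists_bad hres (c + α * w + α1 * w ^ 2)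
  obtain ⟨t2, ht2⟩ := exists_bad hres (s + γ1 * w + s3 * w)
  refine hdef _ (z ^ 2 + w ^ 3) {t1, t2} (by simp) fun t ht => ?_
  simp only [Set.mem_insert_iff, Set.mem_singleton_iff, not_or] at ht
  have hU := ht1 t ht.1
  have hV := ht2 t ht.2
  obtain ⟨U, hUe⟩ : ∃ U, U = c + α * w + α1 * w ^ 2 + algebraMap k S t := ⟨_, rfl⟩
  obtain ⟨V, hVe⟩ : ∃ V, V = s + γ1 * w + s3 * w + algebraMap k S t := ⟨_, rfl⟩
  obtain ⟨B, hBe⟩ : ∃ B, B = β + β1 * w := ⟨_, rfl⟩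
  rw [← hUe] at hU
  rw [← hVe] at hV
  have key : h + c * z ^ 2 + w * (ρ + (α * z ^ 2 + β * (z * w) + s * w ^ 2)) +
      algebraMap k S t * (z ^ 2 + w ^ 3) = h2 + U * z ^ 2 + B * (z * w ^ 2) + V * w ^ 3 := by
    rw [hUe, hVe, hBe]
    linear_combination e1 + e2
  rw [key]
  rcases h23 with h | h
  · obtain ⟨τ, hτ⟩ := h.exists_left_inv
    obtain ⟨b, hb⟩ := hU.exists_left_inv
    have hV' : IsUnit (V + (-(τ ^ 2 * b * B ^ 2)) * w) :=
      isUnit_add_mem hV (Ideal.mul_mem_left _ _ hw)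
    have := hf1 H2 h2 (z + τ * b * B * w ^ 2) w U _ hH2 ?_ hU hV'
    · convert this using 1
      linear_combination (- τ ^ 2 * b * B ^ 2 * w ^ 4 - B * z * w ^ 2 ) * hb
        - U * z * b * B * w ^ 2 * hτ
    · rw [← hm2]
      congr 1
      apply le_antisymm
      · refine sup_le ?_ le_sup_right
        rw [Ideal.span_singleton_le_iff_mem]
        refine add_mem hzL ?_
        rw [pow_two, ← mul_assoc]
        exact Ideal.mul_mem_left _ _ hwL
      · refine sup_le ?_ le_sup_right
        rw [Ideal.span_singleton_le_iff_mem]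
        have : z = (z + τ * b * B * w ^ 2) - (τ * b * B * w) * w := by ring
        rw [this]
        exact sub_mem (Ideal.mem_sup_left (Ideal.subset_span (by ring_nf; rfl)))
          (Ideal.mul_mem_left _ _ (Ideal.mem_sup_right (Ideal.mem_span_singleton_self w)))
  · obtain ⟨τ, hτ⟩ := h.exists_left_inv
    obtain ⟨b, hb⟩ := hV.exists_left_inv
    obtain ⟨lam, hlam⟩ : ∃ lam, lam = τ * b * B := ⟨_, rfl⟩
    have hB : B = 3 * V * lam := by
      rw [hlam]; linear_combination (- B) * hτ - 3 * τ * B * hb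
    have hU' : IsUnit (U + (-(3 * V * lam ^ 2) * w + (- (V * lam ^ 3)) * z)) :=
      isUnit_add_mem hU (add_mem (Ideal.mul_mem_left _ _ hw) (Ideal.mul_mem_left _ _ hz))
    have := hf1 H2 h2 z (w + lam * z) _ V hH2 ?_ hU' hV
    · convert this using 1
      rw [hB]; ring
    · rw [← hm2]
      congr 1
      apply le_antisymm
      · refine sup_le le_sup_left ?_
        rw [Ideal.span_singleton_le_iff_mem]
        exact add_mem hwL (Ideal.mul_mem_left _ _ hzL)
      · refine sup_le le_sup_left ?_
        rw [Ideal.span_singleton_le_iff_mem]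
        have : w = (w + lam * z) - lam * z := by ring
        have q1 : w + lam * z ∈ Ideal.span {z} ⊔ Ideal.span {w + lam * z} :=
          Ideal.mem_sup_right (Ideal.mem_span_singleton_self _)
        have q2 : z ∈ Ideal.span {z} ⊔ Ideal.span {w + lam * z} :=
          Ideal.mem_sup_left (Ideal.mem_span_singleton_self _)
        have h3 := sub_mem q1 (Ideal.mul_mem_left _ lam q2)
        rwa [← this] at h3

theorem degen_B [Good S] (hres : ∀ a : S, ∃ t : k, a - algebraMap k S t ∈ maximalIdeal S)
    (h23 : IsUnit (2 : S) ∨ IsUnit (3 : S))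
    (P : S → Prop)
    (hdef : ∀ f G : S, ∀ B : Set k, B.Finite → (∀ t, t ∉ B → P (f + algebraMap k S t * G)) → P f)
    (d : ℕ)
    (hf1 : ∀ r H h w V, 2 * r = d → Hy r H h → H ⊔ Ideal.span {w} = maximalIdeal S → IsUnit V →
      P (h + V * w ^ 3))
    (hf2 : ∀ r H h z w U V, 2 * r + 1 = d → Hy r H h →
      H ⊔ (Ideal.span {z} ⊔ Ideal.span {w}) = maximalIdeal S →
      IsUnit U → IsUnit V → P (h + U * z ^ 2 + V * w ^ 3))
    (w h'' : S) (hh : h'' ∈ maximalIdeal S ^ 2)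
    (M r : ℕ) (H Z : Ideal S) (h g' : S) (hH : Hy r H h)
    (hm : H ⊔ (Z ⊔ Ideal.span {w}) = maximalIdeal S) (hZ : Gen M Z) (hM : 2 * r + M = d)
    (hg : g' ∈ maximalIdeal S * Z ^ 2 ∨ ∃ M' c z U, M = M' + 1 ∧ Gen M' U ∧
      Ideal.span {z} ⊔ U = Z ∧ g' - c * z ^ 2 ∈ maximalIdeal S * Z ^ 2) :
    P (h + g' + w * h'') := by
  induction M using Nat.strong_induction_on generalizing r H Z h g' with
  | _ M ih =>
  obtain _ | M := M
  · have hZ0 := hZ.eq_bot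
    subst hZ0
    rcases hg with hg | ⟨M', c, z, U, h0, -⟩
    · have : g' = 0 := by simpa [pow_two] using hg
      rw [this, add_zero]
      rw [bot_sup_eq] at hm
      exact degen_E1 hres P hdef r (fun H h w V h1 h2 h3 => hf1 r H h w V (by omega) h1 h2 h3)
        H h w hH hm h'' hh
    · omega
  · have hg' : ∃ c z U, Gen M U ∧ Ideal.span {z} ⊔ U = Z ∧
        g' - c * z ^ 2 ∈ maximalIdeal S * Z ^ 2 := by
      rcases hg with hg | ⟨M', c, z, U, h0, h1, h2, h3⟩
      · obtain ⟨z, U, hU, hz⟩ := hZ.uncons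
        exact ⟨0, z, U, hU, hz, by simpa using hg⟩
      · obtain rfl : M = M' := by omega
        exact ⟨c, z, U, h1, h2, h3⟩
    obtain ⟨c, z, U, hU, rfl, hg'⟩ := hg'
    obtain _ | M := M
    · have hU0 := hU.eq_bot
      subst hU0
      rw [sup_bot_eq] at hg' hm
      have h5 : g' - c * z ^ 2 ∈ Ideal.span {z} ^ 2 := Ideal.mul_le_right hg'
      obtain ⟨s, hs⟩ := mem_span_sq h5
      have : g' = (c + s) * z ^ 2 := by linear_combination hs
      rw [this]
      exact degen_E2 hres h23 P hdef r
        (fun H h z w U V h1 h2 h3 h4 => hf2 r H h z w U V (by omega) h1 h2 h3 h4)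
        H h z w hH hm (c + s) h'' hh
    · obtain ⟨u, U', hU', rfl⟩ := hU.uncons
      obtain ⟨α, β, γ, ρ₁, ρ₂, g₃, m1, m2, m3, m4, m5, m6, e⟩ := dec_sq hg'
      refine hdef _ (z * u) {0} (Set.finite_singleton _) fun t ht => ?_
      have hu : IsUnit ((β + algebraMap k S t) ^ 2 - 4 * (c + α) * γ) := by
        have e2 : (β + algebraMap k S t) ^ 2 - 4 * (c + α) * γ = algebraMap k S (t ^ 2) +
            ((β + 2 * algebraMap k S t) * β - 4 * (c + α) * γ) := by
          rw [map_pow]; ring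
        rw [e2]
        refine isUnit_add_mem (RingHom.isUnit_map _ (isUnit_iff_ne_zero.2 (pow_ne_zero _ ht))) ?_
        exact sub_mem (Ideal.mul_mem_left _ _ m2) (Ideal.mul_mem_left _ _ m3)
      obtain ⟨a, b, s, hs, hab, e3⟩ := hsplit z u U' (maximalIdeal S) (c + α)
        (β + algebraMap k S t) γ ρ₁ ρ₂ m4 m5 hu
      have hs' : s ∈ maximalIdeal S * U' ^ 2 := by
        rw [mul_pow] at hs
        exact Ideal.mul_mono_left (Ideal.pow_le_self (by norm_num)) hs
      have := ih M (by omega) (r + 1) _ U' _ (s + g₃) (hH.cons a b) ?_ hU' (by omega)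
        (Or.inl (add_mem hs' m6))
      · convert this using 1
        linear_combination e + e3
      · rw [← hm]
        have e4 : Ideal.span {a, b} ⊔ H ⊔ (U' ⊔ Ideal.span {w}) =
            (Ideal.span {a, b} ⊔ U') ⊔ (H ⊔ Ideal.span {w}) := by ac_rfl
        rw [e4, hab, Ideal.span_insert]
        ac_rfl

theorem degen_main [Good S] (hres : ∀ a : S, ∃ t : k, a - algebraMap k S t ∈ maximalIdeal S)
    (h23 : IsUnit (2 : S) ∨ IsUnit (3 : S))
    (P : S → Prop)
    (hdef : ∀ f G : S, ∀ B : Set k, B.Finite → (∀ t, t ∉ B → P (f + algebraMap k S t * G)) → P f)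
    (d : ℕ)
    (hf1 : ∀ r H h w V, 2 * r = d → Hy r H h → H ⊔ Ideal.span {w} = maximalIdeal S → IsUnit V →
      P (h + V * w ^ 3))
    (hf2 : ∀ r H h z w U V, 2 * r + 1 = d → Hy r H h →
      H ⊔ (Ideal.span {z} ⊔ Ideal.span {w}) = maximalIdeal S →
      IsUnit U → IsUnit V → P (h + U * z ^ 2 + V * w ^ 3))
    (w : S) (K : Ideal S) (hK : Gen d K) (hm : Ideal.span {w} ⊔ K = maximalIdeal S)
    (f : S) (hf : f ∈ K ^ 2 ⊔ maximalIdeal S ^ 3) : P f := by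
  have hle : K ^ 2 ⊔ maximalIdeal S ^ 3 ≤ K ^ 2 ⊔ Ideal.span {w} * maximalIdeal S ^ 2 := by
    refine sup_le le_sup_left ?_
    have h1 : maximalIdeal S ^ 3 = Ideal.span {w} * maximalIdeal S ^ 2 ⊔ K * maximalIdeal S ^ 2 := by
      rw [← Ideal.sup_mul, hm]; ring
    rw [h1]
    refine sup_le le_sup_right ?_
    have h2 : maximalIdeal S ^ 2 = maximalIdeal S * Ideal.span {w} ⊔ maximalIdeal S * K := by
      rw [← Ideal.mul_sup, hm, pow_two]
    have hKm : K ≤ maximalIdeal S := hm ▸ le_sup_right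
    conv_lhs => rw [h2, Ideal.mul_sup]
    refine sup_le ?_ ?_
    · refine le_trans ?_ le_sup_right
      rw [← mul_assoc, mul_comm, pow_two]
      exact Ideal.mul_mono_right (Ideal.mul_mono_left hKm)
    · refine le_trans ?_ le_sup_left
      rw [pow_two]
      exact Ideal.mul_mono_right Ideal.mul_le_right
  obtain ⟨g, hg, h', hh', rfl⟩ := Submodule.mem_sup.1 (hle hf)
  obtain ⟨h'', hh'', rfl⟩ := Ideal.mem_span_singleton_mul.1 hh'
  obtain ⟨r, H, h, Z, g', h1, rfl, rfl, h3⟩ := lemG hK hg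
  have hm' : H ⊔ (Z ⊔ Ideal.span {w}) = maximalIdeal S := by
    rw [← hm]; ac_rfl
  rcases h3 with ⟨M', a1, a2, a3⟩ | ⟨M', c, z, U, a1, a2, a3, a4⟩
  · exact degen_B hres h23 P hdef d hf1 hf2 w h'' hh'' M' r H Z h g' h1 hm' a2 a1 (Or.inl a3)
  · exact degen_B hres h23 P hdef d hf1 hf2 w h'' hh'' (M' + 1) r H Z h g' h1 hm'
      (a3 ▸ a2.cons z) (by omega) (Or.inr ⟨M', c, z, U, rfl, a2, a3, a4⟩)

end degen
end SWY

end

section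
namespace SWY
open MvPowerSeries IsLocalRing

section inst
variable {k : Type*} [Field k] {N : ℕ}

theorem isUnit_iff_cc (g : MvPowerSeries (Fin N) k) : IsUnit g ↔ constantCoeff g ≠ 0 := by
  rw [isUnit_iff_notMem, mem_mI_iff]

theorem hres_ps (a : MvPowerSeries (Fin N) k) :
    ∃ t : k, a - algebraMap k (MvPowerSeries (Fin N) k) t ∈ maximalIdeal _ := by
  refine ⟨constantCoeff a, ?_⟩
  rw [← mI_eq_max]
  exact sub_C_mem a

theorem h23_ps : IsUnit (2 : MvPowerSeries (Fin N) k) ∨ IsUnit (3 : MvPowerSeries (Fin N) k) := by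
  rw [isUnit_iff_cc, isUnit_iff_cc, map_ofNat, map_ofNat]
  by_contra! h
  have : (1 : k) = 3 - 2 := by norm_num
  rw [h.1, h.2] at this
  simp at this

instance good_ps [IsAlgClosed k] : Good (MvPowerSeries (Fin N) k) where
  hh := by
    intro α β γ hu
    rw [isUnit_iff_cc] at hu
    simp only [map_sub, map_mul, map_pow, map_ofNat] at hu
    set a := constantCoeff α
    set b := constantCoeff β
    set g := constantCoeff γ
    obtain ⟨c, hc, hc0⟩ : ∃ c : k, c ^ 2 - b * c + a * g = 0 ∧ c ≠ 0 := by
      have hdeg : (Polynomial.X ^ 2 - Polynomial.C b * Polynomial.X + Polynomial.C (a * g)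
          : Polynomial k).degree = 2 := by compute_degree!
      obtain ⟨c, hc⟩ := IsAlgClosed.exists_root _ (by rw [hdeg]; norm_num)
      have hc' : c ^ 2 - b * c + a * g = 0 := by simpa using hc
      by_cases h0 : c = 0
      · refine ⟨b - c, by linear_combination hc', ?_⟩
        rintro h1
        apply hu
        have : b = 0 := by rw [h0] at h1; simpa using h1
        rw [h0, this] at hc'
        rw [this]
        linear_combination (-4) * hc'
      · exact ⟨c, hc', h0⟩
    have hne : 2 * c - b ≠ 0 := by
      intro h
      apply hu
      linear_combination 4 * (-1) * hc + (2 * c - b) * h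
    have := isAdicComplete_mI (N := N) (k := k)
    have hens : HenselianRing (MvPowerSeries (Fin N) k) (mI N k) := inferInstance
    obtain ⟨w, hw, hw'⟩ := hens.is_henselian
      (Polynomial.X ^ 2 - Polynomial.C β * Polynomial.X + Polynomial.C (α * γ))
      (by monicity!) (C c) (by
        rw [mem_mI_iff]
        simpa using hc) (by
        refine RingHom.isUnit_map _ ?_
        rw [isUnit_iff_cc]
        have h2 : constantCoeff (2 : MvPowerSeries (Fin N) k) = 2 := map_ofNat _ 2
        simpa [one_add_one_eq_two, h2] using hne)
    refine ⟨w, ?_, by simpa using hw⟩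
    rw [isUnit_iff_cc]
    rw [mem_mI_iff] at hw'
    simp [sub_eq_zero] at hw'
    rwa [hw']
  two := by
    by_cases h : (2 : k) = 0
    · right
      constructor
      · rw [← mI_eq_max, mem_mI_iff, map_ofNat, h]
      · intro a
        obtain ⟨s, hs⟩ := IsAlgClosed.exists_pow_nat_eq (constantCoeff a) (n := 2) (by norm_num)
        refine ⟨C s, ?_⟩
        rw [← mI_eq_max, mem_mI_iff]
        simp [hs]
    · left
      rw [isUnit_iff_cc, map_ofNat]; exact h

end inst

section coords
variable {k : Type*} [Field k] {d : ℕ}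

theorem HK_eq_len (p e : ℕ) (f : MvPolynomial (Fin (d + 1)) k) :
    HKfun k (d + 1) p e f = len (p ^ e) (Ideal.span {(f : MvPowerSeries (Fin (d + 1)) k)}) := by
  rw [len_coe]
  unfold HKfun frP
  rw [Ideal.span_union, sup_comm]

theorem span_fin (y : ℕ → MvPowerSeries (Fin (d + 1)) k) (M : ℕ) :
    Ideal.span (Set.range (fun i : Fin M => y i)) = Ideal.span (y '' Set.Iio M) := by
  congr 1
  ext x
  constructor
  · rintro ⟨i, rfl⟩; exact ⟨i, i.2, rfl⟩
  · rintro ⟨i, hi, rfl⟩; exact ⟨⟨i, hi⟩, rfl⟩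

theorem Iio_succ' (y : ℕ → MvPowerSeries (Fin (d + 1)) k) (M : ℕ) :
    Ideal.span (y '' Set.Iio (M + 1)) = Ideal.span (y '' Set.Iio M) ⊔ Ideal.span {y M} := by
  have : Set.Iio (M + 1) = insert M (Set.Iio M) := by
    ext x; simp [le_iff_eq_or_lt]
  rw [this, Set.image_insert_eq, Ideal.span_insert, sup_comm]

theorem aut_A2 (e : MvPowerSeries (Fin (d + 1)) k ≃ₐ[k] MvPowerSeries (Fin (d + 1)) k)
    (y : ℕ → MvPowerSeries (Fin (d + 1)) k) (he : ∀ i, e (X i) = y i) :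
    e (A2poly k d : MvPowerSeries (Fin (d + 1)) k) =
      (∑ i ∈ Finset.range (d / 2), y (2 * i) * y (2 * i + 1)) +
      (if Odd d then y (d - 1) ^ 2 else 0) + y d ^ 3 := by
  rw [← MvPolynomial.coeToMvPowerSeries.ringHom_apply]
  unfold A2poly
  rw [map_add, map_add, map_add, map_add, map_sum, map_sum, Finset.sum_range]
  congr 2
  · refine Finset.sum_congr rfl fun i _ => ?_
    simp [he]
  · split_ifs <;> simp [he]
  · simp [he]

theorem aut_A1 (e : MvPowerSeries (Fin (d + 1)) k ≃ₐ[k] MvPowerSeries (Fin (d + 1)) k)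
    (y : ℕ → MvPowerSeries (Fin (d + 1)) k) (he : ∀ i, e (X i) = y i) :
    e (A1poly k d : MvPowerSeries (Fin (d + 1)) k) =
      (∑ i ∈ Finset.range ((d + 1) / 2), y (2 * i) * y (2 * i + 1)) +
      (if Even d then y d ^ 2 else 0) := by
  rw [← MvPolynomial.coeToMvPowerSeries.ringHom_apply]
  unfold A1poly
  rw [map_add, map_add, map_sum, map_sum, Finset.sum_range]
  congr 1
  · refine Finset.sum_congr rfl fun i _ => ?_
    simp [he]
  · split_ifs <;> simp [he]

theorem span_eq_of_unit {S : Type*} [CommRing S] {u a b : S} (hu : IsUnit u) (h : u * a = b) :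
    Ideal.span {a} = Ideal.span {b} := by
  rw [← h, Ideal.span_singleton_mul_left_unit hu]

theorem map_span_eq (e : MvPowerSeries (Fin (d + 1)) k ≃ₐ[k] MvPowerSeries (Fin (d + 1)) k)
    (a : MvPowerSeries (Fin (d + 1)) k) :
    (Ideal.span {a}).map (e : MvPowerSeries (Fin (d + 1)) k →+* MvPowerSeries (Fin (d + 1)) k) =
      Ideal.span {e a} := by
  rw [Ideal.map_span, Set.image_singleton]; rfl

theorem len_of_A2 (p e : ℕ) [Fact p.Prime] [CharP k p] (y : ℕ → MvPowerSeries (Fin (d + 1)) k)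
    (hy : Ideal.span (y '' Set.Iio (d + 1)) = mI (d + 1) k) (u f : MvPowerSeries (Fin (d + 1)) k)
    (hu : IsUnit u)
    (hf : u * f = (∑ i ∈ Finset.range (d / 2), y (2 * i) * y (2 * i + 1)) +
      (if Odd d then y (d - 1) ^ 2 else 0) + y d ^ 3) :
    HKfun k (d + 1) p e (A2poly k d) = len (p ^ e) (Ideal.span {f}) := by
  obtain ⟨φ, hφ⟩ := exists_aut (fun i : Fin (d + 1) => y i) (by rw [span_fin]; exact hy)
  rw [HK_eq_len, span_eq_of_unit hu hf, ← aut_A2 φ y hφ, ← map_span_eq, len_map]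

theorem iso_of_A1 (y : ℕ → MvPowerSeries (Fin (d + 1)) k)
    (hy : Ideal.span (y '' Set.Iio (d + 1)) = mI (d + 1) k) (u f : MvPowerSeries (Fin (d + 1)) k)
    (hu : IsUnit u)
    (hf : u * f = (∑ i ∈ Finset.range ((d + 1) / 2), y (2 * i) * y (2 * i + 1)) +
      (if Even d then y d ^ 2 else 0)) :
    Nonempty ((MvPowerSeries (Fin (d + 1)) k ⧸ (Ideal.span {f})) ≃+*
      (MvPowerSeries (Fin (d + 1)) k ⧸
        (Ideal.span {(A1poly k d : MvPowerSeries (Fin (d + 1)) k)}))) := by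
  obtain ⟨φ, hφ⟩ := exists_aut (fun i : Fin (d + 1) => y i) (by rw [span_fin]; exact hy)
  rw [span_eq_of_unit hu hf, ← aut_A1 φ y hφ]
  exact ⟨(Ideal.quotientEquiv _ _ φ.toRingEquiv (map_span_eq φ _).symm).symm⟩

theorem P_hf1 (p e : ℕ) [Fact p.Prime] [CharP k p] (r : ℕ)
    (H : Ideal (MvPowerSeries (Fin (d + 1)) k)) (h w V : MvPowerSeries (Fin (d + 1)) k)
    (hr : 2 * r = d) (hH : Hy r H h) (hm : H ⊔ Ideal.span {w} = maximalIdeal _) (hV : IsUnit V) :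
    HKfun k (d + 1) p e (A2poly k d) = len (p ^ e) (Ideal.span {h + V * w ^ 3}) := by
  obtain ⟨Y, hY, hY'⟩ := (hH.smul (hV.pow 2)).tuple
  have hd2 : d / 2 = r := by omega
  have hodd : ¬ Odd d := by rw [Nat.not_odd_iff_even]; exact ⟨r, by omega⟩
  refine len_of_A2 p e (fun i => if i < 2 * r then Y i else V * w) ?_ (V ^ 2) _ (hV.pow 2) ?_
  · rw [Iio_succ', mI_eq_max, ← hm]
    congr 1
    · rw [← hY]
      congr 1
      refine (Set.image_congr (fun i hi => ?_)).trans (by rw [hr])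
      simp only [Set.mem_Iio] at hi
      rw [if_pos (by omega)]
    · rw [if_neg (by omega), Ideal.span_singleton_mul_left_unit hV]
  · rw [if_neg hodd, hd2, if_neg (by omega)]
    have : ∑ i ∈ Finset.range r, (if 2 * i < 2 * r then Y (2 * i) else V * w) *
        (if 2 * i + 1 < 2 * r then Y (2 * i + 1) else V * w) = V ^ 2 * h := by
      rw [hY']
      refine Finset.sum_congr rfl fun i hi => ?_
      rw [Finset.mem_range] at hi
      rw [if_pos (by omega), if_pos (by omega)]
    rw [this]; ring

theorem P_hf2 (p e : ℕ) [Fact p.Prime] [CharP k p] (r : ℕ)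
    (H : Ideal (MvPowerSeries (Fin (d + 1)) k)) (h z w U V : MvPowerSeries (Fin (d + 1)) k)
    (hr : 2 * r + 1 = d) (hH : Hy r H h)
    (hm : H ⊔ (Ideal.span {z} ⊔ Ideal.span {w}) = maximalIdeal _) (hU : IsUnit U) (hV : IsUnit V) :
    HKfun k (d + 1) p e (A2poly k d) = len (p ^ e) (Ideal.span {h + U * z ^ 2 + V * w ^ 3}) := by
  have hu : IsUnit (U ^ 3 * V ^ 2) := (hU.pow 3).mul (hV.pow 2)
  obtain ⟨Y, hY, hY'⟩ := (hH.smul hu).tuple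
  have hd2 : d / 2 = r := by omega
  have hodd : Odd d := ⟨r, by omega⟩
  refine len_of_A2 p e (fun i => if i < 2 * r then Y i else if i = 2 * r then U ^ 2 * V * z else
    U * V * w) ?_ (U ^ 3 * V ^ 2) _ hu ?_
  · have e1 : Set.Iio (d + 1) = Set.Iio (2 * r + 1 + 1) := by rw [hr]
    rw [e1, Iio_succ', Iio_succ', mI_eq_max, ← hm, sup_assoc]
    congr 1
    · rw [← hY]
      congr 1
      refine (Set.image_congr (fun i hi => ?_))
      simp only [Set.mem_Iio] at hi
      rw [if_pos (by omega)]
    · rw [if_neg (by omega), if_pos rfl, if_neg (by omega), if_neg (by omega),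
        Ideal.span_singleton_mul_left_unit ((hU.pow 2).mul hV),
        Ideal.span_singleton_mul_left_unit (hU.mul hV)]
  · rw [if_pos hodd, hd2, if_neg (by omega), if_pos (by omega), if_neg (by omega),
      if_neg (by omega)]
    have : ∑ i ∈ Finset.range r, (if 2 * i < 2 * r then Y (2 * i) else
        if 2 * i = 2 * r then U ^ 2 * V * z else U * V * w) *
        (if 2 * i + 1 < 2 * r then Y (2 * i + 1) else if 2 * i + 1 = 2 * r then U ^ 2 * V * z else
          U * V * w) = (U ^ 3 * V ^ 2) * h := by
      rw [hY']
      refine Finset.sum_congr rfl fun i hi => ?_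
      rw [Finset.mem_range] at hi
      rw [if_pos (by omega), if_pos (by omega)]
    rw [this]; ring

theorem lowerBound [IsAlgClosed k] (p e : ℕ) [Fact p.Prime] [CharP k p]
    (w : MvPowerSeries (Fin (d + 1)) k) (K : Ideal (MvPowerSeries (Fin (d + 1)) k))
    (hK : Gen d K) (hm : Ideal.span {w} ⊔ K = mI (d + 1) k)
    (f : MvPowerSeries (Fin (d + 1)) k) (hf : f ∈ K ^ 2 ⊔ mI (d + 1) k ^ 3) :
    HKfun k (d + 1) p e (A2poly k d) ≤ len (p ^ e) (Ideal.span {f}) := by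
  have : Infinite k := IsAlgClosed.instInfinite
  rw [mI_eq_max] at hm hf
  refine degen_main (k := k) hres_ps h23_ps
    (fun f => HKfun k (d + 1) p e (A2poly k d) ≤ len (p ^ e) (Ideal.span {f})) ?_ d
    (fun r H h w V h1 h2 h3 h4 => (P_hf1 p e r H h w V h1 h2 h3 h4).le)
    (fun r H h z w U V h1 h2 h3 h4 h5 => (P_hf2 p e r H h z w U V h1 h2 h3 h4 h5).le)
    w K hK hm f hf
  intro f G B hB hP
  have hs := len_semicont (p ^ e) (fun _ : Fin 1 => f) (fun _ => G)
  obtain ⟨t, ht⟩ := (hs.union hB).exists_notMem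
  simp only [Set.mem_union, not_or, Set.range_const, Set.mem_ofPred_eq, not_lt] at ht
  exact (hP t ht.2).trans ht.1

end coords
end SWY

end

section
namespace SWY
open MvPowerSeries IsLocalRing

section ell1
variable {k : Type*} [Field k] [IsAlgClosed k] {d : ℕ}

theorem mul_sq_le {S : Type*} [CommRing S] {m Z : Ideal S} (h : Z ≤ m) : m * Z ^ 2 ≤ m ^ 3 := by
  have : m ^ 3 = m * m ^ 2 := by ring
  rw [this]
  exact Ideal.mul_mono_right (Ideal.pow_right_mono h 2)

theorem ell1 (p : ℕ) [Fact p.Prime] [CharP k p] (f : MvPowerSeries (Fin (d + 1)) k)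
    (hf : f ∈ mI (d + 1) k ^ 2) :
    Nonempty ((MvPowerSeries (Fin (d + 1)) k ⧸ (Ideal.span {f})) ≃+*
      (MvPowerSeries (Fin (d + 1)) k ⧸
        (Ideal.span {(A1poly k d : MvPowerSeries (Fin (d + 1)) k)}))) ∨
    ∀ e, HKfun k (d + 1) p e (A2poly k d) ≤ len (p ^ e) (Ideal.span {f}) := by
  obtain ⟨r, H, h, Z, g', hH, hHZ, rfl, h3⟩ := lemG (J := mI (d + 1) k) ⟨X, rfl⟩ hf
  have hZm : Z ≤ mI (d + 1) k := hHZ ▸ le_sup_right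
  have hHm : H ≤ mI (d + 1) k := hHZ ▸ le_sup_left
  rw [← mI_eq_max] at h3
  rcases h3 with ⟨M', a1, a2, a3⟩ | ⟨M', c, z, U, a1, a2, a3, a4⟩
  · obtain _ | M' := M'
    · left
      have hZ := a2.eq_bot
      subst hZ
      have : g' = 0 := by simpa [pow_two] using a3
      subst this
      obtain ⟨Y, hY, hY'⟩ := hH.tuple
      refine iso_of_A1 Y ?_ 1 _ isUnit_one ?_
      · rw [sup_bot_eq] at hHZ
        rw [← hHZ, ← hY]
        congr 3
        omega
      · have e1 : (d + 1) / 2 = r := by omega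
        rw [e1, if_neg, hY']
        · ring
        · rw [Nat.not_even_iff_odd]
          exact ⟨r - 1, by omega⟩
    · right
      intro e
      obtain ⟨w, Z', b1, rfl⟩ := a2.uncons
      have hK := hH.gen.sup b1
      rw [show 2 * r + M' = d by omega] at hK
      refine lowerBound p e w _ hK (by rw [← hHZ]; ac_rfl) _ ?_
      exact add_mem (Ideal.mem_sup_left (Ideal.pow_right_mono le_sup_left 2 hH.mem))
        (Ideal.mem_sup_right (mul_sq_le hZm a3))
  · obtain _ | M' := M'
    · have hU := a2.eq_bot
      subst hU
      rw [sup_bot_eq] at a3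
      subst a3
      have h5 : g' - c * z ^ 2 ∈ Ideal.span {z} ^ 2 := Ideal.mul_le_right a4
      obtain ⟨s, hs⟩ := mem_span_sq h5
      obtain ⟨a, ha⟩ : ∃ a, a = c + s := ⟨_, rfl⟩
      have hg : g' = a * z ^ 2 := by rw [ha]; linear_combination hs
      subst hg
      rcases isUnit_or_mem a with hu | hu
      · left
        obtain ⟨b, hb⟩ := hu.exists_left_inv
        have hbu : IsUnit b := IsUnit.of_mul_eq_one _ hb
        obtain ⟨Y, hY, hY'⟩ := (hH.smul hbu).tuple
        refine iso_of_A1 (fun i => if i < 2 * r then Y i else z) ?_ b _ hbu ?_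
        · rw [Iio_succ', ← hHZ]
          congr 1
          · rw [← hY]
            congr 1
            refine (Set.image_congr (fun i hi => ?_)).trans (by rw [show Set.Iio d = Set.Iio (2 * r) by congr 1; omega])
            simp only [Set.mem_Iio] at hi
            rw [if_pos (by omega)]
          · rw [if_neg (by omega)]
        · have e1 : (d + 1) / 2 = r := by omega
          rw [if_pos ⟨r, by omega⟩, e1, if_neg (by omega)]
          have : ∑ i ∈ Finset.range r, (if 2 * i < 2 * r then Y (2 * i) else z) *
              (if 2 * i + 1 < 2 * r then Y (2 * i + 1) else z) = b * h := by
            rw [hY']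
            refine Finset.sum_congr rfl fun i hi => ?_
            rw [Finset.mem_range] at hi
            rw [if_pos (by omega), if_pos (by omega)]
          rw [this]
          linear_combination z ^ 2 * hb
      · right
        intro e
        rw [← mI_eq_max] at hu
        have hK := hH.gen
        rw [show 2 * r = d by omega] at hK
        refine lowerBound p e z _ hK (by rw [← hHZ]; ac_rfl) _ ?_
        refine add_mem (Ideal.mem_sup_left hH.mem) (Ideal.mem_sup_right (mul_sq_le hZm ?_))
        exact Ideal.mul_mem_mul hu (Ideal.pow_mem_pow (Ideal.mem_span_singleton_self z) 2)
    · right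
      intro e
      obtain ⟨w, U', b1, rfl⟩ := a2.uncons
      have hK := hH.gen.sup (b1.cons z)
      rw [show 2 * r + (M' + 1) = d by omega] at hK
      refine lowerBound p e w _ hK (by rw [← hHZ, ← a3]; ac_rfl) _ ?_
      have : h + g' = (h + c * z ^ 2) + (g' - c * z ^ 2) := by ring
      rw [this]
      refine add_mem (Ideal.mem_sup_left (add_mem (Ideal.pow_right_mono le_sup_left 2 hH.mem) ?_))
        (Ideal.mem_sup_right (mul_sq_le hZm a4))
      refine Ideal.mul_mem_left _ _ (Ideal.pow_mem_pow ?_ 2)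
      exact Ideal.mem_sup_right (Ideal.mem_sup_left (Ideal.mem_span_singleton_self z))

end ell1
end SWY

end

section
namespace SWY
open MvPowerSeries IsLocalRing

section ell2
variable {k : Type*} [Field k]

theorem pow_mem_fr {N : ℕ} (p e : ℕ) [Fact p.Prime] [CharP k p] {x : MvPowerSeries (Fin N) k}
    (hx : x ∈ mI N k) : x ^ p ^ e ∈ fr N k (p ^ e) := by
  have : CharP (MvPowerSeries (Fin N) k) p := charP_of_injective_algebraMap
        (algebraMap k (MvPowerSeries (Fin N) k)).injective p
  have : ExpChar (MvPowerSeries (Fin N) k) p := ExpChar.prime Fact.out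
  rw [fr_eq_map]
  exact Ideal.mem_map_of_mem (iterateFrobenius (MvPowerSeries (Fin N) k) p e) hx

theorem normal2 [IsAlgClosed k] {N : ℕ} (f : MvPowerSeries (Fin (N + 2)) k)
    (hf : f ∈ mI (N + 2) k ^ 2) :
    ∃ w v K, Gen N K ∧ Ideal.span {w} ⊔ (Ideal.span {v} ⊔ K) = mI (N + 2) k ∧
      f ∈ K ^ 2 ⊔ (Ideal.span {v} * mI (N + 2) k ⊔ mI (N + 2) k ^ 3) := by
  obtain ⟨r, H, h, Z, g', hH, hHZ, rfl, h3⟩ := lemG (J := mI (N + 2) k) ⟨X, rfl⟩ hf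
  have hZm : Z ≤ mI (N + 2) k := hHZ ▸ le_sup_right
  have hHm : H ≤ mI (N + 2) k := hHZ ▸ le_sup_left
  rw [← mI_eq_max] at h3
  rcases hH with _ | ⟨a, b, hh⟩
  · rw [bot_sup_eq] at hHZ
    subst hHZ
    rcases h3 with ⟨M', a1, a2, a3⟩ | ⟨M', c, z, U, a1, a2, a3, a4⟩
    · obtain rfl : M' = N + 1 + 1 := by omega
      obtain ⟨w, K1, b1, b2⟩ := a2.uncons
      obtain ⟨v, K, b3, rfl⟩ := b1.uncons
      refine ⟨w, v, K, b3, b2, ?_⟩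
      rw [zero_add]
      exact Ideal.mem_sup_right (Ideal.mem_sup_right (mul_sq_le le_rfl a3))
    · obtain rfl : M' = N + 1 := by omega
      obtain ⟨w, K, b1, rfl⟩ := a2.uncons
      refine ⟨w, z, K, b1, by rw [← a3]; ac_rfl, ?_⟩
      have : 0 + g' = c * (z * z) + (g' - c * z ^ 2) := by ring
      rw [this]
      refine Ideal.mem_sup_right (add_mem (Ideal.mem_sup_left (Ideal.mul_mem_left _ _ ?_))
        (Ideal.mem_sup_right (mul_sq_le le_rfl a4)))
      refine Ideal.mul_mem_mul (Ideal.mem_span_singleton_self z) ?_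
      rw [← a3]
      exact Ideal.mem_sup_left (Ideal.mem_span_singleton_self z)
  · rename_i r H h
    have key : g' ∈ Z ^ 2 ∧ Gen (N - 2 * r) Z ∧ 2 * r ≤ N := by
      rcases h3 with ⟨M', a1, a2, a3⟩ | ⟨M', c, z, U, a1, a2, a3, a4⟩
      · refine ⟨Ideal.mul_le_right a3, ?_, by omega⟩
        rwa [show N - 2 * r = M' by omega]
      · refine ⟨?_, ?_, by omega⟩
        · have h5 : g' - c * z ^ 2 ∈ Z ^ 2 := Ideal.mul_le_right a4
          have h6 : c * z ^ 2 ∈ Z ^ 2 := Ideal.mul_mem_left _ _ (Ideal.pow_mem_pow (by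
            rw [← a3]; exact Ideal.mem_sup_left (Ideal.mem_span_singleton_self z)) 2)
          have := add_mem h5 h6
          rwa [sub_add_cancel] at this
        · rw [show N - 2 * r = M' + 1 by omega, ← a3]
          exact a2.cons z
    obtain ⟨k1, k2, k3⟩ := key
    have hK := hh.gen.sup k2
    rw [show 2 * r + (N - 2 * r) = N by omega] at hK
    refine ⟨a, b, _, hK, ?_, ?_⟩
    · rw [← hHZ, Ideal.span_insert]; ac_rfl
    · have : a * b + h + g' = (h + g') + b * a := by ring
      rw [this]
      refine add_mem (Ideal.mem_sup_left (add_mem (Ideal.pow_right_mono le_sup_left 2 hh.mem)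
        (Ideal.pow_right_mono le_sup_right 2 k1))) (Ideal.mem_sup_right (Ideal.mem_sup_left ?_))
      refine Ideal.mul_mem_mul (Ideal.mem_span_singleton_self b) (hHm ?_)
      exact Ideal.mem_sup_left (Ideal.subset_span (by simp))

theorem normal2' [IsAlgClosed k] {n N : ℕ} (hn : n = N + 2) (f : MvPowerSeries (Fin n) k)
    (hf : f ∈ mI n k ^ 2) :
    ∃ w v K, Gen N K ∧ Ideal.span {w} ⊔ (Ideal.span {v} ⊔ K) = mI n k ∧
      f ∈ K ^ 2 ⊔ (Ideal.span {v} * mI n k ⊔ mI n k ^ 3) := by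
  subst hn
  exact normal2 f hf

theorem killCompl_surj {n m : ℕ} (e : Fin n ↪ Fin m) :
    Function.Surjective (killCompl (R := k) e) :=
  fun g => ⟨rename e g, killCompl_rename_app g⟩

theorem ell2 [IsAlgClosed k] (p e : ℕ) [Fact p.Prime] [CharP k p] {d l : ℕ}
    (f : Fin (l + 1 + 1) → MvPowerSeries (Fin (d + 1 + (l + 1))) k)
    (hf : ∀ i, f i ∈ mI (d + 1 + (l + 1)) k ^ 2) :
    HKfun k (d + 1) p e (A2poly k d) ≤ len (p ^ e) (Ideal.span (Set.range f)) := by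
  have : Infinite k := IsAlgClosed.instInfinite
  obtain ⟨w, v, K, hK, hm, hf0⟩ := normal2' (N := d + l) (by omega) (f 0) (hf 0)
  obtain ⟨K1, K2, ⟨u1, hu1⟩, ⟨u2, hu2⟩, hK12⟩ := hK.split
  let L : Fin (l + 1) → MvPowerSeries (Fin (d + 1 + (l + 1))) k := Fin.cons v u2
  have hL : Ideal.span (Set.range L) = Ideal.span {v} ⊔ K2 := by rw [← hu2]; exact span_cons _ _
  let G : Fin (l + 1 + 1) → MvPowerSeries (Fin (d + 1 + (l + 1))) k := Fin.cons 0 L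
  obtain ⟨t, ht⟩ := ((len_semicont (p ^ e) f G).union (Set.finite_singleton (0 : k))).exists_notMem
  simp only [Set.mem_union, not_or, Set.mem_ofPred_eq, not_lt, Set.mem_singleton_iff] at ht
  obtain ⟨ht1, ht0⟩ := ht
  refine le_trans ?_ ht1
  let y : Fin (d + 1 + (l + 1)) → MvPowerSeries (Fin (d + 1 + (l + 1))) k :=
    Fin.append (Fin.cons w u1 : Fin (d + 1) → _) (fun j => f j.succ + C t * L j)
  have hyl : ∀ i, y (Fin.castAdd _ i) = (Fin.cons w u1 : Fin (d + 1) → _) i := fun i =>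
    Fin.append_left _ _ i
  have hyr : ∀ j, y (Fin.natAdd _ j) = f j.succ + C t * L j := fun j => Fin.append_right _ _ j
  have hwm : w ∈ mI (d + 1 + (l + 1)) k := by
    rw [← hm]; exact Ideal.mem_sup_left (Ideal.mem_span_singleton_self w)
  have hvK : Ideal.span {v} ⊔ K ≤ mI (d + 1 + (l + 1)) k := hm ▸ le_sup_right
  have hLm : ∀ j, L j ∈ mI (d + 1 + (l + 1)) k := fun j => by
    have h1 : L j ∈ Ideal.span (Set.range L) := Ideal.subset_span ⟨j, rfl⟩
    rw [hL] at h1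
    have h2 : Ideal.span {v} ⊔ K2 ≤ Ideal.span {v} ⊔ K :=
      sup_le_sup_left (hK12 ▸ le_sup_right) _
    exact hvK (h2 h1)
  have hK1m : K1 ≤ mI (d + 1 + (l + 1)) k := le_trans (le_trans (hK12 ▸ le_sup_left) le_sup_right) hvK
  have hy : Ideal.span (Set.range y) = mI (d + 1 + (l + 1)) k := by
    apply le_antisymm
    · rw [Ideal.span_le]
      rintro _ ⟨i, rfl⟩
      refine Fin.addCases (fun i => ?_) (fun j => ?_) i
      · rw [hyl]
        refine Fin.cases ?_ (fun i => ?_) i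
        · exact hwm
        · exact hK1m (hu1 ▸ Ideal.subset_span ⟨i, rfl⟩)
      · rw [hyr]
        exact add_mem (Ideal.pow_le_self (by norm_num) (hf _)) (Ideal.mul_mem_left _ _ (hLm j))
    · refine Submodule.le_of_le_smul_of_le_jacobson_bot (I := mI (d + 1 + (l + 1)) k) ?_ ?_ ?_
      · exact IsNoetherian.noetherian _
      · rw [IsLocalRing.jacobson_eq_maximalIdeal _ bot_ne_top, mI_eq_max]
      · rw [smul_eq_mul, ← pow_two]
        conv_lhs => rw [← hm, ← hK12]
        have hw' : Ideal.span {w} ≤ Ideal.span (Set.range y) := by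
          rw [Ideal.span_singleton_le_iff_mem]
          exact Ideal.subset_span ⟨Fin.castAdd _ 0, hyl 0⟩
        have hK1' : K1 ≤ Ideal.span (Set.range y) := by
          rw [← hu1, Ideal.span_le]
          rintro _ ⟨i, rfl⟩
          exact Ideal.subset_span ⟨Fin.castAdd _ i.succ, hyl i.succ⟩
        have hL' : Ideal.span {v} ⊔ K2 ≤ Ideal.span (Set.range y) ⊔ mI (d + 1 + (l + 1)) k ^ 2 := by
          rw [← hL, Ideal.span_le]
          rintro _ ⟨j, rfl⟩
          have h1 : y (Fin.natAdd _ j) ∈ Ideal.span (Set.range y) ⊔ mI (d + 1 + (l + 1)) k ^ 2 :=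
            Ideal.mem_sup_left (Ideal.subset_span ⟨_, rfl⟩)
          have h2 : f j.succ ∈ Ideal.span (Set.range y) ⊔ mI (d + 1 + (l + 1)) k ^ 2 := Ideal.mem_sup_right (hf _)
          have h3 : L j = C t⁻¹ * (y (Fin.natAdd _ j) - f j.succ) := by
            rw [hyr, add_sub_cancel_left, ← mul_assoc, ← map_mul, inv_mul_cancel₀ ht0, map_one,
              one_mul]
          rw [h3]
          exact Ideal.mul_mem_left _ _ (sub_mem h1 h2)
        refine sup_le (hw'.trans le_sup_left) (sup_le (le_trans le_sup_left hL')
          (sup_le (hK1'.trans le_sup_left) (le_trans le_sup_right hL')))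
  obtain ⟨ψ, hψ⟩ := exists_aut y hy
  let φ : MvPowerSeries (Fin (d + 1 + (l + 1))) k →ₐ[k] MvPowerSeries (Fin (d + 1)) k :=
    (killCompl (Fin.castAddEmb (l + 1))).comp (ψ.symm : _ →ₐ[k] _)
  have hφs : Function.Surjective φ := (killCompl_surj _).comp ψ.symm.surjective
  have hψ' : ∀ i, ψ.symm (y i) = X i := fun i => by rw [← hψ, AlgEquiv.symm_apply_apply]
  have hφl : ∀ i, φ (y (Fin.castAdd _ i)) = X i := fun i => by
    change killCompl (Fin.castAddEmb (l + 1)) (ψ.symm (y (Fin.castAdd _ i))) = _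
    rw [hψ']
    exact killCompl_X (e := Fin.castAddEmb (l + 1)) i
  have hφr : ∀ j, φ (y (Fin.natAdd _ j)) = 0 := fun j => by
    change killCompl (Fin.castAddEmb (l + 1)) (ψ.symm (y (Fin.natAdd _ j))) = _
    rw [hψ']
    refine killCompl_X_eq_zero ?_
    rintro ⟨i, hi⟩
    have := congrArg Fin.val hi
    simp at this
    omega
  have hφm : (mI (d + 1 + (l + 1)) k).map φ ≤ mI (d + 1) k := by
    rw [← hy, Ideal.map_span, Ideal.span_le]
    rintro _ ⟨_, ⟨i, rfl⟩, rfl⟩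
    refine Fin.addCases (fun i => ?_) (fun j => ?_) i
    · rw [hφl]; exact X_mem_mI _
    · rw [hφr]; exact zero_mem _
  have hφm' : ∀ x ∈ mI (d + 1 + (l + 1)) k, φ x ∈ mI (d + 1) k := fun x hx => hφm (Ideal.mem_map_of_mem _ hx)
  have hφL : ∀ j, φ (L j) ∈ mI (d + 1) k ^ 2 := fun j => by
    have h1 := hφr j
    have h3 : L j = C t⁻¹ * (y (Fin.natAdd _ j) - f j.succ) := by
      rw [hyr, add_sub_cancel_left, ← mul_assoc, ← map_mul, inv_mul_cancel₀ ht0, map_one,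
        one_mul]
    rw [h3, map_mul, map_sub, h1]
    refine Ideal.mul_mem_left _ _ (sub_mem (zero_mem _) ?_)
    have h4 := Ideal.mem_map_of_mem φ (hf j.succ)
    rw [Ideal.map_pow] at h4
    exact Ideal.pow_right_mono hφm 2 h4
  have hφvK2 : (Ideal.span {v} ⊔ K2).map φ ≤ mI (d + 1) k ^ 2 := by
    rw [← hL, Ideal.map_span, Ideal.span_le]
    rintro _ ⟨_, ⟨i, rfl⟩, rfl⟩
    exact hφL i
  -- the bound
  have h1 : len (p ^ e) (Ideal.span {φ (f 0)}) ≤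
      len (p ^ e) (Ideal.span (Set.range fun i => f i + C t * G i)) := by
    have := finite_quot (q := p ^ e)
      (I := Ideal.span (Set.range fun i => f i + C t * G i) ⊔ fr (d + 1 + (l + 1)) k (p ^ e)) le_sup_right
    have hle : Ideal.span (Set.range fun i => f i + C t * G i) ⊔ fr (d + 1 + (l + 1)) k (p ^ e) ≤
        (Ideal.span {φ (f 0)} ⊔ fr (d + 1) k (p ^ e)).comap φ := by
      refine sup_le ?_ ?_
      · rw [Ideal.span_le]
        rintro _ ⟨i, rfl⟩
        refine Fin.cases ?_ (fun j => ?_) i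
        · simp only [G, Fin.cons_zero, mul_zero, add_zero]
          exact Ideal.mem_sup_left (Ideal.mem_span_singleton_self _)
        · have : f j.succ + C t * G j.succ = y (Fin.natAdd _ j) := by
            rw [hyr]; simp [G]
          simp only [SetLike.mem_coe, Ideal.mem_comap]
          rw [this, hφr]; exact zero_mem _
      · unfold fr
        rw [Ideal.span_le]
        rintro _ ⟨i, rfl⟩
        simp only [SetLike.mem_coe, Ideal.mem_comap]
        rw [map_pow]
        exact Ideal.mem_sup_right (pow_mem_fr p e (hφm' _ (X_mem_mI i)))
    refine LinearMap.finrank_le_finrank_of_surjective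
      (f := (Ideal.quotientMapₐ _ φ hle).toLinearMap) ?_
    intro x
    obtain ⟨x, rfl⟩ := Ideal.Quotient.mk_surjective x
    obtain ⟨x, rfl⟩ := hφs x
    exact ⟨Ideal.Quotient.mk _ x, rfl⟩
  refine le_trans ?_ h1
  refine lowerBound p e (φ w) (K1.map φ) ⟨φ ∘ u1, ?_⟩ ?_ _ ?_
  · rw [← hu1, Ideal.map_span, ← Set.range_comp]
  · have h2 : Ideal.span (Set.range (X : Fin (d + 1) → MvPowerSeries (Fin (d + 1)) k)) =
        Ideal.span {φ w} ⊔ K1.map φ := by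
      have : (X : Fin (d + 1) → MvPowerSeries (Fin (d + 1)) k) =
          Fin.cons (φ w) (φ ∘ u1) := by
        funext i
        rw [← hφl, hyl]
        refine Fin.cases ?_ (fun i => ?_) i
        · simp
        · simp
      rw [this, span_cons, ← hu1, Ideal.map_span, ← Set.range_comp]
    exact h2.symm
  · have h2 := Ideal.mem_map_of_mem φ hf0
    have hKK : K.map φ ≤ K1.map φ ⊔ mI (d + 1) k ^ 2 := by
      rw [← hK12, Ideal.map_sup]
      exact sup_le_sup_left (le_trans (Ideal.map_mono le_sup_right) hφvK2) _
    have hK1m' : K1.map φ ≤ mI (d + 1) k := (Ideal.map_mono hK1m).trans hφm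
    refine (?_ : Ideal.map φ _ ≤ _) h2
    rw [Ideal.map_sup, Ideal.map_sup, Ideal.map_pow, Ideal.map_pow, Ideal.map_mul]
    refine sup_le ?_ (sup_le ?_ ?_)
    · refine (Ideal.pow_right_mono hKK 2).trans ?_
      rw [pow_two, Ideal.sup_mul, Ideal.mul_sup]
      have e3 : mI (d + 1) k ^ 3 = mI (d + 1) k * mI (d + 1) k ^ 2 := by ring
      refine sup_le (sup_le (by rw [pow_two]; exact le_sup_left) ?_) ?_
      · refine le_trans ?_ le_sup_right
        rw [e3]
        exact Ideal.mul_mono_left hK1m'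
      · refine le_trans ?_ le_sup_right
        rw [e3, mul_comm]
        exact Ideal.mul_mono_left (sup_le hK1m' (Ideal.pow_le_self (by norm_num)))
    · refine le_trans ?_ le_sup_right
      have e3 : mI (d + 1) k ^ 3 = mI (d + 1) k ^ 2 * mI (d + 1) k := by ring
      rw [e3]
      exact Ideal.mul_mono (le_trans (Ideal.map_mono le_sup_left) hφvK2) hφm
    · exact (Ideal.pow_right_mono hφm 3).trans le_sup_right

end ell2
end SWY

end

section
namespace SWY
section colen
variable {k A : Type*} [Field k] [CommRing A] [Algebra k A]

theorem colen_mul (J : Ideal A) (a b : A) [Module.Finite k (A ⧸ (J ⊔ Ideal.span {a}))]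
    [Module.Finite k (A ⧸ (J ⊔ Ideal.span {b}))] :
    Module.Finite k (A ⧸ (J ⊔ Ideal.span {a * b})) ∧
    Module.finrank k (A ⧸ (J ⊔ Ideal.span {a * b})) ≤
      Module.finrank k (A ⧸ (J ⊔ Ideal.span {a})) + Module.finrank k (A ⧸ (J ⊔ Ideal.span {b})) := by
  have hab : a * b ∈ J ⊔ Ideal.span {a * b} :=
    Ideal.mem_sup_right (Ideal.mem_span_singleton_self _)
  have h1 : J ⊔ Ideal.span {b} ≤ Submodule.comap (LinearMap.mulLeft A a) (J ⊔ Ideal.span {a * b}) := by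
    refine sup_le (fun x hx => ?_) ?_
    · exact Ideal.mem_sup_left (Ideal.mul_mem_left _ _ hx)
    · rw [Ideal.span_singleton_le_iff_mem]
      exact hab
  have h2 : J ⊔ Ideal.span {a * b} ≤ J ⊔ Ideal.span {a} := by
    refine sup_le_sup_left ?_ _
    rw [Ideal.span_singleton_le_iff_mem]
    exact Ideal.mul_mem_right _ _ (Ideal.mem_span_singleton_self _)
  let φ : (A ⧸ (J ⊔ Ideal.span {b})) →ₗ[k] (A ⧸ (J ⊔ Ideal.span {a * b})) :=
    (Submodule.mapQ _ _ (LinearMap.mulLeft A a) h1).restrictScalars k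
  let π : (A ⧸ (J ⊔ Ideal.span {a * b})) →ₗ[k] (A ⧸ (J ⊔ Ideal.span {a})) :=
    (Ideal.Quotient.factorₐ k h2).toLinearMap
  have hπ : Function.Surjective π := Ideal.Quotient.factor_surjective h2
  have hk : LinearMap.ker π ≤ LinearMap.range φ := by
    intro x hx
    obtain ⟨x, rfl⟩ := Ideal.Quotient.mk_surjective x
    have hx' : Ideal.Quotient.mk (J ⊔ Ideal.span {a}) x = 0 := hx
    rw [Ideal.Quotient.eq_zero_iff_mem] at hx'
    obtain ⟨j, hj, y, hy, rfl⟩ := Submodule.mem_sup.1 hx'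
    obtain ⟨c, rfl⟩ := Ideal.mem_span_singleton'.1 hy
    refine ⟨Ideal.Quotient.mk _ c, ?_⟩
    change Ideal.Quotient.mk _ (a * c) = _
    rw [Ideal.Quotient.eq]
    refine Ideal.mem_sup_left ?_
    have : a * c - (j + c * a) = - j := by ring
    rw [this]
    exact neg_mem hj
  have f1 : Module.Finite k (LinearMap.ker π) :=
    Module.Finite.of_injective (Submodule.inclusion hk) (Submodule.inclusion_injective hk)
  have f2 : Module.Finite k ((A ⧸ (J ⊔ Ideal.span {a * b})) ⧸ LinearMap.ker π) :=
    Module.Finite.equiv (π.quotKerEquivOfSurjective hπ).symm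
  have f3 := Module.Finite.of_submodule_quotient (LinearMap.ker π)
  refine ⟨f3, ?_⟩
  rw [← Submodule.finrank_quotient_add_finrank (LinearMap.ker π),
    (π.quotKerEquivOfSurjective hπ).finrank_eq]
  refine Nat.add_le_add_left ?_ _
  exact (Submodule.finrank_mono hk).trans (LinearMap.finrank_range_le φ)

theorem colen_pow (J : Ideal A) (a : A) (q : ℕ) [Module.Finite k (A ⧸ (J ⊔ Ideal.span {a}))] :
    Module.Finite k (A ⧸ (J ⊔ Ideal.span {a ^ q})) ∧
    Module.finrank k (A ⧸ (J ⊔ Ideal.span {a ^ q})) ≤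
      q * Module.finrank k (A ⧸ (J ⊔ Ideal.span {a})) := by
  induction q with
  | zero =>
    have : J ⊔ Ideal.span {a ^ 0} = ⊤ := by
      rw [pow_zero, Ideal.span_singleton_one, sup_top_eq]
    rw [this]
    have : Subsingleton (A ⧸ (⊤ : Ideal A)) := Ideal.Quotient.subsingleton_iff.2 rfl
    exact ⟨inferInstance, by simp [Module.finrank_zero_of_subsingleton]⟩
  | succ q ih =>
    have := ih.1
    have h := colen_mul (k := k) J (a ^ q) a
    rw [pow_succ]
    refine ⟨h.1, h.2.trans ?_⟩
    rw [Nat.succ_mul]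
    exact Nat.add_le_add_right ih.2 _

theorem colen_pows {c : ℕ} (s : Fin c → A) (J : Ideal A) (q : ℕ)
    [hfin : Module.Finite k (A ⧸ (J ⊔ Ideal.span (Set.range s)))] :
    Module.Finite k (A ⧸ (J ⊔ Ideal.span (Set.range fun i => s i ^ q))) ∧
    Module.finrank k (A ⧸ (J ⊔ Ideal.span (Set.range fun i => s i ^ q))) ≤
      q ^ c * Module.finrank k (A ⧸ (J ⊔ Ideal.span (Set.range s))) := by
  induction c generalizing J with
  | zero =>
    have : (fun i => s i ^ q) = s := by funext i; exact i.elim0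
    rw [this]
    exact ⟨hfin, by simp⟩
  | succ c ih =>
    have e : ∀ (s : Fin (c + 1) → A), J ⊔ Ideal.span (Set.range s) =
        (J ⊔ Ideal.span (Set.range (fun i => s (Fin.succ i)))) ⊔ Ideal.span {s 0} := by
      intro s
      conv_lhs => rw [← Fin.cons_self_tail s, Fin.range_cons, Ideal.span_insert]
      unfold Fin.tail
      ac_rfl
    have e' : ∀ (s : Fin (c + 1) → A) (x : A),
        (J ⊔ Ideal.span (Set.range (fun i => s (Fin.succ i)))) ⊔ Ideal.span {x} =
        (J ⊔ Ideal.span {x}) ⊔ Ideal.span (Set.range (fun i => s (Fin.succ i))) := by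
      intro s x
      ac_rfl
    rw [e] at hfin
    have h1 := colen_pow (k := k) (J ⊔ Ideal.span (Set.range fun i => s (Fin.succ i))) (s 0) q
    rw [e' s (s 0 ^ q)] at h1
    have := h1.1
    have h2 := ih (fun i => s i.succ) (J ⊔ Ideal.span {s 0 ^ q})
    rw [e (fun i => s i ^ q), e' (fun i => s i ^ q) (s 0 ^ q)]
    refine ⟨h2.1, h2.2.trans ?_⟩
    rw [e s, pow_succ, mul_assoc]
    exact Nat.mul_le_mul_left _ h1.2

end colen
end SWY

end

section
namespace SWY
open MvPowerSeries IsLocalRing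

theorem exists_sop {n ℓ d : ℕ} {k : Type*} [Field k] (hnd : n = d + ℓ)
    (f : Fin ℓ → MvPowerSeries (Fin n) k) (hf : ∀ i, f i ∈ mI n k)
    (hreg : RingTheory.Sequence.IsRegular (MvPowerSeries (Fin n) k) (List.ofFn f)) :
    ∃ (c : ℕ) (_ : c ≤ d) (s : Fin c → MvPowerSeries (Fin n) k), (∀ i, s i ∈ mI n k) ∧
      ∃ N, mI n k ^ N ≤ Ideal.span (Set.range f) ⊔ Ideal.span (Set.range s) := by
  have hof : Ideal.ofList (List.ofFn f) = Ideal.span (Set.range f) := by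
    unfold Ideal.ofList
    congr 1
    ext x
    simp [List.mem_ofFn]
  have hdim := ringKrullDim_add_length_eq_ringKrullDim_of_isRegular _ hreg
  rw [hof, List.length_ofFn] at hdim
  have hle : ringKrullDim (MvPowerSeries (Fin n) k) ≤ (n : ℕ) := by
    refine (ringKrullDim_le_spanFinrank_maximalIdeal (R := MvPowerSeries (Fin n) k)).trans ?_
    rw [← mI_eq_max, mI]
    have := Submodule.spanFinrank_span_le_ncard_of_finite (R := MvPowerSeries (Fin n) k)
      (s := Set.range (X : Fin n → MvPowerSeries (Fin n) k)) (Set.finite_range _)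
    have h2 : (Set.range (X : Fin n → MvPowerSeries (Fin n) k)).ncard ≤ n := by
      rw [← Set.image_univ]
      refine (Set.ncard_image_le (Set.finite_univ)).trans ?_
      simp [Set.ncard_univ]
    exact_mod_cast this.trans h2
  set J := Ideal.span (Set.range f) with hJ
  have hJm : J ≤ mI n k := by
    rw [hJ, Ideal.span_le]
    rintro _ ⟨i, rfl⟩
    exact hf i
  have hJt : J ≠ ⊤ := by
    intro h
    rw [h, top_le_iff] at hJm
    exact (mI_isMaximal (N := n) (k := k)).ne_top hJm
  have : Nontrivial (MvPowerSeries (Fin n) k ⧸ J) := Ideal.Quotient.nontrivial_iff.2 hJt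
  have : IsLocalRing (MvPowerSeries (Fin n) k ⧸ J) :=
    IsLocalRing.of_surjective' (Ideal.Quotient.mk J) Ideal.Quotient.mk_surjective
  obtain ⟨s, hs, hcard⟩ := Ideal.exists_finset_card_eq_height_of_isNoetherianRing
    (maximalIdeal (MvPowerSeries (Fin n) k ⧸ J))
  have hh := IsLocalRing.maximalIdeal_height_eq_ringKrullDim (R := MvPowerSeries (Fin n) k ⧸ J)
  rw [← hh, ← hcard] at hdim
  have hc : s.card ≤ d := by
    have : ((s.card + ℓ : ℕ) : WithBot ℕ∞) ≤ ((d + ℓ : ℕ)) := by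
      rw [← hnd]
      refine le_trans (le_of_eq ?_) hle
      rw [← hdim]
      push_cast
      rfl
    have : s.card + ℓ ≤ d + ℓ := by exact_mod_cast this
    omega
  have hrad : maximalIdeal (MvPowerSeries (Fin n) k ⧸ J) ≤ (Ideal.span (s : Set _)).radical := by
    rw [Ideal.radical_eq_sInf]
    refine le_sInf ?_
    rintro P ⟨hP1, hP2⟩
    exact hs.2 ⟨hP2, hP1⟩ (le_maximalIdeal hP2.ne_top)
  obtain ⟨N, hN⟩ := Ideal.exists_pow_le_of_le_radical_of_fg hrad (IsNoetherian.noetherian _)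
  have hmk : ∀ x, Ideal.Quotient.mk J x ∈ maximalIdeal (MvPowerSeries (Fin n) k ⧸ J) ↔
      x ∈ mI n k := by
    intro x
    have hloc : IsLocalHom (Ideal.Quotient.mk J) :=
      IsLocalHom.of_surjective _ Ideal.Quotient.mk_surjective
    rw [mI_eq_max, mem_maximalIdeal, mem_maximalIdeal, mem_nonunits_iff, mem_nonunits_iff,
      isUnit_map_iff]
  let e := s.equivFin
  choose g hg using fun i : Fin s.card => Ideal.Quotient.mk_surjective (I := J) (e.symm i : _)
  refine ⟨s.card, hc, g, ?_, N, ?_⟩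
  · intro i
    rw [← hmk, hg]
    exact hs.1.2 (Ideal.subset_span (e.symm i).2)
  · intro x hx
    have h1 : Ideal.Quotient.mk J x ∈ Ideal.span (s : Set _) := by
      apply hN
      have : (mI n k ^ N).map (Ideal.Quotient.mk J) ≤
          maximalIdeal (MvPowerSeries (Fin n) k ⧸ J) ^ N := by
        rw [Ideal.map_pow]
        refine Ideal.pow_right_mono ?_ N
        rw [Ideal.map_le_iff_le_comap]
        intro y hy
        exact (hmk y).2 hy
      exact this (Ideal.mem_map_of_mem _ hx)
    have h2 : Ideal.span (s : Set _) = (Ideal.span (Set.range g)).map (Ideal.Quotient.mk J) := by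
      rw [Ideal.map_span, ← Set.range_comp]
      congr 1
      ext y
      constructor
      · intro hy
        refine ⟨e ⟨y, hy⟩, ?_⟩
        simp [hg]
      · rintro ⟨i, rfl⟩
        simp only [Function.comp, hg]
        exact (e.symm i).2
    rw [h2] at h1
    have h3 : x ∈ ((Ideal.span (Set.range g)).map (Ideal.Quotient.mk J)).comap
      (Ideal.Quotient.mk J) := h1
    rw [Ideal.comap_map_of_surjective _ Ideal.Quotient.mk_surjective] at h3
    rw [sup_comm]
    convert h3 using 2
    exact (Ideal.mk_ker (I := J)).symm

theorem len_bound {n ℓ d : ℕ} {k : Type*} [Field k] (p : ℕ) [Fact p.Prime] [CharP k p]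
    (hnd : n = d + ℓ)
    (f : Fin ℓ → MvPowerSeries (Fin n) k) (hf : ∀ i, f i ∈ mI n k)
    (hreg : RingTheory.Sequence.IsRegular (MvPowerSeries (Fin n) k) (List.ofFn f)) :
    ∃ C : ℕ, ∀ e, len (p ^ e) (Ideal.span (Set.range f)) ≤ C * p ^ (d * e) := by
  obtain ⟨c, hc, s, hs, N, hN⟩ := exists_sop hnd f hf hreg
  have hfr : fr n k N ≤ Ideal.span (Set.range f) ⊔ Ideal.span (Set.range s) := by
    refine le_trans ?_ hN
    unfold fr
    rw [Ideal.span_le]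
    rintro _ ⟨i, rfl⟩
    exact Ideal.pow_mem_pow (X_mem_mI i) N
  have := finite_quot (k := k) hfr
  refine ⟨Module.finrank k (MvPowerSeries (Fin n) k ⧸
    (Ideal.span (Set.range f) ⊔ Ideal.span (Set.range s))), fun e => ?_⟩
  obtain ⟨h1, h2⟩ := colen_pows (k := k) s (Ideal.span (Set.range f)) (p ^ e)
  have hle : Ideal.span (Set.range f) ⊔ Ideal.span (Set.range fun i => s i ^ p ^ e) ≤
      Ideal.span (Set.range f) ⊔ fr n k (p ^ e) := by
    refine sup_le_sup_left ?_ _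
    rw [Ideal.span_le]
    rintro _ ⟨i, rfl⟩
    exact pow_mem_fr p e (hs i)
  have h3 : len (p ^ e) (Ideal.span (Set.range f)) ≤ _ :=
    LinearMap.finrank_le_finrank_of_surjective
      (f := (Ideal.Quotient.factorₐ k hle).toLinearMap) (Ideal.Quotient.factor_surjective hle)
  refine h3.trans (h2.trans ?_)
  rw [mul_comm]
  refine Nat.mul_le_mul_left _ ?_
  rw [← pow_mul, mul_comm e c]
  exact Nat.pow_le_pow_right (Fact.out : p.Prime).pos (Nat.mul_le_mul_right _ hc)

end SWY

end

section
namespace SWY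
open MvPolynomial

section scale
variable {k : Type*} [Field k] {σ : Type*} [Fintype σ]

/-- colength of `(g, X_i^q)` -/
noncomputable def cl (q : ℕ) (g : MvPolynomial σ k) : ℕ :=
  Module.finrank k (MvPolynomial σ k ⧸ (Ideal.span {g} ⊔ frP σ k q))

noncomputable def divEquiv (σ : Type*) [Fintype σ] (q : ℕ) [NeZero q] :
    (Σ _ : (σ → Fin q), (σ →₀ ℕ)) ≃ (σ →₀ ℕ) where
  toFun x := q • x.2 + Finsupp.equivFunOnFinite.symm (fun i => (x.1 i : ℕ))
  invFun m := ⟨fun i => ⟨m i % q, Nat.mod_lt _ (NeZero.pos q)⟩,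
    Finsupp.equivFunOnFinite.symm (fun i => m i / q)⟩
  left_inv := by
    rintro ⟨r, m⟩
    have h1 : (fun i => (⟨(q • m + Finsupp.equivFunOnFinite.symm (fun i => (r i : ℕ))) i % q,
        Nat.mod_lt _ (NeZero.pos q)⟩ : Fin q)) = r := by
      funext i
      ext
      simp [Nat.mod_eq_of_lt (r i).2]
    have h2 : Finsupp.equivFunOnFinite.symm
        (fun i => (q • m + Finsupp.equivFunOnFinite.symm (fun i => (r i : ℕ))) i / q) = m := by
      ext i
      simp [Nat.mul_add_div (NeZero.pos q), Nat.div_eq_of_lt (r i).2]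
    simp only [h1, h2]
  right_inv := by
    intro m
    ext i
    simp [Nat.div_add_mod]

noncomputable def Psi (k σ : Type*) [Field k] [Fintype σ] (q : ℕ) [NeZero q] :
    ((σ → Fin q) → MvPolynomial σ k) ≃ₗ[k] MvPolynomial σ k := by
  classical
  exact (Pi.basis (fun _ => basisMonomials σ k)).equiv (basisMonomials σ k) (divEquiv σ q)

open Classical in
theorem Psi_single (q : ℕ) [NeZero q] (r : σ → Fin q) (m : σ →₀ ℕ) :
    Psi k σ q (Pi.single r (monomial m 1)) =
      monomial (q • m + Finsupp.equivFunOnFinite.symm (fun i => (r i : ℕ))) 1 := by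
  have h := (Pi.basis (fun _ : (σ → Fin q) => basisMonomials σ k)).equiv_apply ⟨r, m⟩
    (basisMonomials σ k) (divEquiv σ q)
  rw [Pi.basis_apply] at h
  simp only [coe_basisMonomials] at h
  exact h

theorem Psi_mul (q : ℕ) [NeZero q] (c : MvPolynomial σ k)
    (g : (σ → Fin q) → MvPolynomial σ k) :
    Psi k σ q (fun r => c * g r) = expand q c * Psi k σ q g := by
  classical
  let L : MvPolynomial σ k →ₗ[k] (((σ → Fin q) → MvPolynomial σ k) →ₗ[k] MvPolynomial σ k) :=
    LinearMap.mk₂ k (fun c g => Psi k σ q (fun r => c * g r))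
      (by intro a b c; rw [← map_add]; congr 1; funext r; simp [add_mul])
      (by intro a b c; rw [← map_smul]; congr 1; funext r; simp)
      (by intro a b c; rw [← map_add]; congr 1; funext r; simp [mul_add])
      (by intro a b c; rw [← map_smul]; congr 1; funext r; simp)
  let R : MvPolynomial σ k →ₗ[k] (((σ → Fin q) → MvPolynomial σ k) →ₗ[k] MvPolynomial σ k) :=
    LinearMap.mk₂ k (fun c g => expand q c * Psi k σ q g)
      (by intro a b c; simp [add_mul])
      (by intro a b c; simp)
      (by intro a b c; simp [mul_add])
      (by intro a b c; simp)
  have : L = R := by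
    refine (basisMonomials σ k).ext fun m => ?_
    refine (Pi.basis (fun _ : (σ → Fin q) => basisMonomials σ k)).ext ?_
    rintro ⟨r, m'⟩
    rw [Pi.basis_apply]
    simp only [coe_basisMonomials, L, R, LinearMap.mk₂_apply]
    rw [Psi_single]
    have : (fun s => (monomial m (1 : k)) * (Pi.single r (monomial m' (1 : k)) :
        (σ → Fin q) → MvPolynomial σ k) s) = Pi.single r (monomial (m + m') 1) := by
      funext s
      by_cases h : s = r
      · subst h; simp [monomial_mul]
      · simp [Pi.single_eq_of_ne h]
    rw [this, Psi_single, expand_monomial, monomial_mul]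
    simp [smul_add, add_assoc]
  exact congrArg (fun F => F c g) this

theorem finrank_expand (q : ℕ) [NeZero q] (I : Ideal (MvPolynomial σ k))
    [Module.Finite k (MvPolynomial σ k ⧸ I)] :
    Module.finrank k (MvPolynomial σ k ⧸ I.map (expand q : _ →ₐ[k] MvPolynomial σ k)) =
      q ^ Fintype.card σ * Module.finrank k (MvPolynomial σ k ⧸ I) := by
  classical
  let V : Submodule k ((σ → Fin q) → MvPolynomial σ k) :=
    Submodule.pi Set.univ (fun _ => I.restrictScalars k)
  have hsum : ∀ g : (σ → Fin q) → MvPolynomial σ k,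
      Psi k σ q g = ∑ r, expand q (g r) * Psi k σ q (Pi.single r 1) := by
    intro g
    have : g = ∑ r, (fun s => g r * (Pi.single r 1 : (σ → Fin q) → MvPolynomial σ k) s) := by
      funext s
      rw [Finset.sum_apply, Finset.sum_eq_single s]
      · simp
      · intro b _ hb
        simp [Pi.single_eq_of_ne hb.symm]
      · simp
    conv_lhs => rw [this, map_sum]
    refine Finset.sum_congr rfl fun r _ => ?_
    rw [Psi_mul]
  have hmem : ∀ c ∈ I, ∀ y, expand q c * y ∈ V.map (Psi k σ q).toLinearMap := by
    intro c hc y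
    refine ⟨fun r => c * (Psi k σ q).symm y r, fun r _ => Ideal.mul_mem_right _ _ hc, ?_⟩
    rw [LinearEquiv.coe_coe, Psi_mul, LinearEquiv.apply_symm_apply]
  have hV : V.map (Psi k σ q).toLinearMap =
      (I.map (expand q : _ →ₐ[k] MvPolynomial σ k)).restrictScalars k := by
    apply le_antisymm
    · rintro _ ⟨g, hg, rfl⟩
      have hg' : ∀ r, g r ∈ I := fun r => hg r trivial
      rw [LinearEquiv.coe_coe, hsum]
      refine Submodule.sum_mem _ fun r _ => ?_
      exact Ideal.mul_mem_right _ _ (Ideal.mem_map_of_mem _ (hg' r))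
    · intro x hx
      have hx' : x ∈ I.map (expand q : _ →ₐ[k] MvPolynomial σ k) := hx
      clear hx
      rw [Ideal.map] at hx'
      induction hx' using Submodule.span_induction with
      | mem x h =>
        obtain ⟨c, hc, rfl⟩ := h
        simpa using hmem c hc 1
      | zero => exact zero_mem _
      | add x y hx hy h1 h2 => exact add_mem h1 h2
      | smul a x hx h1 =>
        obtain ⟨g, hg, rfl⟩ := h1
        rw [LinearEquiv.coe_coe, hsum, smul_eq_mul, Finset.mul_sum]
        refine Submodule.sum_mem _ fun r _ => ?_
        have hg' : g r ∈ I := hg r trivial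
        have := hmem (g r) hg' (a * Psi k σ q (Pi.single r 1))
        convert this using 1
        ring
  have e1 : (((σ → Fin q) → MvPolynomial σ k) ⧸ V) ≃ₗ[k]
      (MvPolynomial σ k ⧸ (I.map (expand q : _ →ₐ[k] MvPolynomial σ k)).restrictScalars k) :=
    Submodule.Quotient.equiv _ _ (Psi k σ q) hV
  have e2 : (((σ → Fin q) → MvPolynomial σ k) ⧸ V) ≃ₗ[k]
      ((σ → Fin q) → (MvPolynomial σ k ⧸ I.restrictScalars k)) :=
    Submodule.quotientPi _
  have hf : Module.Finite k (MvPolynomial σ k ⧸ I.restrictScalars k) :=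
    Module.Finite.equiv (Submodule.Quotient.restrictScalarsEquiv k I).symm
  have h3 := e1.symm.trans e2
  have h4 := h3.finrank_eq
  rw [Module.finrank_pi_fintype, Finset.sum_const, Finset.card_univ, smul_eq_mul,
    Fintype.card_fun, Fintype.card_fin,
    (Submodule.Quotient.restrictScalarsEquiv k I).finrank_eq,
    (Submodule.Quotient.restrictScalarsEquiv k _).finrank_eq] at h4
  exact h4

/-- polynomials fixed by Frobenius on coefficients -/
def Fz (p : ℕ) (f : MvPolynomial σ k) : Prop := ∀ e, expand (p ^ e) f = f ^ p ^ e

theorem Fz.X (p : ℕ) (i : σ) : Fz p (X i : MvPolynomial σ k) := fun e => by simp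

theorem Fz.mul {p : ℕ} {f g : MvPolynomial σ k} (hf : Fz p f) (hg : Fz p g) : Fz p (f * g) :=
  fun e => by rw [map_mul, hf, hg, mul_pow]

theorem Fz.pow {p : ℕ} {f : MvPolynomial σ k} (hf : Fz p f) (n : ℕ) : Fz p (f ^ n) :=
  fun e => by rw [map_pow, hf, ← pow_mul, ← pow_mul, mul_comm]

theorem Fz.add {p : ℕ} [Fact p.Prime] [CharP k p] {f g : MvPolynomial σ k}
    (hf : Fz p f) (hg : Fz p g) : Fz p (f + g) :=
  fun e => by rw [map_add, hf, hg, add_pow_char_pow]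

theorem Fz.zero (p : ℕ) [Fact p.Prime] : Fz p (0 : MvPolynomial σ k) := fun e => by
  rw [map_zero, zero_pow (pow_ne_zero _ (Fact.out : p.Prime).ne_zero)]

theorem Fz.sum {p : ℕ} [Fact p.Prime] [CharP k p] {ι : Type*} (s : Finset ι)
    (f : ι → MvPolynomial σ k) (hf : ∀ i ∈ s, Fz p (f i)) : Fz p (∑ i ∈ s, f i) := by
  classical
  induction s using Finset.induction_on with
  | empty => simpa using Fz.zero p
  | insert a s ha ih =>
    rw [Finset.sum_insert ha]
    exact (hf a (Finset.mem_insert_self _ _)).add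
      (ih fun i hi => hf i (Finset.mem_insert_of_mem hi))

theorem cl_scale (p : ℕ) [Fact p.Prime] [CharP k p] (e q t : ℕ) {f : MvPolynomial σ k}
    (hf : Fz p f) :
    cl (q * p ^ e) (f ^ (t * p ^ e)) = (p ^ e) ^ Fintype.card σ * cl q (f ^ t) := by
  have : NeZero (p ^ e) := ⟨pow_ne_zero _ (Fact.out : p.Prime).ne_zero⟩
  have : Module.Finite k (MvPolynomial σ k ⧸ (Ideal.span {f ^ t} ⊔ frP σ k q)) :=
    finite_quotP (q := q) le_sup_right
  unfold cl
  rw [← finrank_expand]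
  rw [Ideal.map_sup, Ideal.map_span, frP, frP, Ideal.map_span, Set.image_singleton,
    ← Set.range_comp]
  have h1 : (expand (p ^ e)) (f ^ t) = f ^ (t * p ^ e) := by rw [hf.pow t e, ← pow_mul]
  have h2 : ((expand (p ^ e) : _ →ₐ[k] MvPolynomial σ k) ∘ fun i : σ => X i ^ q) =
      fun i => X i ^ (q * p ^ e) := by
    funext i
    simp [← pow_mul, mul_comm]
  rw [h1, h2]

end scale
end SWY

end

section
namespace SWY
open Polynomial TensorProduct

section tens
variable {k A B : Type*} [Field k] [CommRing A] [CommRing B] [Algebra k A] [Algebra k B]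
  [Algebra k[X] A] [Algebra k[X] B] [IsScalarTower k k[X] A] [IsScalarTower k k[X] B]

theorem finrank_smul_top (a : ℕ) :
    Module.finrank k (B ⧸ (Ideal.span {(X : k[X]) ^ a} • (⊤ : Submodule k[X] B))) =
      Module.finrank k (B ⧸ Ideal.span {algebraMap k[X] B X ^ a}) := by
  have h : (Ideal.span {(X : k[X]) ^ a} • (⊤ : Submodule k[X] B)) =
      (Ideal.span {algebraMap k[X] B X ^ a}).restrictScalars k[X] := by
    rw [Ideal.smul_top_eq_map, Ideal.map_span, Set.image_singleton, map_pow]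
  rw [h]
  exact ((Submodule.Quotient.restrictScalarsEquiv k[X]
    (Ideal.span {algebraMap k[X] B X ^ a})).restrictScalars k).finrank_eq

theorem pi_rank {R M : Type*} [CommRing R] [Algebra k R] [AddCommGroup M] [Module k M] [Module R M]
    [IsScalarTower k R M] {r : ℕ} {N : Fin r → Type*} [∀ i, AddCommGroup (N i)]
    [∀ i, Module k (N i)] [∀ i, Module R (N i)] [∀ i, IsScalarTower k R (N i)]
    [∀ i, Module.Finite k (N i)]
    (e : M ≃ₗ[R] (∀ i, N i)) : Module.finrank k M = ∑ i, Module.finrank k (N i) := by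
  rw [(e.restrictScalars k).finrank_eq, Module.finrank_pi_fintype]

theorem fin_tower {R M : Type*} [CommRing R] [Algebra k R] [AddCommGroup M] [Module k M]
    [Module R M] [IsScalarTower k R M] [Module.Finite k M] (N : Submodule R M) :
    Module.Finite k (M ⧸ N) := 
  Module.Finite.of_surjective (N.mkQ.restrictScalars k) (Submodule.mkQ_surjective N)

theorem tensor_rank [Module.Finite k B] {r : ℕ} (a : Fin r → ℕ)
    (e : A ≃ₗ[k[X]] DirectSum (Fin r) fun i => k[X] ⧸ Ideal.span {(X : k[X]) ^ a i}) :
    Module.finrank k (A ⊗[k[X]] B) =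
      ∑ i, Module.finrank k (B ⧸ Ideal.span {algebraMap k[X] B X ^ a i}) := by
  have e1 : A ⊗[k[X]] B ≃ₗ[k[X]] (∀ i, B ⧸ (Ideal.span {(X : k[X]) ^ a i} •
      (⊤ : Submodule k[X] B))) :=
    (TensorProduct.congr e (LinearEquiv.refl _ _)).trans
      ((TensorProduct.directSumLeft k[X] k[X] _ B).trans
        ((DirectSum.linearEquivFunOnFintype k[X] _ _).trans
          (LinearEquiv.piCongrRight fun i => TensorProduct.quotTensorEquivQuotSMul B _)))
  have hfin : ∀ i, Module.Finite k (B ⧸ (Ideal.span {(X : k[X]) ^ a i} •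
      (⊤ : Submodule k[X] B))) := fun i =>
    fin_tower _
  rw [pi_rank (k := k) e1]
  exact Finset.sum_congr rfl fun i _ => finrank_smul_top (a i)

theorem finrank_tensor_quot (t : ℕ) :
    Module.finrank k (A ⊗[k[X]] (k[X] ⧸ Ideal.span {(X : k[X]) ^ t})) =
      Module.finrank k (A ⧸ Ideal.span {algebraMap k[X] A X ^ t}) := by
  rw [← finrank_smul_top]
  exact ((TensorProduct.tensorQuotEquivQuotSMul A _).restrictScalars k).finrank_eq

theorem finrank_dq {R : Type*} [CommRing R] [Algebra k R] (I : Ideal R) (x : R) :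
    Module.finrank k ((R ⧸ I) ⧸ Ideal.span {Ideal.Quotient.mk I x}) =
      Module.finrank k (R ⧸ (Ideal.span {x} ⊔ I)) := by
  have h := (DoubleQuot.quotQuotEquivQuotSupₐ k I (Ideal.span {x})).toLinearEquiv.finrank_eq
  rw [sup_comm, ← h, Ideal.map_span, Set.image_singleton]
  rfl

theorem finrank_trunc2 (t a : ℕ) :
    Module.finrank k ((k[X] ⧸ Ideal.span {(X : k[X]) ^ t}) ⧸
      Ideal.span {algebraMap k[X] (k[X] ⧸ Ideal.span {(X : k[X]) ^ t}) X ^ a}) = min a t := by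
  have h := finrank_dq (k := k) (Ideal.span {(X : k[X]) ^ t}) (X ^ a)
  rw [map_pow] at h
  refine h.trans ?_
  have : Ideal.span {(X : k[X]) ^ a} ⊔ Ideal.span {(X : k[X]) ^ t} =
      Ideal.span {(X : k[X]) ^ (min a t)} := by
    rcases le_total a t with h | h
    · rw [min_eq_left h, sup_eq_left, Ideal.span_singleton_le_span_singleton]
      exact pow_dvd_pow _ h
    · rw [min_eq_right h, sup_eq_right, Ideal.span_singleton_le_span_singleton]
      exact pow_dvd_pow _ h
  rw [this, finrank_quotient_span_eq_natDegree, natDegree_X_pow]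

theorem finrank_min {r : ℕ} (a : Fin r → ℕ)
    (e : A ≃ₗ[k[X]] DirectSum (Fin r) fun i => k[X] ⧸ Ideal.span {(X : k[X]) ^ a i}) (t : ℕ) :
    Module.finrank k (A ⧸ Ideal.span {algebraMap k[X] A X ^ t}) = ∑ i, min (a i) t := by
  have : Module.Finite k (k[X] ⧸ Ideal.span {(X : k[X]) ^ t}) :=
    (Polynomial.monic_X_pow (R := k) t).finite_quotient
  rw [← finrank_tensor_quot, tensor_rank a e]
  exact Finset.sum_congr rfl fun i _ => finrank_trunc2 t (a i)

theorem exists_jordan [Module.Finite k A] (m : ℕ)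
    (hm : algebraMap k[X] A X ^ m = 0) :
    ∃ (r : ℕ) (a : Fin r → ℕ),
      Nonempty (A ≃ₗ[k[X]] DirectSum (Fin r) fun i => k[X] ⧸ Ideal.span {(X : k[X]) ^ a i}) := by
  have : Module.Finite k[X] A := Module.Finite.of_restrictScalars_finite k k[X] A
  refine Module.torsion_by_prime_power_decomposition (Polynomial.irreducible_X) ?_
  intro x
  refine ⟨⟨X ^ m, m, rfl⟩, ?_⟩
  change (X : k[X]) ^ m • x = 0
  rw [Algebra.smul_def, map_pow, hm, zero_mul]
end tens
end SWY

end

section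
namespace SWY
open TensorProduct

section KF
variable {k : Type*} [Field k] {σ τ : Type*}

theorem tower_aeval {A : Type*} [CommRing A] [Algebra k A] (x : A) :
    let iA := (Polynomial.aeval (R := k) x).toAlgebra
    IsScalarTower k (Polynomial k) A := by
  letI := (Polynomial.aeval (R := k) x).toAlgebra
  refine IsScalarTower.of_algebraMap_eq fun c => ?_
  change _ = Polynomial.aeval x (Polynomial.C c)
  simp

theorem comm_key {C D : Type*} [CommRing C] [Algebra k C] [Algebra (Polynomial k) C]
    [IsScalarTower k (Polynomial k) C] [CommRing D] [Algebra k D] [Algebra (Polynomial k) D]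
    [IsScalarTower k (Polynomial k) D] (j : C →ₐ[k] D)
    (hj : j (algebraMap (Polynomial k) C Polynomial.X) =
      algebraMap (Polynomial k) D Polynomial.X) (x : Polynomial k) :
    j (algebraMap (Polynomial k) C x) = algebraMap (Polynomial k) D x := by
  have : (j.comp (IsScalarTower.toAlgHom k (Polynomial k) C)) =
      IsScalarTower.toAlgHom k (Polynomial k) D := by
    apply Polynomial.algHom_ext
    simpa using hj
  exact congrArg (fun F => F x) this

theorem tensor_crit {A B D : Type*} [CommRing A] [Algebra k A] [Algebra (Polynomial k) A]
    [IsScalarTower k (Polynomial k) A] [CommRing B] [Algebra k B] [Algebra (Polynomial k) B]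
    [IsScalarTower k (Polynomial k) B] [CommRing D] [Algebra k D]
    (jL0 : A →ₐ[k] D) (jR0 : B →ₐ[k] D) (φ : D →ₐ[k] A ⊗[Polynomial k] B)
    (hL : ∀ a, φ (jL0 a) = a ⊗ₜ 1) (hR : ∀ b, φ (jR0 b) = 1 ⊗ₜ b)
    (hX : jL0 (algebraMap (Polynomial k) A Polynomial.X) =
      jR0 (algebraMap (Polynomial k) B Polynomial.X))
    (hgen : ∀ F : D →ₐ[k] D, (∀ a, F (jL0 a) = jL0 a) → (∀ b, F (jR0 b) = jR0 b) →
      ∀ x, F x = x) :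
    Module.finrank k D = Module.finrank k (A ⊗[Polynomial k] B) := by
  let iD : Algebra (Polynomial k) D :=
    (Polynomial.aeval (R := k) (jL0 (algebraMap (Polynomial k) A Polynomial.X))).toAlgebra
  have htow : IsScalarTower k (Polynomial k) D := tower_aeval _
  have hD : algebraMap (Polynomial k) D Polynomial.X =
      jL0 (algebraMap (Polynomial k) A Polynomial.X) := by
    change Polynomial.aeval _ Polynomial.X = _
    simp
  let jL : A →ₐ[Polynomial k] D := { jL0.toRingHom with commutes' := comm_key jL0 hD.symm }
  let jR : B →ₐ[Polynomial k] D :=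
    { jR0.toRingHom with commutes' := comm_key jR0 (hX.symm.trans hD.symm) }
  let ψ : A ⊗[Polynomial k] B →ₐ[Polynomial k] D := Algebra.TensorProduct.productMap jL jR
  have hψφ : ∀ x, ψ (φ x) = x := by
    refine hgen ((ψ.restrictScalars k).comp φ) (fun a => ?_) (fun b => ?_)
    · change ψ (φ (jL0 a)) = _
      rw [hL]
      exact Algebra.TensorProduct.productMap_left_apply _ _ a
    · change ψ (φ (jR0 b)) = _
      rw [hR]
      exact Algebra.TensorProduct.productMap_right_apply _ _ b
  have hsurj : Function.Surjective φ := by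
    intro x
    induction x using TensorProduct.induction_on with
    | zero => exact ⟨0, map_zero _⟩
    | tmul a b =>
      refine ⟨jL0 a * jR0 b, ?_⟩
      rw [map_mul, hL, hR, Algebra.TensorProduct.tmul_mul_tmul, one_mul, mul_one]
    | add x y hx hy =>
      obtain ⟨a, rfl⟩ := hx
      obtain ⟨b, rfl⟩ := hy
      exact ⟨a + b, map_add _ _ _⟩
  have hinj : Function.Injective φ := Function.LeftInverse.injective hψφ
  exact (LinearEquiv.ofBijective φ.toLinearMap ⟨hinj, hsurj⟩).finrank_eq

theorem finrank_neg_pow {A : Type*} [CommRing A] [Algebra k A] (x y : A) (h : x = -y) (n : ℕ) :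
    Module.finrank k (A ⧸ Ideal.span {x ^ n}) = Module.finrank k (A ⧸ Ideal.span {y ^ n}) := by
  have : IsUnit ((-1 : A) ^ n) := (isUnit_one.neg).pow _
  rw [h, neg_pow, mul_comm, Ideal.span_singleton_mul_right_unit this]

/-- the ideal of the Thom-Sebastiani sum -/
noncomputable def TS (I : Ideal (MvPolynomial σ k)) (J : Ideal (MvPolynomial τ k))
    (f : MvPolynomial σ k) (g : MvPolynomial τ k) : Ideal (MvPolynomial (σ ⊕ τ) k) :=
  I.map (MvPolynomial.rename Sum.inl : _ →ₐ[k] MvPolynomial (σ ⊕ τ) k) ⊔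
    J.map (MvPolynomial.rename Sum.inr : _ →ₐ[k] MvPolynomial (σ ⊕ τ) k) ⊔
    Ideal.span {MvPolynomial.rename Sum.inl f + MvPolynomial.rename Sum.inr g}

theorem TS_tensor (I : Ideal (MvPolynomial σ k)) (J : Ideal (MvPolynomial τ k))
    (f : MvPolynomial σ k) (g : MvPolynomial τ k)
    [Algebra (Polynomial k) (MvPolynomial σ k ⧸ I)]
    [Algebra (Polynomial k) (MvPolynomial τ k ⧸ J)]
    [IsScalarTower k (Polynomial k) (MvPolynomial σ k ⧸ I)]
    [IsScalarTower k (Polynomial k) (MvPolynomial τ k ⧸ J)]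
    (hA : algebraMap (Polynomial k) (MvPolynomial σ k ⧸ I) Polynomial.X = Ideal.Quotient.mk I f)
    (hB : algebraMap (Polynomial k) (MvPolynomial τ k ⧸ J) Polynomial.X =
      - Ideal.Quotient.mk J g) :
    Module.finrank k (MvPolynomial (σ ⊕ τ) k ⧸ TS I J f g) =
      Module.finrank k
        ((MvPolynomial σ k ⧸ I) ⊗[Polynomial k] (MvPolynomial τ k ⧸ J)) := by
  set A := MvPolynomial σ k ⧸ I
  set B := MvPolynomial τ k ⧸ J
  set K := TS I J f g with hK
  set D := MvPolynomial (σ ⊕ τ) k ⧸ K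
  -- the map from polynomials to the tensor product
  let iL : A →ₐ[k] A ⊗[Polynomial k] B :=
    (Algebra.TensorProduct.includeLeft (R := Polynomial k) (S := k) (A := A) (B := B))
  let iR : B →ₐ[k] A ⊗[Polynomial k] B :=
    (Algebra.TensorProduct.includeRight (R := Polynomial k) (A := A) (B := B)).restrictScalars k
  let φ0 : MvPolynomial (σ ⊕ τ) k →ₐ[k] A ⊗[Polynomial k] B :=
    MvPolynomial.aeval (Sum.elim (fun i => iL (Ideal.Quotient.mk I (MvPolynomial.X i)))
      (fun j => iR (Ideal.Quotient.mk J (MvPolynomial.X j))))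
  have hl : φ0.comp (MvPolynomial.rename Sum.inl) = iL.comp (Ideal.Quotient.mkₐ k I) := by
    apply MvPolynomial.algHom_ext
    intro i
    simp [φ0]
    rfl
  have hr : φ0.comp (MvPolynomial.rename Sum.inr) = iR.comp (Ideal.Quotient.mkₐ k J) := by
    apply MvPolynomial.algHom_ext
    intro i
    simp [φ0]
    rfl
  have hl' : ∀ x, φ0 (MvPolynomial.rename Sum.inl x) = iL (Ideal.Quotient.mk I x) := fun x =>
    congrArg (fun F => F x) hl
  have hr' : ∀ x, φ0 (MvPolynomial.rename Sum.inr x) = iR (Ideal.Quotient.mk J x) := fun x =>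
    congrArg (fun F => F x) hr
  have hφK : ∀ x ∈ K, φ0 x = 0 := by
    have : K ≤ RingHom.ker φ0 := by
      refine sup_le (sup_le ?_ ?_) ?_
      · rw [Ideal.map_le_iff_le_comap]
        intro x hx
        change φ0 (MvPolynomial.rename Sum.inl x) = 0
        rw [hl', Ideal.Quotient.eq_zero_iff_mem.2 hx, map_zero]
      · rw [Ideal.map_le_iff_le_comap]
        intro x hx
        change φ0 (MvPolynomial.rename Sum.inr x) = 0
        rw [hr', Ideal.Quotient.eq_zero_iff_mem.2 hx, map_zero]
      · rw [Ideal.span_singleton_le_iff_mem]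
        change φ0 _ = 0
        rw [map_add, hl', hr', ← hA, ← neg_neg (Ideal.Quotient.mk J g), ← hB, map_neg]
        have h1 : iL (algebraMap (Polynomial k) A Polynomial.X) =
          algebraMap (Polynomial k) (A ⊗[Polynomial k] B) Polynomial.X :=
          (Algebra.TensorProduct.algebraMap_apply Polynomial.X).symm
        have h2 : iR (algebraMap (Polynomial k) B Polynomial.X) =
          algebraMap (Polynomial k) (A ⊗[Polynomial k] B) Polynomial.X :=
          (Algebra.TensorProduct.includeRight (R := Polynomial k) (A := A) (B := B)).commutes _
        rw [h1, h2, add_neg_cancel]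
    exact this
  let φ : D →ₐ[k] A ⊗[Polynomial k] B := Ideal.Quotient.liftₐ K φ0 hφK
  -- the inverse
  let jL0 : A →ₐ[k] D := Ideal.Quotient.liftₐ I
    ((Ideal.Quotient.mkₐ k K).comp (MvPolynomial.rename Sum.inl)) (by
      intro x hx
      refine Ideal.Quotient.eq_zero_iff_mem.2 ?_
      exact Ideal.mem_sup_left (Ideal.mem_sup_left (Ideal.mem_map_of_mem _ hx)))
  let jR0 : B →ₐ[k] D := Ideal.Quotient.liftₐ J
    ((Ideal.Quotient.mkₐ k K).comp (MvPolynomial.rename Sum.inr)) (by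
      intro x hx
      refine Ideal.Quotient.eq_zero_iff_mem.2 ?_
      exact Ideal.mem_sup_left (Ideal.mem_sup_right (Ideal.mem_map_of_mem _ hx)))
  have hjLR : jL0 (algebraMap (Polynomial k) A Polynomial.X) =
      jR0 (algebraMap (Polynomial k) B Polynomial.X) := by
    rw [hA, hB, map_neg]
    change Ideal.Quotient.mk K (MvPolynomial.rename Sum.inl f) =
      - Ideal.Quotient.mk K (MvPolynomial.rename Sum.inr g)
    rw [← map_neg, Ideal.Quotient.eq, sub_neg_eq_add]
    exact Ideal.mem_sup_right (Ideal.mem_span_singleton_self _)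
  refine tensor_crit jL0 jR0 φ ?_ ?_ hjLR ?_
  · intro a
    obtain ⟨a, rfl⟩ := Ideal.Quotient.mk_surjective a
    exact hl' a
  · intro b
    obtain ⟨b, rfl⟩ := Ideal.Quotient.mk_surjective b
    exact hr' b
  · intro F h1 h2 x
    obtain ⟨x, rfl⟩ := Ideal.Quotient.mk_surjective x
    have : F.comp (Ideal.Quotient.mkₐ k K) = Ideal.Quotient.mkₐ k K := by
      apply MvPolynomial.algHom_ext
      rintro (i | j)
      · have := h1 (Ideal.Quotient.mk I (MvPolynomial.X i))
        change F (Ideal.Quotient.mk K (MvPolynomial.rename Sum.inl (MvPolynomial.X i))) =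
          Ideal.Quotient.mk K (MvPolynomial.rename Sum.inl (MvPolynomial.X i)) at this
        rw [MvPolynomial.rename_X] at this
        exact this
      · have := h2 (Ideal.Quotient.mk J (MvPolynomial.X j))
        change F (Ideal.Quotient.mk K (MvPolynomial.rename Sum.inr (MvPolynomial.X j))) =
          Ideal.Quotient.mk K (MvPolynomial.rename Sum.inr (MvPolynomial.X j)) at this
        rw [MvPolynomial.rename_X] at this
        exact this
    exact congrArg (fun F => F x) this

theorem KF (I : Ideal (MvPolynomial σ k)) [Module.Finite k (MvPolynomial σ k ⧸ I)]
    (f : MvPolynomial σ k) (m : ℕ) (hm : f ^ m ∈ I) :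
    ∃ (r : ℕ) (a : Fin r → ℕ),
      (∀ t, Module.finrank k (MvPolynomial σ k ⧸ (Ideal.span {f ^ t} ⊔ I)) =
        ∑ i, min (a i) t) ∧
      ∀ (τ : Type) (J : Ideal (MvPolynomial τ k)) [Module.Finite k (MvPolynomial τ k ⧸ J)]
        (g : MvPolynomial τ k),
        Module.finrank k (MvPolynomial (σ ⊕ τ) k ⧸ TS I J f g) =
          ∑ i, Module.finrank k (MvPolynomial τ k ⧸ (Ideal.span {g ^ a i} ⊔ J)) := by
  letI : Algebra (Polynomial k) (MvPolynomial σ k ⧸ I) :=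
    (Polynomial.aeval (R := k) (Ideal.Quotient.mk I f)).toAlgebra
  have htow : IsScalarTower k (Polynomial k) (MvPolynomial σ k ⧸ I) := tower_aeval _
  have hA : algebraMap (Polynomial k) (MvPolynomial σ k ⧸ I) Polynomial.X =
      Ideal.Quotient.mk I f := by
    change Polynomial.aeval _ Polynomial.X = _
    simp
  obtain ⟨r, a, ⟨e⟩⟩ := exists_jordan (k := k) (A := MvPolynomial σ k ⧸ I) m (by
    rw [hA, ← map_pow, Ideal.Quotient.eq_zero_iff_mem]
    exact hm)
  refine ⟨r, a, fun t => ?_, ?_⟩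
  · rw [← finrank_dq, ← finrank_min (k := k) a e, hA, map_pow]
  · intro τ J _ g
    let iB : Algebra (Polynomial k) (MvPolynomial τ k ⧸ J) :=
      (Polynomial.aeval (R := k) (- Ideal.Quotient.mk J g)).toAlgebra
    have htow : IsScalarTower k (Polynomial k) (MvPolynomial τ k ⧸ J) := tower_aeval _
    have hB : algebraMap (Polynomial k) (MvPolynomial τ k ⧸ J) Polynomial.X =
        - Ideal.Quotient.mk J g := by
      change Polynomial.aeval _ Polynomial.X = _
      simp
    rw [TS_tensor I J f g hA hB, tensor_rank a e]
    refine Finset.sum_congr rfl fun i _ => ?_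
    rw [← finrank_dq, finrank_neg_pow _ _ hB, map_pow]

end KF
end SWY

end

section
namespace SWY
open MvPolynomial

section colon
variable {k A : Type*} [Field k] [CommRing A] [Algebra k A]

theorem colen_colon (J : Ideal A) [Module.Finite k (A ⧸ J)] (a b : A) (C : Ideal A)
    (hC : ∀ x, x ∈ C ↔ a * x ∈ J ⊔ Ideal.span {a * b}) :
    Module.finrank k (A ⧸ (J ⊔ Ideal.span {a * b})) =
      Module.finrank k (A ⧸ (J ⊔ Ideal.span {a})) + Module.finrank k (A ⧸ C) := by
  have h2 : J ⊔ Ideal.span {a * b} ≤ J ⊔ Ideal.span {a} := by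
    refine sup_le_sup_left ?_ _
    rw [Ideal.span_singleton_le_iff_mem]
    exact Ideal.mul_mem_right _ _ (Ideal.mem_span_singleton_self _)
  have h1 : C ≤ Submodule.comap (LinearMap.mulLeft A a) (J ⊔ Ideal.span {a * b}) :=
    fun x hx => (hC x).1 hx
  let φ : (A ⧸ C) →ₗ[k] (A ⧸ (J ⊔ Ideal.span {a * b})) :=
    (Submodule.mapQ _ _ (LinearMap.mulLeft A a) h1).restrictScalars k
  let π : (A ⧸ (J ⊔ Ideal.span {a * b})) →ₗ[k] (A ⧸ (J ⊔ Ideal.span {a})) :=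
    (Ideal.Quotient.factorₐ k h2).toLinearMap
  have hπ : Function.Surjective π := Ideal.Quotient.factor_surjective h2
  have hφ : Function.Injective φ := by
    rw [← LinearMap.ker_eq_bot, eq_bot_iff]
    intro x hx
    obtain ⟨x, rfl⟩ := Ideal.Quotient.mk_surjective x
    have hx' : Ideal.Quotient.mk (J ⊔ Ideal.span {a * b}) (a * x) = 0 := hx
    rw [Ideal.Quotient.eq_zero_iff_mem, ← hC] at hx'
    exact Ideal.Quotient.eq_zero_iff_mem.2 hx'
  have hk : LinearMap.ker π = LinearMap.range φ := by
    apply le_antisymm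
    · intro x hx
      obtain ⟨x, rfl⟩ := Ideal.Quotient.mk_surjective x
      have hx' : Ideal.Quotient.mk (J ⊔ Ideal.span {a}) x = 0 := hx
      rw [Ideal.Quotient.eq_zero_iff_mem] at hx'
      obtain ⟨j, hj, y, hy, rfl⟩ := Submodule.mem_sup.1 hx'
      obtain ⟨c, rfl⟩ := Ideal.mem_span_singleton'.1 hy
      refine ⟨Ideal.Quotient.mk _ c, ?_⟩
      change Ideal.Quotient.mk _ (a * c) = _
      rw [Ideal.Quotient.eq]
      refine Ideal.mem_sup_left ?_
      have : a * c - (j + c * a) = - j := by ring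
      rw [this]
      exact neg_mem hj
    · rintro _ ⟨x, rfl⟩
      obtain ⟨x, rfl⟩ := Ideal.Quotient.mk_surjective x
      change Ideal.Quotient.mk (J ⊔ Ideal.span {a}) (a * x) = 0
      rw [Ideal.Quotient.eq_zero_iff_mem]
      exact Ideal.mem_sup_right (Ideal.mul_mem_right _ _ (Ideal.mem_span_singleton_self _))
  have hle0 : J ≤ J ⊔ Ideal.span {a * b} := le_sup_left
  have f3 : Module.Finite k (A ⧸ (J ⊔ Ideal.span {a * b})) :=
    Module.Finite.of_surjective (Ideal.Quotient.factorₐ k hle0).toLinearMap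
      (Ideal.Quotient.factor_surjective hle0)
  rw [← Submodule.finrank_quotient_add_finrank (LinearMap.ker π),
    (π.quotKerEquivOfSurjective hπ).finrank_eq, hk, LinearMap.finrank_range_of_inj hφ]

theorem finrank_quot_lt {I J : Ideal A} [Module.Finite k (A ⧸ I)] (h : I ≤ J) (u : A)
    (hu : u ∈ J) (hu' : u ∉ I) : Module.finrank k (A ⧸ J) < Module.finrank k (A ⧸ I) := by
  let π : (A ⧸ I) →ₗ[k] (A ⧸ J) := (Ideal.Quotient.factorₐ k h).toLinearMap
  have hπ : Function.Surjective π := Ideal.Quotient.factor_surjective h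
  have h1 := Submodule.finrank_quotient_add_finrank (LinearMap.ker π)
  rw [(π.quotKerEquivOfSurjective hπ).finrank_eq] at h1
  have : 0 < Module.finrank k (LinearMap.ker π) := by
    rw [Module.finrank_pos_iff]
    refine ⟨⟨⟨Ideal.Quotient.mk I u, ?_⟩, 0, ?_⟩⟩
    · change Ideal.Quotient.mk J u = 0
      exact Ideal.Quotient.eq_zero_iff_mem.2 hu
    · intro h
      have := congrArg Subtype.val h
      exact hu' (Ideal.Quotient.eq_zero_iff_mem.1 this)
  omega

theorem blocks_pos (J : Ideal A) [Module.Finite k (A ⧸ J)] (T u : A) (j : ℕ)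
    (h1 : T ^ (j + 1) * u ∈ J) (h2 : T ^ j * u ∉ J ⊔ Ideal.span {T ^ (j + 1)}) :
    Module.finrank k (A ⧸ (J ⊔ Ideal.span {T ^ (j + 2)})) +
      Module.finrank k (A ⧸ (J ⊔ Ideal.span {T ^ j})) + 1 ≤
      2 * Module.finrank k (A ⧸ (J ⊔ Ideal.span {T ^ (j + 1)})) := by
  let C : ℕ → Ideal A := fun n =>
    Submodule.comap (LinearMap.mulLeft A (T ^ n)) (J ⊔ Ideal.span {T ^ (n + 1)})
  have hC : ∀ n x, x ∈ C n ↔ T ^ n * x ∈ J ⊔ Ideal.span {T ^ (n + 1)} := fun n x => Iff.rfl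
  have e1 := colen_colon (k := k) J (T ^ j) T (C j) (by
    intro x; rw [hC, pow_succ])
  have e2 := colen_colon (k := k) J (T ^ (j + 1)) T (C (j + 1)) (by
    intro x; rw [hC, pow_succ T (j + 1)])
  rw [← pow_succ] at e1 e2
  have hJC : J ≤ C j := fun x hx => by
    rw [hC]
    exact Ideal.mem_sup_left (Ideal.mul_mem_left _ _ hx)
  have hle : C j ≤ C (j + 1) := by
    intro x hx
    rw [hC] at hx ⊢
    obtain ⟨y, hy, z, hz, hyz⟩ := Submodule.mem_sup.1 hx
    obtain ⟨c, rfl⟩ := Ideal.mem_span_singleton'.1 hz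
    have : T ^ (j + 1) * x = T * y + c * T ^ (j + 1 + 1) := by
      rw [pow_succ, mul_comm (T ^ j), mul_assoc, ← hyz]; ring
    rw [this]
    exact add_mem (Ideal.mem_sup_left (Ideal.mul_mem_left _ _ hy))
      (Ideal.mem_sup_right (Ideal.mul_mem_left _ _ (Ideal.mem_span_singleton_self _)))
  have : Module.Finite k (A ⧸ C j) :=
    Module.Finite.of_surjective (Ideal.Quotient.factorₐ k hJC).toLinearMap
      (Ideal.Quotient.factor_surjective hJC)
  have := finrank_quot_lt (k := k) hle u (by rw [hC]; exact Ideal.mem_sup_left h1)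
    (by rw [hC]; exact h2)
  change Module.finrank k (A ⧸ (J ⊔ Ideal.span {T ^ (j + 1 + 1)})) + _ + _ ≤ _
  omega
end colon

section hyp
variable {k : Type*} [Field k] {σ : Type*}

/-- the ideal of polynomials with no monomials below `α` -/
def lowI (α : σ →₀ ℕ) : Ideal (MvPolynomial σ k) where
  carrier := {g | ∀ β ≤ α, coeff β g = 0}
  zero_mem' := by intro β _; simp
  add_mem' := by
    intro a b ha hb β hβ
    rw [coeff_add, ha β hβ, hb β hβ, add_zero]
  smul_mem' := by
    classical
    intro c x hx β hβ
    rw [smul_eq_mul, coeff_mul]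
    refine Finset.sum_eq_zero fun y hy => ?_
    have hy := Finset.HasAntidiagonal.mem_antidiagonal.1 hy
    rw [hx y.2 (le_trans (by rw [← hy]; exact le_add_self) hβ), mul_zero]

theorem mem_lowI {α : σ →₀ ℕ} {g : MvPolynomial σ k} :
    g ∈ lowI α ↔ ∀ β ≤ α, coeff β g = 0 := Iff.rfl

theorem X_pow_mem_lowI {α : σ →₀ ℕ} {i : σ} {n : ℕ} (h : α i < n) :
    (X i ^ n : MvPolynomial σ k) ∈ lowI α := by
  classical
  intro β hβ
  rw [coeff_X_pow, if_neg]
  rintro rfl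
  have := hβ i
  simp at this
  omega

theorem monomial_mem_frP {α : σ →₀ ℕ} {i : σ} {q : ℕ} (h : q ≤ α i) :
    (monomial α 1 : MvPolynomial σ k) ∈ frP σ k q := by
  classical
  rw [mem_frP_iff]
  intro β hβ
  rw [coeff_monomial, if_neg]
  rintro rfl
  exact absurd (hβ i) (by omega)

/-- hyperbolic form -/
noncomputable def hyp (k : Type*) [Field k] (h : ℕ) : MvPolynomial (Fin h × Fin 2) k :=
  ∑ i, X (i, 0) * X (i, 1)

theorem hyp_blocks (h q j : ℕ) (hj : j < q) :
    cl q (hyp k (h + 1) ^ (j + 2)) + cl q (hyp k (h + 1) ^ j) + 1 ≤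
      2 * cl q (hyp k (h + 1) ^ (j + 1)) := by
  classical
  have := finite_frP (k := k) (Fin (h + 1) × Fin 2) q
  have hcl : ∀ g : MvPolynomial (Fin (h + 1) × Fin 2) k, cl q g = Module.finrank k
      (MvPolynomial (Fin (h + 1) × Fin 2) k ⧸ (frP (Fin (h + 1) × Fin 2) k q ⊔ Ideal.span {g})) :=
    fun g => by unfold cl; rw [sup_comm]
  rw [hcl, hcl, hcl]
  set T := hyp k (h + 1) with hT
  let υ : Fin (h + 1) × Fin 2 →₀ ℕ := Finsupp.equivFunOnFinite.symm
    (fun x => if x.2 = 0 then (if x.1 = 0 then q - 1 - j else q - 1) else 0)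
  let α : Fin (h + 1) × Fin 2 →₀ ℕ := Finsupp.equivFunOnFinite.symm
    (fun x => if x.2 = 0 then q - 1 else if x.1 = 0 then j else 0)
  set u : MvPolynomial (Fin (h + 1) × Fin 2) k := monomial υ 1 with hu
  have hTs : T = X (0, 0) * X (0, 1) +
      ∑ i : Fin h, X (i.succ, 0) * X (i.succ, 1) := by
    rw [hT, hyp, Fin.sum_univ_succ]
  set S : MvPolynomial (Fin (h + 1) × Fin 2) k :=
    ∑ i : Fin h, X (i.succ, 0) * X (i.succ, 1) with hS
  set w : MvPolynomial (Fin (h + 1) × Fin 2) k := X (0, 0) * X (0, 1) with hw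
  have hSu : S * u ∈ frP (Fin (h + 1) × Fin 2) k q := by
    rw [hS, Finset.sum_mul]
    refine Ideal.sum_mem _ fun i _ => ?_
    rw [mul_assoc, mul_left_comm]
    refine Ideal.mul_mem_left _ _ ?_
    rw [hu, X, monomial_mul, mul_one]
    refine monomial_mem_frP (i := (i.succ, 0)) ?_
    simp [υ, Fin.succ_ne_zero]
    omega
  have hdvd : ∀ n, ∃ c, T ^ n = w ^ n + S * c := by
    intro n
    obtain ⟨c, hc⟩ := sub_dvd_pow_sub_pow T w n
    have : T - w = S := by rw [hTs]; ring
    rw [this] at hc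
    exact ⟨c, by rw [← hc]; ring⟩
  have hwu : w ^ j * u = monomial α 1 := by
    rw [hw, hu, mul_pow, X_pow_eq_monomial, X_pow_eq_monomial, monomial_mul, monomial_mul]
    have hα : Finsupp.single ((0 : Fin (h + 1)), (0 : Fin 2)) j +
        Finsupp.single ((0 : Fin (h + 1)), (1 : Fin 2)) j + υ = α := by
      refine Finsupp.ext ?_
      rintro ⟨i, b⟩
      fin_cases b <;> by_cases hi : i = 0
      · subst hi
        simp [υ, α]
        omega
      · simp [υ, α, hi, Finsupp.single_apply, Ne.symm hi]
      · subst hi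
        simp [υ, α]
      · simp [υ, α, hi, Finsupp.single_apply, Ne.symm hi]
    rw [hα, mul_one, mul_one]
  refine blocks_pos (frP (Fin (h + 1) × Fin 2) k q) T u j ?_ ?_
  · obtain ⟨c, hc⟩ := hdvd (j + 1)
    have e1 : T ^ (j + 1) * u = X (0, 1) * (X (0, 0) * (w ^ j * u)) + c * (S * u) := by
      rw [hc, pow_succ, hw]; ring
    rw [e1]
    refine add_mem (Ideal.mul_mem_left _ _ ?_) (Ideal.mul_mem_left _ _ hSu)
    rw [hwu, X, monomial_mul, mul_one]
    refine monomial_mem_frP (i := (0, 0)) ?_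
    simp [α]
    omega
  · intro hmem
    have hSL : S ∈ lowI (k := k) α := by
      refine Ideal.sum_mem _ fun i _ => Ideal.mul_mem_left _ _ ?_
      have := X_pow_mem_lowI (k := k) (α := α) (i := (i.succ, 1)) (n := 1)
        (by simp [α, Fin.succ_ne_zero])
      simpa using this
    have hle : frP (Fin (h + 1) × Fin 2) k q ⊔ Ideal.span {T ^ (j + 1)} ≤ lowI α := by
      refine sup_le ?_ ?_
      · unfold frP
        rw [Ideal.span_le]
        rintro _ ⟨⟨i, b⟩, rfl⟩
        refine X_pow_mem_lowI ?_
        simp only [α, Finsupp.equivFunOnFinite_symm_apply_apply]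
        split_ifs <;> omega
      · rw [Ideal.span_singleton_le_iff_mem]
        obtain ⟨c, hc⟩ := hdvd (j + 1)
        rw [hc]
        refine add_mem ?_ (Ideal.mul_mem_right _ _ hSL)
        rw [hw, mul_pow]
        refine Ideal.mul_mem_left _ _ (X_pow_mem_lowI ?_)
        simp [α]
    have h3 := hle hmem
    obtain ⟨c, hc⟩ := hdvd j
    have h4 : monomial α (1 : k) ∈ lowI α := by
      have : monomial α (1 : k) = T ^ j * u - S * (c * u) := by
        rw [hc, ← hwu]; ring
      rw [this]
      exact sub_mem h3 (Ideal.mul_mem_right _ _ hSL)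
    have := mem_lowI.1 h4 α le_rfl
    simp at this

end hyp
end SWY

end

section
namespace SWY
open MvPolynomial

section tools
variable {k : Type*} [Field k]

theorem finrank_quot_le {A : Type*} [CommRing A] [Algebra k A] {I J : Ideal A}
    [Module.Finite k (A ⧸ I)] (h : I ≤ J) :
    Module.finrank k (A ⧸ J) ≤ Module.finrank k (A ⧸ I) :=
  LinearMap.finrank_le_finrank_of_surjective (f := (Ideal.Quotient.factorₐ k h).toLinearMap)
    (Ideal.Quotient.factor_surjective h)

theorem finrank_frP (σ : Type*) [Fintype σ] (q : ℕ) :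
    Module.finrank k (MvPolynomial σ k ⧸ frP σ k q) = q ^ Fintype.card σ := by
  classical
  let A : (σ → Fin q) → (σ →₀ ℕ) := fun r => Finsupp.equivFunOnFinite.symm (fun i => (r i : ℕ))
  have hA : Function.Injective A := by
    intro r s h
    funext i
    have := DFunLike.congr_fun h i
    simpa [A, Fin.ext_iff] using this
  let φ : MvPolynomial σ k →ₗ[k] ((σ → Fin q) → k) := LinearMap.pi fun r => lcoeff k (A r)
  have hφ : Function.Surjective φ := by
    intro v
    refine ⟨∑ r, monomial (A r) (v r), ?_⟩
    funext s
    change coeff (A s) _ = _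
    rw [coeff_sum, Finset.sum_eq_single s]
    · simp
    · intro b _ hb
      rw [coeff_monomial, if_neg (fun h => hb (hA h))]
    · simp
  have hk : LinearMap.ker φ = (frP σ k q).restrictScalars k := by
    ext g
    rw [Submodule.restrictScalars_mem, mem_frP_iff, LinearMap.mem_ker]
    constructor
    · intro h α hα
      have := congrFun h (fun i => ⟨α i, hα i⟩)
      have h2 : A (fun i => ⟨α i, hα i⟩) = α := by ext i; simp [A]
      change coeff (A _) g = 0 at this
      rwa [h2] at this
    · intro h
      funext r
      exact h _ (fun i => by simp [A])
  have e1 := (φ.quotKerEquivOfSurjective hφ).finrank_eq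
  rw [Module.finrank_pi, Fintype.card_fun, Fintype.card_fin] at e1
  rw [← e1, hk]
  exact (Submodule.Quotient.restrictScalarsEquiv k (frP σ k q)).finrank_eq.symm

theorem cl_one_var (Q n : ℕ) : cl Q ((X 0 : MvPolynomial (Fin 1) k) ^ n) = min Q n := by
  unfold cl
  have : Ideal.span {(X 0 : MvPolynomial (Fin 1) k) ^ n} ⊔ frP (Fin 1) k Q =
      frP (Fin 1) k (min Q n) := by
    have h1 : ∀ q, frP (Fin 1) k q = Ideal.span {(X 0 : MvPolynomial (Fin 1) k) ^ q} := by
      intro q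
      unfold frP
      congr 1
      ext x
      simp [eq_comm]
    rw [h1, h1]
    rcases le_total Q n with h | h
    · rw [min_eq_left h]
      refine sup_eq_right.2 ?_
      rw [Ideal.span_singleton_le_span_singleton]
      exact pow_dvd_pow _ h
    · rw [min_eq_right h]
      refine sup_eq_left.2 ?_
      rw [Ideal.span_singleton_le_span_singleton]
      exact pow_dvd_pow _ h
  rw [this, finrank_frP]
  simp

theorem cl_rename {σ τ : Type*} [Fintype σ] [Fintype τ] (ε : σ ≃ τ) (q : ℕ)
    (f : MvPolynomial σ k) : cl q (rename ε f) = cl q f := by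
  unfold cl
  have : Ideal.span {rename ε f} ⊔ frP τ k q =
      (Ideal.span {f} ⊔ frP σ k q).map (renameEquiv k ε : MvPolynomial σ k →+* MvPolynomial τ k) := by
    rw [Ideal.map_sup, Ideal.map_span, Set.image_singleton]
    unfold frP
    rw [Ideal.map_span, ← Set.range_comp]
    congr 1
    congr 1
    ext x
    constructor
    · rintro ⟨i, rfl⟩
      exact ⟨ε.symm i, by simp⟩
    · rintro ⟨i, rfl⟩
      exact ⟨ε i, by simp⟩
  exact (Ideal.quotientEquivAlg _ _ (renameEquiv k ε) this).toLinearEquiv.finrank_eq.symm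

theorem TS_frP {σ τ : Type*} (Q : ℕ) (f : MvPolynomial σ k) (g : MvPolynomial τ k) :
    TS (frP σ k Q) (frP τ k Q) f g =
      Ideal.span {rename Sum.inl f + rename Sum.inr g} ⊔ frP (σ ⊕ τ) k Q := by
  unfold TS
  rw [sup_comm]
  congr 1
  unfold frP
  rw [Ideal.map_span, Ideal.map_span, ← Ideal.span_union, ← Set.range_comp, ← Set.range_comp]
  congr 1
  ext x
  constructor
  · rintro (⟨i, rfl⟩ | ⟨i, rfl⟩)
    · exact ⟨Sum.inl i, by simp⟩
    · exact ⟨Sum.inr i, by simp⟩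
  · rintro ⟨i | i, rfl⟩
    · exact Or.inl ⟨i, by simp⟩
    · exact Or.inr ⟨i, by simp⟩

theorem KF_cl {σ : Type*} [Fintype σ] (Q : ℕ) (f : MvPolynomial σ k) (m : ℕ)
    (hm : f ^ m ∈ frP σ k Q) :
    ∃ (r : ℕ) (a : Fin r → ℕ), (∀ t, cl Q (f ^ t) = ∑ i, min (a i) t) ∧
      ∀ (τ : Type) [Fintype τ] (g : MvPolynomial τ k),
        cl Q (rename Sum.inl f + rename Sum.inr g : MvPolynomial (σ ⊕ τ) k) =
          ∑ i, cl Q (g ^ a i) := by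
  have := finite_frP (k := k) σ Q
  obtain ⟨r, a, h1, h2⟩ := KF (frP σ k Q) f m hm
  refine ⟨r, a, h1, ?_⟩
  intro τ _ g
  have := finite_frP (k := k) τ Q
  have := h2 τ (frP τ k Q) g
  rw [TS_frP] at this
  exact this

theorem hyp_Fz (p : ℕ) [Fact p.Prime] [CharP k p] (h : ℕ) : Fz p (hyp k h) :=
  Fz.sum _ _ fun _ _ => (Fz.X p _).mul (Fz.X p _)

/-- block data for the hyperbolic form -/
theorem hyp_data (p : ℕ) [Fact p.Prime] [CharP k p] (h s e j : ℕ) (hj : j < p ^ s) :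
    ∃ (r : ℕ) (a : Fin r → ℕ),
      (∑ i, min (a i) ((j + 2) * p ^ e)) + (∑ i, min (a i) (j * p ^ e)) + p ^ (2 * (h + 1) * e) ≤
        2 * ∑ i, min (a i) ((j + 1) * p ^ e) ∧
      ∀ (τ : Type) [Fintype τ] (g : MvPolynomial τ k),
        cl (p ^ s * p ^ e) (rename Sum.inl (hyp k (h + 1)) + rename Sum.inr g :
          MvPolynomial ((Fin (h + 1) × Fin 2) ⊕ τ) k) = ∑ i, cl (p ^ s * p ^ e) (g ^ a i) := by
  obtain ⟨r, a, h1, h2⟩ := KF_cl (k := k) (p ^ s * p ^ e) (hyp k (h + 1)) (p ^ (s + e)) (by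
    rw [← hyp_Fz p (h + 1) (s + e), hyp, map_sum, ← pow_add]
    refine Ideal.sum_mem _ fun i _ => ?_
    rw [map_mul, expand_X, expand_X]
    exact Ideal.mul_mem_left _ _ (Ideal.subset_span ⟨_, rfl⟩))
  refine ⟨r, a, ?_, h2⟩
  rw [← h1, ← h1, ← h1, cl_scale p e _ _ (hyp_Fz p _), cl_scale p e _ _ (hyp_Fz p _),
    cl_scale p e _ _ (hyp_Fz p _)]
  have hb := hyp_blocks (k := k) h (p ^ s) j hj
  have hc : Fintype.card (Fin (h + 1) × Fin 2) = 2 * (h + 1) := by simp; ring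
  rw [hc]
  have : p ^ (2 * (h + 1) * e) = (p ^ e) ^ (2 * (h + 1)) := by rw [← pow_mul]; ring
  rw [this]
  nlinarith [Nat.mul_le_mul_left ((p ^ e) ^ (2 * (h + 1))) hb]

theorem even_gap (p : ℕ) [Fact p.Prime] [CharP k p] (h e : ℕ) :
    cl (p ^ 3 * p ^ e) (rename Sum.inl (hyp k (h + 1)) + rename Sum.inr (X 0 ^ 2) :
      MvPolynomial ((Fin (h + 1) × Fin 2) ⊕ Fin 1) k) + p ^ (2 * (h + 1) * e) ≤
    cl (p ^ 3 * p ^ e) (rename Sum.inl (hyp k (h + 1)) + rename Sum.inr (X 0 ^ 3) :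
      MvPolynomial ((Fin (h + 1) × Fin 2) ⊕ Fin 1) k) := by
  have hp2 := (Fact.out : p.Prime).two_le
  obtain ⟨r, a, h1, h2⟩ := hyp_data (k := k) p h 3 e 0 (by positivity)
  rw [h2, h2]
  simp only [← pow_mul, cl_one_var]
  have h8 : 8 * p ^ e ≤ p ^ 3 * p ^ e :=
    Nat.mul_le_mul_right _ (by calc 8 = 2 ^ 3 := rfl
                                  _ ≤ p ^ 3 := Nat.pow_le_pow_left hp2 3)
  have key : ∑ i, (min (p ^ 3 * p ^ e) (2 * a i) + 2 * min (a i) (1 * p ^ e)) ≤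
      ∑ i, (min (p ^ 3 * p ^ e) (3 * a i) + min (a i) (2 * p ^ e)) := by
    refine Finset.sum_le_sum fun i _ => ?_
    generalize p ^ 3 * p ^ e = Q at *
    generalize p ^ e = q at *
    omega
  rw [Finset.sum_add_distrib, Finset.sum_add_distrib, ← Finset.mul_sum] at key
  simp only [zero_add, zero_mul, Nat.min_zero, Finset.sum_const_zero, add_zero] at h1
  omega
end tools
end SWY

end

section
namespace SWY
open MvPolynomial

section two
variable {k : Type*} [Field k]

theorem frP_two (q : ℕ) : frP (Fin 2) k q = Ideal.span {(X 0 : MvPolynomial (Fin 2) k) ^ q} ⊔ Ideal.span {(X 1 : MvPolynomial (Fin 2) k) ^ q} := by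
  unfold frP
  rw [← Ideal.span_union]
  congr 1
  ext x
  constructor
  · rintro ⟨i, rfl⟩
    fin_cases i
    · exact Or.inl rfl
    · exact Or.inr rfl
  · rintro (h | h)
    · exact ⟨0, h.symm⟩
    · exact ⟨1, h.symm⟩

theorem fin2_le (a b : ℕ) :
    Module.Finite k ((MvPolynomial (Fin 2) k) ⧸ (Ideal.span {(X 0 : MvPolynomial (Fin 2) k) ^ a} ⊔ Ideal.span {(X 1 : MvPolynomial (Fin 2) k) ^ b})) ∧
    Module.finrank k ((MvPolynomial (Fin 2) k) ⧸ (Ideal.span {(X 0 : MvPolynomial (Fin 2) k) ^ a} ⊔ Ideal.span {(X 1 : MvPolynomial (Fin 2) k) ^ b})) ≤ a * b := by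
  have h1 : Ideal.span {(X 1 : MvPolynomial (Fin 2) k)} ⊔ Ideal.span {(X 0 : MvPolynomial (Fin 2) k)} = frP (Fin 2) k 1 := by
    rw [frP_two, pow_one, pow_one, sup_comm]
  have f1 : Module.Finite k ((MvPolynomial (Fin 2) k) ⧸ (Ideal.span {(X 1 : MvPolynomial (Fin 2) k)} ⊔ Ideal.span {(X 0 : MvPolynomial (Fin 2) k)})) := by
    rw [h1]; exact finite_frP _ _
  have n1 : Module.finrank k ((MvPolynomial (Fin 2) k) ⧸ (Ideal.span {(X 1 : MvPolynomial (Fin 2) k)} ⊔ Ideal.span {(X 0 : MvPolynomial (Fin 2) k)})) = 1 := by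
    rw [h1, finrank_frP]; simp
  obtain ⟨f2, n2⟩ := colen_pow (k := k) (Ideal.span {(X 1 : MvPolynomial (Fin 2) k)}) (X 0) a
  rw [n1, mul_one] at n2
  rw [sup_comm] at f2 n2
  obtain ⟨f3, n3⟩ := colen_pow (k := k) (Ideal.span {(X 0 : MvPolynomial (Fin 2) k) ^ a}) (X 1) b
  refine ⟨f3, n3.trans ?_⟩
  rw [mul_comm]
  exact Nat.mul_le_mul_right _ n2

theorem cl_le_sq (Q : ℕ) (g : MvPolynomial (Fin 2) k) : cl Q g ≤ Q ^ 2 := by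
  have := finite_frP (k := k) (Fin 2) Q
  have h := finrank_frP (k := k) (Fin 2) Q
  rw [Fintype.card_fin] at h
  rw [← h]
  exact finrank_quot_le le_sup_right

theorem cl_mono {σ : Type*} [Fintype σ] (Q : ℕ) (g : MvPolynomial σ k) {a b : ℕ} (h : a ≤ b) :
    cl Q (g ^ a) ≤ cl Q (g ^ b) := by
  have : Module.Finite k (MvPolynomial σ k ⧸ (Ideal.span {g ^ b} ⊔ frP σ k Q)) :=
    finite_quotP (q := Q) le_sup_right
  refine finrank_quot_le (sup_le_sup_right ?_ _)
  rw [Ideal.span_singleton_le_span_singleton]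
  exact pow_dvd_pow _ h

theorem cl_add {σ : Type*} [Fintype σ] (Q : ℕ) (g : MvPolynomial σ k) (a b : ℕ) :
    cl Q (g ^ (a + b)) ≤ cl Q (g ^ a) + cl Q (g ^ b) := by
  have h : ∀ g : MvPolynomial σ k, Module.Finite k (MvPolynomial σ k ⧸ (frP σ k Q ⊔ Ideal.span {g})) :=
    fun g => finite_quotP (q := Q) le_sup_left
  have h1 := h (g ^ a)
  have h2 := h (g ^ b)
  have hcl : ∀ g : MvPolynomial σ k, cl Q g = Module.finrank k
      (MvPolynomial σ k ⧸ (frP σ k Q ⊔ Ideal.span {g})) :=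
    fun g => by unfold cl; rw [sup_comm]
  rw [hcl, hcl, hcl, pow_add]
  exact (colen_mul (k := k) (frP σ k Q) (g ^ a) (g ^ b)).2

theorem g1_le (Q a : ℕ) (ha : a ≤ Q) :
    cl Q ((X 0 * X 1 : MvPolynomial (Fin 2) k) ^ a) ≤ a * Q + a * (Q - a) := by
  have := finite_frP (k := k) (Fin 2) Q
  have hcl : cl Q ((X 0 * X 1 : MvPolynomial (Fin 2) k) ^ a) = Module.finrank k
      ((MvPolynomial (Fin 2) k) ⧸ (frP (Fin 2) k Q ⊔ Ideal.span {X 0 ^ a * X 1 ^ a})) := by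
    unfold cl; rw [sup_comm, mul_pow]
  let C : Ideal (MvPolynomial (Fin 2) k) := Submodule.comap (LinearMap.mulLeft (MvPolynomial (Fin 2) k) (X 0 ^ a))
    (frP (Fin 2) k Q ⊔ Ideal.span {X 0 ^ a * X 1 ^ a})
  have hC : ∀ x, x ∈ C ↔ X 0 ^ a * x ∈ frP (Fin 2) k Q ⊔ Ideal.span {X 0 ^ a * X 1 ^ a} :=
    fun x => Iff.rfl
  rw [hcl, colen_colon (k := k) _ _ _ C hC]
  refine add_le_add ?_ ?_
  · obtain ⟨f1, n1⟩ := fin2_le (k := k) a Q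
    refine le_trans (finrank_quot_le ?_) n1
    refine sup_le le_sup_right (le_trans ?_ le_sup_left)
    rw [frP_two]
    exact le_sup_right
  · obtain ⟨f1, n1⟩ := fin2_le (k := k) (Q - a) a
    rw [mul_comm a]
    refine le_trans (finrank_quot_le ?_) n1
    refine sup_le ?_ ?_
    · rw [Ideal.span_singleton_le_iff_mem, hC, ← pow_add, Nat.add_sub_cancel' ha]
      exact Ideal.mem_sup_left (Ideal.subset_span ⟨0, rfl⟩)
    · rw [Ideal.span_singleton_le_iff_mem, hC]
      exact Ideal.mem_sup_right (Ideal.mem_span_singleton_self _)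

theorem g1_ub (Q a : ℕ) : cl Q ((X 0 * X 1 : MvPolynomial (Fin 2) k) ^ a) + (Q - a) ^ 2 ≤ Q ^ 2 := by
  rcases le_total a Q with h | h
  · have := g1_le (k := k) Q a h
    obtain ⟨c, rfl⟩ := Nat.exists_eq_add_of_le h
    rw [Nat.add_sub_cancel_left] at this ⊢
    nlinarith
  · rw [Nat.sub_eq_zero_of_le h]
    simpa using cl_le_sq Q _

theorem g2_le (Q b : ℕ) : cl Q ((X 0 ^ 2 + X 1 ^ 3 : MvPolynomial (Fin 2) k) ^ b) ≤ 2 * b * Q := by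
  obtain ⟨f1, n1⟩ := fin2_le (k := k) 2 1
  have hI : Ideal.span {(X 0 : MvPolynomial (Fin 2) k) ^ 2} ⊔ Ideal.span {(X 1 : MvPolynomial (Fin 2) k) ^ 1} ≤
      Ideal.span {(X 0 ^ 2 + X 1 ^ 3 : MvPolynomial (Fin 2) k)} ⊔ Ideal.span {(X 1 : MvPolynomial (Fin 2) k)} := by
    refine sup_le ?_ (by rw [pow_one]; exact le_sup_right)
    rw [Ideal.span_singleton_le_iff_mem]
    have : (X 0 : MvPolynomial (Fin 2) k) ^ 2 = (X 0 ^ 2 + X 1 ^ 3) - X 1 ^ 2 * X 1 := by ring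
    have h2 := sub_mem (H := Ideal.span {(X 0 ^ 2 + X 1 ^ 3 : MvPolynomial (Fin 2) k)} ⊔
      Ideal.span {(X 1 : MvPolynomial (Fin 2) k)}) (Ideal.mem_sup_left (Ideal.mem_span_singleton_self _))
      (Ideal.mem_sup_right (Ideal.mul_mem_left _ (X 1 ^ 2) (Ideal.mem_span_singleton_self _)))
    rwa [← this] at h2
  have f2 : Module.Finite k ((MvPolynomial (Fin 2) k) ⧸ (Ideal.span {(X 0 ^ 2 + X 1 ^ 3 : MvPolynomial (Fin 2) k)} ⊔ Ideal.span {(X 1 : MvPolynomial (Fin 2) k)})) :=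
    Module.Finite.of_surjective (Ideal.Quotient.factorₐ k hI).toLinearMap
      (Ideal.Quotient.factor_surjective hI)
  have n2 := (finrank_quot_le (k := k) hI).trans n1
  obtain ⟨f3, n3⟩ := colen_pow (k := k) (Ideal.span {(X 0 ^ 2 + X 1 ^ 3 : MvPolynomial (Fin 2) k)}) (X 1) Q
  rw [sup_comm] at f3 n3
  obtain ⟨f4, n4⟩ := colen_pow (k := k) (Ideal.span {(X 1 : MvPolynomial (Fin 2) k) ^ Q}) (X 0 ^ 2 + X 1 ^ 3 : MvPolynomial (Fin 2) k) b
  unfold cl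
  refine (finrank_quot_le (I := Ideal.span {(X 1 : MvPolynomial (Fin 2) k) ^ Q} ⊔
    Ideal.span {(X 0 ^ 2 + X 1 ^ 3 : MvPolynomial (Fin 2) k) ^ b}) ?_).trans (n4.trans ?_)
  · rw [frP_two]
    exact sup_le (le_sup_right.trans le_sup_right) le_sup_left
  · calc _ ≤ b * (Q * (2 * 1)) := Nat.mul_le_mul_left _ (n3.trans (Nat.mul_le_mul_left _ n2))
      _ = _ := by ring

theorem monomial_fin2 (α : Fin 2 →₀ ℕ) : (monomial α 1 : MvPolynomial (Fin 2) k) = X 0 ^ α 0 * X 1 ^ α 1 := by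
  rw [monomial_eq, Finsupp.prod_fintype _ _ (by simp)]
  simp

theorem g2_lb (Q a : ℕ) : Q ^ 2 ≤ cl Q ((X 0 ^ 2 + X 1 ^ 3 : MvPolynomial (Fin 2) k) ^ a) + (Q - a) ^ 2 := by
  classical
  have hfin := finite_frP (k := k) (Fin 2) Q
  set J := frP (Fin 2) k Q with hJ
  set G : (MvPolynomial (Fin 2) k) := X 0 ^ 2 + X 1 ^ 3 with hG
  have hle : J ≤ Ideal.span {G ^ a} ⊔ J := le_sup_right
  let π : ((MvPolynomial (Fin 2) k) ⧸ J) →ₗ[k] ((MvPolynomial (Fin 2) k) ⧸ (Ideal.span {G ^ a} ⊔ J)) := (Ideal.Quotient.factorₐ k hle).toLinearMap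
  have hπ : Function.Surjective π := Ideal.Quotient.factor_surjective hle
  have h1 := Submodule.finrank_quotient_add_finrank (LinearMap.ker π)
  have hQ : Module.finrank k (MvPolynomial (Fin 2) k ⧸ J) = Q ^ 2 := by
    rw [hJ, finrank_frP, Fintype.card_fin]
  rw [(π.quotKerEquivOfSurjective hπ).finrank_eq, hQ] at h1
  rw [← h1]
  refine Nat.add_le_add_left ?_ _
  set c := Q - a with hc
  let v : Fin c × Fin c → ((MvPolynomial (Fin 2) k) ⧸ J) := fun x =>
    Ideal.Quotient.mk J (if (x.1 : ℕ) + x.2 < c then X 0 ^ (x.1 : ℕ) * X 1 ^ (x.2 : ℕ) * G ^ a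
      else X 0 ^ (x.1 + a : ℕ) * X 1 ^ (x.2 + a : ℕ))
  have hv : LinearMap.ker π ≤ Submodule.span k (Set.range v) := by
    intro x hx
    obtain ⟨x, rfl⟩ := Ideal.Quotient.mk_surjective x
    have hx' : Ideal.Quotient.mk (Ideal.span {G ^ a} ⊔ J) x = 0 := hx
    rw [Ideal.Quotient.eq_zero_iff_mem] at hx'
    obtain ⟨y, hy, j, hj, rfl⟩ := Submodule.mem_sup.1 hx'
    obtain ⟨y, rfl⟩ := Ideal.mem_span_singleton'.1 hy
    rw [map_add, Ideal.Quotient.eq_zero_iff_mem.2 hj, add_zero]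
    clear hy hx hx'
    induction y using MvPolynomial.induction_on' with
    | add y1 y2 h1 h2 =>
      rw [add_mul, map_add]
      exact add_mem h1 h2
    | monomial α s =>
      have hs : (monomial α s : MvPolynomial (Fin 2) k) = s • monomial α 1 := by
        rw [smul_monomial, smul_eq_mul, mul_one]
      have hmk : ∀ (t : k) (y : MvPolynomial (Fin 2) k),
          Ideal.Quotient.mk J (t • y) = t • Ideal.Quotient.mk J y := fun t y => rfl
      rw [hs, smul_mul_assoc, hmk]
      refine Submodule.smul_mem _ _ ?_
      by_cases hα : α 0 + α 1 < c
      · refine Submodule.subset_span ⟨(⟨α 0, by omega⟩, ⟨α 1, by omega⟩), ?_⟩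
        simp only [v]
        rw [if_pos hα, monomial_fin2]
      · have hdeg : monomial α 1 * G ^ a ∈ idealOfVars (Fin 2) k ^ (c + 2 * a) := by
          rw [pow_add, pow_mul]
          have hX : ∀ i, (X i : MvPolynomial (Fin 2) k) ∈ idealOfVars (Fin 2) k :=
            fun i => Ideal.subset_span ⟨i, rfl⟩
          refine Ideal.mul_mem_mul ?_ (Ideal.pow_mem_pow ?_ _)
          · rw [monomial_mem_pow_idealOfVars_iff _ _ one_ne_zero, Finsupp.degree_eq_sum]
            simp
            omega
          · rw [hG]
            exact add_mem (Ideal.pow_mem_pow (hX 0) 2)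
              (Ideal.pow_le_pow_right (by norm_num) (Ideal.pow_mem_pow (hX 1) 3))
        rw [mem_pow_idealOfVars_iff] at hdeg
        rw [← support_sum_monomial_coeff (monomial α 1 * G ^ a), map_sum]
        refine Submodule.sum_mem _ fun β hβ => ?_
        have hd := hdeg β hβ
        rw [Finsupp.degree_eq_sum, Fin.sum_univ_two] at hd
        have hs : ∀ s : k, (monomial β s : MvPolynomial (Fin 2) k) = s • monomial β 1 := by
          intro s
          rw [smul_monomial, smul_eq_mul, mul_one]
        rw [hs, hmk]
        refine Submodule.smul_mem _ _ ?_
        by_cases hb : β 0 < Q ∧ β 1 < Q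
        · obtain ⟨i, hi⟩ := Nat.exists_eq_add_of_le (show a ≤ β 0 by omega)
          obtain ⟨j, hj⟩ := Nat.exists_eq_add_of_le (show a ≤ β 1 by omega)
          refine Submodule.subset_span ⟨(⟨i, by omega⟩, ⟨j, by omega⟩), ?_⟩
          simp only [v]
          rw [if_neg (by omega), monomial_fin2, hi, hj, add_comm a, add_comm a]
        · have : (monomial β 1 : MvPolynomial (Fin 2) k) ∈ J := by
            by_cases hb0 : β 0 < Q
            · exact monomial_mem_frP (i := 1) (by omega)
            · exact monomial_mem_frP (i := 0) (by omega)
          rw [Ideal.Quotient.eq_zero_iff_mem.2 this]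
          exact zero_mem _
  have h2 : Module.finrank k (LinearMap.ker π) ≤ Module.finrank k (Submodule.span k (Set.range v)) :=
    Submodule.finrank_mono hv
  refine h2.trans ((finrank_range_le_card v).trans ?_)
  simp [pow_two]

/-- the cusp has colength at least `2p` -/
theorem cusp_lb (p : ℕ) [Fact p.Prime] : 2 * p ≤ cl p (X 0 ^ 2 + X 1 ^ 3 : MvPolynomial (Fin 2) k) := by
  have hp := (Fact.out : p.Prime)
  have i1 := finite_frP (k := k) (Fin 1) p
  have i2 := finite_frP (k := k) (Fin 1) (2 * p)
  have hm : ((X 0 : MvPolynomial (Fin 1) k) ^ 3) ^ p ∈ frP (Fin 1) k p := by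
    rw [← pow_mul, mul_comm, pow_mul]
    have h0 : (X 0 ^ p : MvPolynomial (Fin 1) k) ∈ frP (Fin 1) k p := Ideal.subset_span ⟨0, rfl⟩
    exact Ideal.pow_mem_of_mem _ h0 3 (by norm_num)
  obtain ⟨r, a, h1, h2⟩ := KF (frP (Fin 1) k p) (X 0 ^ 3) p hm
  have h3 := h2 (Fin 1) (frP (Fin 1) k (2 * p)) (X 0 ^ 2)
  have h4 : ∀ i, Module.finrank k (MvPolynomial (Fin 1) k ⧸
      (Ideal.span {((X 0 : MvPolynomial (Fin 1) k) ^ 2) ^ a i} ⊔ frP (Fin 1) k (2 * p))) =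
      2 * min (a i) p := by
    intro i
    rw [← pow_mul]
    refine (cl_one_var (k := k) (2 * p) (2 * a i)).trans ?_
    omega
  have h5 := h1 p
  rw [← pow_mul] at h5
  have h6 := h5.symm.trans (cl_one_var (k := k) p (3 * p))
  rw [Finset.sum_congr rfl (fun i _ => h4 i), ← Finset.mul_sum, h6, min_eq_left (by omega)] at h3
  set T := TS (frP (Fin 1) k p) (frP (Fin 1) k (2 * p)) (X 0 ^ 3 : MvPolynomial (Fin 1) k)
    (X 0 ^ 2 : MvPolynomial (Fin 1) k) with hT
  let ε : Fin 1 ⊕ Fin 1 ≃ Fin 2 := Equiv.ofBijective (Sum.elim (fun _ => 1) (fun _ => 0)) (by decide)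
  have hcl : cl p (X 0 ^ 2 + X 1 ^ 3 : MvPolynomial (Fin 2) k) =
      cl p (X (Sum.inl 0) ^ 3 + X (Sum.inr 0) ^ 2 : MvPolynomial (Fin 1 ⊕ Fin 1) k) := by
    rw [← cl_rename ε]
    simp [ε, add_comm]
  have hg : (X (Sum.inl 0) ^ 3 + X (Sum.inr 0) ^ 2 : MvPolynomial (Fin 1 ⊕ Fin 1) k) ∈ T := by
    refine Ideal.mem_sup_right ?_
    have : (X (Sum.inl 0) ^ 3 + X (Sum.inr 0) ^ 2 : MvPolynomial (Fin 1 ⊕ Fin 1) k) =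
      rename Sum.inl (X 0 ^ 3) + rename Sum.inr (X 0 ^ 2) := by simp
    rw [this]
    exact Ideal.mem_span_singleton_self _
  have hw : (X (Sum.inl 0) ^ p : MvPolynomial (Fin 1 ⊕ Fin 1) k) ∈ T := by
    refine Ideal.mem_sup_left (Ideal.mem_sup_left ?_)
    have : (X (Sum.inl 0) ^ p : MvPolynomial (Fin 1 ⊕ Fin 1) k) = rename Sum.inl (X 0 ^ p) := by simp
    rw [this]
    have h0 : (X 0 ^ p : MvPolynomial (Fin 1) k) ∈ frP (Fin 1) k p := Ideal.subset_span ⟨0, rfl⟩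
    exact Ideal.mem_map_of_mem _ h0
  have hw' : ∀ n, p ≤ n → (X (Sum.inl 0) ^ n : MvPolynomial (Fin 1 ⊕ Fin 1) k) ∈ T := by
    intro n hn
    exact Ideal.mem_of_dvd _ (pow_dvd_pow _ hn) hw
  have hz : (X (Sum.inr 0) ^ p : MvPolynomial (Fin 1 ⊕ Fin 1) k) ∈ T := by
    set z : MvPolynomial (Fin 1 ⊕ Fin 1) k := X (Sum.inr 0)
    set w : MvPolynomial (Fin 1 ⊕ Fin 1) k := X (Sum.inl 0)
    have hn : ∀ s, p ≤ 3 * s → z ^ (2 * s) ∈ T := by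
      intro s hs
      obtain ⟨c, hc⟩ := sub_dvd_pow_sub_pow (z ^ 2) (-w ^ 3) s
      have : z ^ (2 * s) = (w ^ 3 + z ^ 2) * c + (-1) ^ s * w ^ (3 * s) := by
        rw [pow_mul z, pow_mul w, ← mul_pow, neg_one_mul, ← sub_eq_iff_eq_add, hc]
        ring
      rw [this]
      exact add_mem (Ideal.mul_mem_right _ _ hg) (Ideal.mul_mem_left _ _ (hw' _ hs))
    rcases hp.eq_two_or_odd' with h | ⟨s, hs⟩
    · rw [h]
      exact hn 1 (by omega)
    · rw [hs, pow_succ]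
      exact Ideal.mul_mem_right _ _ (hn s (by have := hp.two_le; omega))
  rw [hcl, ← h3]
  have : Module.Finite k (MvPolynomial (Fin 1 ⊕ Fin 1) k ⧸ (Ideal.span {X (Sum.inl 0) ^ 3 +
      X (Sum.inr 0) ^ 2} ⊔ frP (Fin 1 ⊕ Fin 1) k p)) := finite_quotP (q := p) le_sup_right
  refine finrank_quot_le (sup_le ?_ ?_)
  · rwa [Ideal.span_singleton_le_iff_mem]
  · unfold frP
    rw [Ideal.span_le]
    rintro _ ⟨i | i, rfl⟩
    · fin_cases i; exact hw
    · fin_cases i; exact hz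

theorem g2_mid (p : ℕ) [Fact p.Prime] [CharP k p] (e : ℕ) :
    2 * p * (p ^ e) ^ 2 ≤ cl (p * p ^ e) ((X 0 ^ 2 + X 1 ^ 3 : MvPolynomial (Fin 2) k) ^ p ^ e) := by
  have h := cl_scale (k := k) p e p 1 (f := (X 0 ^ 2 + X 1 ^ 3 : MvPolynomial (Fin 2) k))
    (((Fz.X p 0).pow 2).add ((Fz.X p 1).pow 3))
  rw [one_mul, pow_one, Fintype.card_fin] at h
  rw [h, mul_comm]
  exact Nat.mul_le_mul_left _ (cusp_lb p)

theorem hat_aux (p q m Q a x1 x2 : ℕ) (hp : 2 ≤ p) (hm : m = p ^ 3 * q) (hQ : Q = p * m)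
    (g1 g2 : ℕ → ℕ) (m1 : Monotone g1) (m2 : Monotone g2)
    (s1 : ∀ a b, g1 (a + b) ≤ g1 a + g1 b) (s2 : ∀ a b, g2 (a + b) ≤ g2 a + g2 b)
    (b1 : ∀ b, g1 b ≤ 2 * b * Q) (b2 : ∀ b, g2 b ≤ 2 * b * Q)
    (u1 : g1 m + m ^ 2 ≤ 2 * m * Q) (l2 : 2 * p * m ^ 2 ≤ g2 m)
    (le : ∀ a, g1 a ≤ g2 a) (h1 : x1 = m - q) (h2 : x2 = m + q) :
    g1 a + q * (2 * min a m) ≤ g2 a + q * (min a x1 + min a x2) := by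
  have hqm : q ≤ m := by rw [hm]; exact Nat.le_mul_of_pos_left _ (by positivity)
  by_cases hfar : a + q ≤ m ∨ m + q ≤ a
  · have : 2 * min a m ≤ min a x1 + min a x2 := by omega
    exact add_le_add (le a) (Nat.mul_le_mul_left _ this)
  · have h3 : 2 * min a m ≤ min a x1 + min a x2 + q := by omega
    have h4 : q * (2 * min a m) ≤ q * (min a x1 + min a x2) + q * q := by
      rw [← mul_add]; exact Nat.mul_le_mul_left _ h3
    have hbig : 2 * q * Q + q * q ≤ m ^ 2 := by
      have e1 : 2 * q * Q + q * q = (2 * p ^ 4 + 1) * (q * q) := by rw [hQ, hm]; ring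
      have e2 : m ^ 2 = p ^ 6 * (q * q) := by rw [hm]; ring
      rw [e1, e2]
      refine Nat.mul_le_mul_right _ ?_
      have : p ^ 4 * 4 ≤ p ^ 6 := by
        calc p ^ 4 * 4 = p ^ 4 * 2 ^ 2 := by norm_num
          _ ≤ p ^ 4 * p ^ 2 := Nat.mul_le_mul_left _ (Nat.pow_le_pow_left hp 2)
          _ = p ^ 6 := by ring
      have : 0 < p ^ 4 := by positivity
      omega
    have h5 : 2 * m * Q = 2 * p * m ^ 2 := by rw [hQ]; ring
    have h6 : g1 a + q * q ≤ g2 a := by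
      rcases le_total a m with h | h
      · obtain ⟨c, hc⟩ := Nat.exists_eq_add_of_le h
        have t1 := m1 h
        have t2 := s2 a c
        rw [← hc] at t2
        have t3 := b2 c
        have t4 : 2 * c * Q ≤ 2 * q * Q := Nat.mul_le_mul_right _ (by omega)
        omega
      · obtain ⟨c, hc⟩ := Nat.exists_eq_add_of_le h
        have t1 := m2 h
        have t2 := s1 m c
        rw [← hc] at t2
        have t3 := b1 c
        have t4 : 2 * c * Q ≤ 2 * q * Q := Nat.mul_le_mul_right _ (by omega)
        omega
    omega

theorem odd_gap (p : ℕ) [Fact p.Prime] [CharP k p] (h e : ℕ) :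
    cl (p ^ 4 * p ^ e) (rename Sum.inl (hyp k (h + 1)) + rename Sum.inr (X 0 * X 1) :
      MvPolynomial ((Fin (h + 1) × Fin 2) ⊕ Fin 2) k) + p ^ ((2 * (h + 1) + 1) * e) ≤
    cl (p ^ 4 * p ^ e) (rename Sum.inl (hyp k (h + 1)) + rename Sum.inr (X 0 ^ 2 + X 1 ^ 3) :
      MvPolynomial ((Fin (h + 1) × Fin 2) ⊕ Fin 2) k) := by
  have hp2 := (Fact.out : p.Prime).two_le
  have hp3 : 0 < p ^ 3 := by positivity
  obtain ⟨r, a, h1, h2⟩ := hyp_data (k := k) p h 4 e (p ^ 3 - 1)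
    ((Nat.sub_lt hp3 one_pos).trans_le (Nat.pow_le_pow_right (by omega) (by norm_num)))
  rw [h2, h2]
  have hj1 : p ^ 3 - 1 + 1 = p ^ 3 := by omega
  have hj2 : (p ^ 3 - 1 + 2) * p ^ e = p ^ 3 * p ^ e + p ^ e := by
    have : p ^ 3 - 1 + 2 = p ^ 3 + 1 := by omega
    rw [this]; ring
  have hj0 : (p ^ 3 - 1) * p ^ e = p ^ 3 * p ^ e - p ^ e := by
    rw [Nat.sub_mul, one_mul]
  rw [hj1] at h1
  have hQ : p ^ 4 * p ^ e = p * (p ^ 3 * p ^ e) := by ring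
  have hle : ∀ b, cl (p ^ 4 * p ^ e) ((X 0 * X 1 : MvPolynomial (Fin 2) k) ^ b) ≤
      cl (p ^ 4 * p ^ e) ((X 0 ^ 2 + X 1 ^ 3 : MvPolynomial (Fin 2) k) ^ b) := by
    intro b
    have t1 := g1_ub (k := k) (p ^ 4 * p ^ e) b
    have t2 := g2_lb (k := k) (p ^ 4 * p ^ e) b
    omega
  have hl2 : 2 * p * (p ^ 3 * p ^ e) ^ 2 ≤
      cl (p ^ 4 * p ^ e) ((X 0 ^ 2 + X 1 ^ 3 : MvPolynomial (Fin 2) k) ^ (p ^ 3 * p ^ e)) := by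
    have := g2_mid (k := k) p (3 + e)
    rw [pow_add] at this
    rw [hQ]
    exact this
  have hu1 : cl (p ^ 4 * p ^ e) ((X 0 * X 1 : MvPolynomial (Fin 2) k) ^ (p ^ 3 * p ^ e)) +
      (p ^ 3 * p ^ e) ^ 2 ≤ 2 * (p ^ 3 * p ^ e) * (p ^ 4 * p ^ e) := by
    have hmQ : p ^ 3 * p ^ e ≤ p ^ 4 * p ^ e := by
      rw [hQ]; exact Nat.le_mul_of_pos_left _ (by omega)
    have := g1_le (k := k) (p ^ 4 * p ^ e) (p ^ 3 * p ^ e) hmQ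
    obtain ⟨c, hc⟩ := Nat.exists_eq_add_of_le hmQ
    rw [hc, Nat.add_sub_cancel_left] at this
    rw [hc]
    nlinarith
  have key := Finset.sum_le_sum (s := Finset.univ) fun (i : Fin r) _ =>
    hat_aux p (p ^ e) (p ^ 3 * p ^ e) (p ^ 4 * p ^ e) (a i)
    ((p ^ 3 - 1) * p ^ e) ((p ^ 3 - 1 + 2) * p ^ e) hp2 rfl hQ
    (fun b => cl (p ^ 4 * p ^ e) ((X 0 * X 1 : MvPolynomial (Fin 2) k) ^ b))
    (fun b => cl (p ^ 4 * p ^ e) ((X 0 ^ 2 + X 1 ^ 3 : MvPolynomial (Fin 2) k) ^ b))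
    (fun _ _ h => cl_mono _ _ h) (fun _ _ h => cl_mono _ _ h)
    (fun _ _ => cl_add _ _ _ _) (fun _ _ => cl_add _ _ _ _)
    (fun b => (hle b).trans (g2_le _ b)) (fun b => g2_le _ b) hu1 hl2 hle hj0 hj2
  simp only [Finset.sum_add_distrib, ← Finset.mul_sum] at key
  have hpow : p ^ ((2 * (h + 1) + 1) * e) = p ^ e * p ^ (2 * (h + 1) * e) := by
    rw [← pow_add]; ring
  rw [hpow]
  have h1' := Nat.mul_le_mul_left (p ^ e) h1
  rw [mul_add, mul_add] at h1'
  rw [mul_add] at key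
  omega
end two
end SWY

end

section
namespace SWY
open MvPolynomial

section transport
variable {k : Type*} [Field k]

theorem HK_eq_cl (n p e : ℕ) (f : MvPolynomial (Fin n) k) : HKfun k n p e f = cl (p ^ e) f := by
  unfold HKfun cl frP
  rw [Ideal.span_union, sup_comm]

theorem A1_Fz (p : ℕ) [Fact p.Prime] [CharP k p] (d : ℕ) : Fz p (A1poly k d) := by
  unfold A1poly
  refine (Fz.sum _ _ fun _ _ => (Fz.X p _).mul (Fz.X p _)).add ?_
  split_ifs
  · exact (Fz.X p _).pow 2
  · exact Fz.zero p

theorem A2_Fz (p : ℕ) [Fact p.Prime] [CharP k p] (d : ℕ) : Fz p (A2poly k d) := by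
  unfold A2poly
  refine ((Fz.sum _ _ fun _ _ => (Fz.X p _).mul (Fz.X p _)).add ?_).add ((Fz.X p _).pow 3)
  split_ifs
  · exact (Fz.X p _).pow 2
  · exact Fz.zero p

theorem sum_hyp (N m h : ℕ) (hmh : m = h) (hm : ∀ i : Fin m, 2 * (i : ℕ) + 1 < N)
    (hh : ∀ i : Fin h, 2 * (i : ℕ) + 1 < N) :
    (∑ i : Fin m, (X (⟨2 * i, by have := hm i; omega⟩ : Fin N) : MvPolynomial (Fin N) k) *
      X (⟨2 * i + 1, hm i⟩ : Fin N)) =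
    ∑ i : Fin h, (X (⟨2 * i, by have := hh i; omega⟩ : Fin N) : MvPolynomial (Fin N) k) *
      X (⟨2 * i + 1, hh i⟩ : Fin N) := by
  subst hmh
  rfl

theorem even_transport (d h : ℕ) (hd : d = 2 * h) :
    ∃ ε : (Fin h × Fin 2) ⊕ Fin 1 ≃ Fin (d + 1),
      A1poly k d = rename ε (rename Sum.inl (hyp k h) + rename Sum.inr (X 0 ^ 2)) ∧
      A2poly k d = rename ε (rename Sum.inl (hyp k h) + rename Sum.inr (X 0 ^ 3)) := by
  let F : (Fin h × Fin 2) ⊕ Fin 1 → Fin (d + 1) := Sum.elim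
    (fun x => ⟨2 * x.1 + x.2, by have := x.1.2; have := x.2.2; omega⟩) (fun _ => ⟨d, by omega⟩)
  have hF : Function.Bijective F := by
    rw [Fintype.bijective_iff_injective_and_card]
    refine ⟨?_, by simp; omega⟩
    rintro (⟨i, b⟩ | i) (⟨j, c⟩ | j) hij
    · simp only [F, Sum.elim_inl, Fin.mk.injEq] at hij
      have := b.2; have := c.2
      have h1 : i = j := by ext; omega
      have h2 : b = c := by ext; omega
      rw [h1, h2]
    · simp only [F, Sum.elim_inl, Sum.elim_inr, Fin.mk.injEq] at hij
      have := b.2; have := i.2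
      omega
    · simp only [F, Sum.elim_inl, Sum.elim_inr, Fin.mk.injEq] at hij
      have := c.2; have := j.2
      omega
    · rw [Subsingleton.elim i j]
  have hev : Even d := ⟨h, by omega⟩
  refine ⟨Equiv.ofBijective F hF, ?_, ?_⟩
  · unfold A1poly hyp
    rw [if_pos hev, sum_hyp (d + 1) ((d + 1) / 2) h (by omega) (fun i => by omega)
      (fun i => by omega)]
    simp [F]
  · unfold A2poly hyp
    rw [if_neg (by rwa [Nat.not_odd_iff_even]), sum_hyp (d + 1) (d / 2) h (by omega)
      (fun i => by omega) (fun i => by omega)]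
    simp [F]

theorem odd_transport (d h : ℕ) (hd : d = 2 * h + 1) :
    ∃ ε : (Fin h × Fin 2) ⊕ Fin 2 ≃ Fin (d + 1),
      A1poly k d = rename ε (rename Sum.inl (hyp k h) + rename Sum.inr (X 0 * X 1)) ∧
      A2poly k d = rename ε (rename Sum.inl (hyp k h) + rename Sum.inr (X 0 ^ 2 + X 1 ^ 3)) := by
  let F : (Fin h × Fin 2) ⊕ Fin 2 → Fin (d + 1) := Sum.elim
    (fun x => ⟨2 * x.1 + x.2, by have := x.1.2; have := x.2.2; omega⟩)
    (fun x => ⟨2 * h + x, by have := x.2; omega⟩)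
  have hF : Function.Bijective F := by
    rw [Fintype.bijective_iff_injective_and_card]
    refine ⟨?_, by simp; omega⟩
    rintro (⟨i, b⟩ | i) (⟨j, c⟩ | j) hij
    · simp only [F, Sum.elim_inl, Fin.mk.injEq] at hij
      have := b.2; have := c.2
      have h1 : i = j := by ext; omega
      have h2 : b = c := by ext; omega
      rw [h1, h2]
    · simp only [F, Sum.elim_inl, Sum.elim_inr, Fin.mk.injEq] at hij
      have := b.2; have := i.2
      omega
    · simp only [F, Sum.elim_inl, Sum.elim_inr, Fin.mk.injEq] at hij
      have := c.2; have := j.2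
      omega
    · simp only [F, Sum.elim_inr, Fin.mk.injEq] at hij
      have h1 : i = j := by ext; omega
      rw [h1]
  have hodd : Odd d := ⟨h, by omega⟩
  have hF0 : F (Sum.inr 0) = ⟨2 * h, by omega⟩ := by simp [F]
  have hF1 : F (Sum.inr 1) = ⟨2 * h + 1, by omega⟩ := by simp [F]
  refine ⟨Equiv.ofBijective F hF, ?_, ?_⟩
  · unfold A1poly hyp
    rw [if_neg (by rwa [Nat.not_even_iff_odd]), sum_hyp (d + 1) ((d + 1) / 2) (h + 1) (by omega)
      (fun i => by omega) (fun i => by omega), Fin.sum_univ_castSucc]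
    simp [F]
  · unfold A2poly hyp
    rw [if_pos hodd, sum_hyp (d + 1) (d / 2) h (by omega)
      (fun i => by omega) (fun i => by omega)]
    have e1 : (⟨d - 1, by omega⟩ : Fin (d + 1)) = ⟨2 * h, by omega⟩ := by ext; simp; omega
    have e2 : (⟨d, by omega⟩ : Fin (d + 1)) = ⟨2 * h + 1, by omega⟩ := by ext; simp; omega
    rw [e1, e2, add_assoc]
    simp [F]

theorem cl_hyp_le (p : ℕ) [Fact p.Prime] [CharP k p] (h e : ℕ) {τ : Type} [Fintype τ]
    (g : MvPolynomial τ k) (B : ℕ) (hB : ∀ a, cl (p ^ e) (g ^ a) ≤ B * a) :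
    cl (p ^ e) (rename Sum.inl (hyp k (h + 1)) + rename Sum.inr g :
          MvPolynomial ((Fin (h + 1) × Fin 2) ⊕ τ) k) ≤ B * p ^ (2 * (h + 1) * e) := by
  obtain ⟨r, a, h1, h2⟩ := KF_cl (k := k) (p ^ e) (hyp k (h + 1)) (p ^ e) (by
    rw [← hyp_Fz p (h + 1) e, hyp, map_sum]
    refine Ideal.sum_mem _ fun i _ => ?_
    rw [map_mul, expand_X, expand_X]
    exact Ideal.mul_mem_left _ _ (Ideal.subset_span ⟨_, rfl⟩))
  rw [h2]
  refine (Finset.sum_le_sum fun i _ => hB (a i)).trans ?_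
  rw [← Finset.mul_sum]
  refine Nat.mul_le_mul_left _ ?_
  have h3 := h1 (∑ i, a i)
  rw [Finset.sum_congr rfl (fun i _ => min_eq_left
    (Finset.single_le_sum (f := a) (fun _ _ => Nat.zero_le _) (Finset.mem_univ i)))] at h3
  rw [← h3]
  have := finite_frP (k := k) (Fin (h + 1) × Fin 2) (p ^ e)
  have hc : Fintype.card (Fin (h + 1) × Fin 2) = 2 * (h + 1) := by simp; ring
  have h4 := finrank_frP (k := k) (Fin (h + 1) × Fin 2) (p ^ e)
  rw [hc, ← pow_mul, mul_comm e] at h4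
  rw [← h4]
  exact finrank_quot_le le_sup_right

theorem HK_facts (p : ℕ) [Fact p.Prime] [CharP k p] (d : ℕ) (hd : 2 ≤ d) :
    (∃ s, ∀ e, HKfun k (d + 1) p (e + s) (A1poly k d) + p ^ (d * e) ≤
      HKfun k (d + 1) p (e + s) (A2poly k d)) ∧
    (∀ e, HKfun k (d + 1) p e (A1poly k d) ≤ 3 * p ^ (d * e)) ∧
    (∀ e, HKfun k (d + 1) p e (A2poly k d) ≤ 3 * p ^ (d * e)) := by
  simp only [HK_eq_cl]
  rcases Nat.even_or_odd' d with ⟨h, hh | hh⟩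
  · obtain ⟨h, rfl⟩ : ∃ h', h = h' + 1 := ⟨h - 1, by omega⟩
    obtain ⟨ε, h1, h2⟩ := even_transport (k := k) d _ hh
    rw [h1, h2]
    simp only [cl_rename]
    rw [hh]
    refine ⟨⟨3, fun e => ?_⟩, fun e => ?_, fun e => ?_⟩
    · rw [add_comm e 3, pow_add]
      exact even_gap p h e
    · refine cl_hyp_le p h e _ 3 fun a => ?_
      rw [← pow_mul, cl_one_var]
      omega
    · refine cl_hyp_le p h e _ 3 fun a => ?_
      rw [← pow_mul, cl_one_var]
      omega
  · obtain ⟨h, rfl⟩ : ∃ h', h = h' + 1 := ⟨h - 1, by omega⟩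
    obtain ⟨ε, h1, h2⟩ := odd_transport (k := k) d _ hh
    rw [h1, h2]
    simp only [cl_rename]
    rw [hh]
    have hpow : ∀ e, 3 * p ^ ((2 * (h + 1) + 1) * e) = (3 * p ^ e) * p ^ (2 * (h + 1) * e) := by
      intro e
      rw [mul_assoc, ← pow_add]; ring
    have hb : ∀ e a : ℕ, 2 * a * p ^ e ≤ 3 * p ^ e * a := by
      intro e a
      calc 2 * a * p ^ e = 2 * (p ^ e * a) := by ring
        _ ≤ 3 * (p ^ e * a) := Nat.mul_le_mul_right _ (by norm_num)
        _ = _ := by ring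
    refine ⟨⟨4, fun e => ?_⟩, fun e => ?_, fun e => ?_⟩
    · rw [add_comm e 4, pow_add]
      exact odd_gap p h e
    · rw [hpow]
      refine cl_hyp_le p h e _ _ fun a => le_trans ?_ ((g2_le (k := k) (p ^ e) a).trans (hb e a))
      have t1 := g1_ub (k := k) (p ^ e) a
      have t2 := g2_lb (k := k) (p ^ e) a
      omega
    · rw [hpow]
      exact cl_hyp_le p h e _ _ fun a => (g2_le (k := k) (p ^ e) a).trans (hb e a)

theorem HK_step (p : ℕ) [Fact p.Prime] [CharP k p] (d e : ℕ) {f : MvPolynomial (Fin (d + 1)) k}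
    (hf : Fz p f) : p ^ d * HKfun k (d + 1) p e f ≤ HKfun k (d + 1) p (e + 1) f := by
  rw [HK_eq_cl, HK_eq_cl]
  have h := cl_scale (k := k) p 1 (p ^ e) 1 hf
  rw [pow_one, one_mul, pow_one, Fintype.card_fin, ← pow_succ] at h
  have hcl : ∀ g : MvPolynomial (Fin (d + 1)) k, cl (p ^ (e + 1)) g = Module.finrank k
      (MvPolynomial (Fin (d + 1)) k ⧸ (frP (Fin (d + 1)) k (p ^ (e + 1)) ⊔ Ideal.span {g})) :=
    fun g => by unfold cl; rw [sup_comm]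
  have hfin : Module.Finite k (MvPolynomial (Fin (d + 1)) k ⧸
      (frP (Fin (d + 1)) k (p ^ (e + 1)) ⊔ Ideal.span {f})) :=
    finite_quotP (q := p ^ (e + 1)) le_sup_left
  have h2 := (colen_pow (k := k) (frP (Fin (d + 1)) k (p ^ (e + 1))) f p).2
  rw [← hcl, ← hcl, h, pow_succ, mul_comm (p ^ d), mul_assoc] at h2
  exact Nat.le_of_mul_le_mul_left h2 (Fact.out : p.Prime).pos

theorem HK_tendsto (p : ℕ) [Fact p.Prime] [CharP k p] (d : ℕ) {f : MvPolynomial (Fin (d + 1)) k}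
    (hf : Fz p f) (B : ℕ) (hB : ∀ e, HKfun k (d + 1) p e f ≤ B * p ^ (d * e)) :
    ∃ L : ℝ, Filter.Tendsto (fun e : ℕ => (HKfun k (d + 1) p e f : ℝ) / (p : ℝ) ^ (d * e))
      Filter.atTop (nhds L) := by
  have hp : (0 : ℝ) < p := by exact_mod_cast (Fact.out : p.Prime).pos
  refine ⟨_, tendsto_atTop_ciSup (monotone_nat_of_le_succ fun e => ?_) ⟨B, ?_⟩⟩
  · rw [div_le_div_iff₀ (by positivity) (by positivity)]
    have h : ((p ^ d * HKfun k (d + 1) p e f : ℕ) : ℝ) ≤ (HKfun k (d + 1) p (e + 1) f : ℝ) := by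
      exact_mod_cast HK_step p d e hf
    push_cast at h
    calc (HKfun k (d + 1) p e f : ℝ) * p ^ (d * (e + 1))
        = (p ^ d * HKfun k (d + 1) p e f) * p ^ (d * e) := by rw [mul_add, mul_one, pow_add]; ring
      _ ≤ _ := mul_le_mul_of_nonneg_right h (by positivity)
  · rintro _ ⟨e, rfl⟩
    rw [div_le_iff₀ (by positivity)]
    exact_mod_cast hB e

theorem limits (p : ℕ) [Fact p.Prime] [CharP k p] (d : ℕ) (hd : 2 ≤ d) :
    ∃ L_S L_R : ℝ,
      Filter.Tendsto (fun e : ℕ => (HKfun k (d + 1) p e (A2poly k d) : ℝ) / (p : ℝ) ^ (d * e))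
        Filter.atTop (nhds L_S) ∧
      Filter.Tendsto (fun e : ℕ => (HKfun k (d + 1) p e (A1poly k d) : ℝ) / (p : ℝ) ^ (d * e))
        Filter.atTop (nhds L_R) ∧ L_S > L_R := by
  have hp : (0 : ℝ) < p := by exact_mod_cast (Fact.out : p.Prime).pos
  obtain ⟨⟨s, hs⟩, hb1, hb2⟩ := HK_facts (k := k) p d hd
  obtain ⟨LS, hLS⟩ := HK_tendsto p d (A2_Fz (k := k) p d) 3 hb2
  obtain ⟨LR, hLR⟩ := HK_tendsto p d (A1_Fz (k := k) p d) 3 hb1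
  refine ⟨LS, LR, hLS, hLR, ?_⟩
  have h1 := (Filter.tendsto_add_atTop_iff_nat s).2 hLS
  have h2 := ((Filter.tendsto_add_atTop_iff_nat s).2 hLR).add_const (1 / (p : ℝ) ^ (d * s))
  have h3 := le_of_tendsto_of_tendsto' h2 h1 (fun e => by
    rw [mul_add, pow_add, div_add_div _ _ (by positivity) (by positivity),
      div_le_div_iff₀ (by positivity) (by positivity)]
    have h : ((HKfun k (d + 1) p (e + s) (A1poly k d) + p ^ (d * e) : ℕ) : ℝ) ≤
      (HKfun k (d + 1) p (e + s) (A2poly k d) : ℝ) := by exact_mod_cast hs e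
    push_cast at h
    have h' := mul_le_mul_of_nonneg_right h
      (show (0 : ℝ) ≤ p ^ (d * s) * (p ^ (d * e) * p ^ (d * s)) by positivity)
    nlinarith)
  have : (0 : ℝ) < 1 / (p : ℝ) ^ (d * s) := by positivity
  linarith

end transport

theorem main_d {k : Type*} [Field k] [IsAlgClosed k] (p : ℕ) [Fact p.Prime] [CharP k p]
    (n ℓ d : ℕ) (hnd : n = d + ℓ) (hℓ : 1 ≤ ℓ) (hd : 2 ≤ d)
    (f : Fin ℓ → MvPowerSeries (Fin n) k)
    (hf : ∀ i : Fin ℓ, f i ∈ mI n k ^ 2)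
    (hreg : RingTheory.Sequence.IsRegular (MvPowerSeries (Fin n) k) (List.ofFn f)) :
    Nonempty ((MvPowerSeries (Fin n) k ⧸
        (Ideal.span (Set.range f) : Ideal (MvPowerSeries (Fin n) k))) ≃+*
      (MvPowerSeries (Fin (d + 1)) k ⧸
        (Ideal.span {(A1poly k d : MvPowerSeries (Fin (d + 1)) k)} :
          Ideal (MvPowerSeries (Fin (d + 1)) k)))) ∨
    ∃ L_S L_R : ℝ,
      Filter.Tendsto (fun e : ℕ => (HKfun k (d + 1) p e (A2poly k d) : ℝ) / (p : ℝ) ^ (d * e))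
        Filter.atTop (nhds L_S) ∧
      Filter.Tendsto (fun e : ℕ => (HKfun k (d + 1) p e (A1poly k d) : ℝ) / (p : ℝ) ^ (d * e))
        Filter.atTop (nhds L_R) ∧ L_S > L_R ∧
      Filter.liminf (fun e : ℕ => (len (p ^ e) (Ideal.span (Set.range f)) : ℝ) /
            (p : ℝ) ^ (d * e)) Filter.atTop ≥ L_S := by
  have hp : (0 : ℝ) < p := by exact_mod_cast (Fact.out : p.Prime).pos
  have key : Nonempty ((MvPowerSeries (Fin n) k ⧸
        (Ideal.span (Set.range f) : Ideal (MvPowerSeries (Fin n) k))) ≃+*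
      (MvPowerSeries (Fin (d + 1)) k ⧸
        (Ideal.span {(A1poly k d : MvPowerSeries (Fin (d + 1)) k)} :
          Ideal (MvPowerSeries (Fin (d + 1)) k)))) ∨
      ∀ e, HKfun k (d + 1) p e (A2poly k d) ≤ len (p ^ e) (Ideal.span (Set.range f)) := by
    clear hreg
    obtain rfl | ⟨l, rfl⟩ : ℓ = 1 ∨ ∃ l, ℓ = l + 1 + 1 := by
      rcases Nat.lt_or_ge ℓ 2 with h | h
      · left; omega
      · right; exact ⟨ℓ - 2, by omega⟩
    · subst hnd
      have : Set.range f = {f 0} := by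
        ext x; simp [eq_comm]
      rw [this]
      exact ell1 p (f 0) (hf 0)
    · right
      intro e
      obtain rfl : n = d + 1 + (l + 1) := by omega
      exact ell2 p e f hf
  refine key.imp id fun h => ?_
  obtain ⟨LS, LR, h1, h2, h3⟩ := limits (k := k) p d hd
  refine ⟨LS, LR, h1, h2, h3, ?_⟩
  obtain ⟨C, hC⟩ := len_bound p hnd f (fun i => Ideal.pow_le_self two_ne_zero (hf i)) hreg
  rw [ge_iff_le, ← h1.liminf_eq]
  refine Filter.liminf_le_liminf (Filter.Eventually.of_forall fun e => ?_) ?_ ?_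
  · exact div_le_div_of_nonneg_right (by exact_mod_cast h e) (by positivity)
  · exact h1.isBoundedUnder_ge
  · refine Filter.IsBoundedUnder.isCoboundedUnder_ge ⟨C, ?_⟩
    rw [Filter.eventually_map]
    refine Filter.Eventually.of_forall fun e => ?_
    beta_reduce
    rw [div_le_iff₀ (by positivity)]
    exact_mod_cast hC e

end SWY

end

/-- The Strong Watanabe–Yoshida conjecture for complete intersections: a non-regular
complete intersection `R = k[[x_1,…,x_n]]/(f_1,…,f_ℓ)` of dimension `d = n − ℓ ≥ 2` is
either isomorphic to the `A₁` singularity, or satisfies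
`e_HK(R) ≥ e_HK(S_{p,d}) > e_HK(R_{p,d})`. -/
theorem strong_watanabe_yoshida_complete_intersections
    (p : ℕ) (hp : p.Prime) (k : Type*) [Field k] [IsAlgClosed k] [CharP k p]
    (n ℓ : ℕ) (hn : 1 ≤ n) (hℓ : 1 ≤ ℓ) (hd : 2 ≤ n - ℓ)
    (f : Fin ℓ → MvPowerSeries (Fin n) k)
    (hf : ∀ i : Fin ℓ, f i ∈ (Ideal.span
      (Set.range (MvPowerSeries.X : Fin n → MvPowerSeries (Fin n) k))) ^ 2)
    (hreg : RingTheory.Sequence.IsRegular (MvPowerSeries (Fin n) k) (List.ofFn f)) :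
    Nonempty ((MvPowerSeries (Fin n) k ⧸
        (Ideal.span (Set.range f) : Ideal (MvPowerSeries (Fin n) k))) ≃+*
      (MvPowerSeries (Fin (n - ℓ + 1)) k ⧸
        (Ideal.span {(A1poly k (n - ℓ) : MvPowerSeries (Fin (n - ℓ + 1)) k)} :
          Ideal (MvPowerSeries (Fin (n - ℓ + 1)) k)))) ∨
    ∃ L_S L_R : ℝ,
      Filter.Tendsto
        (fun e : ℕ =>
          (HKfun k (n - ℓ + 1) p e (A2poly k (n - ℓ)) : ℝ) / (p : ℝ) ^ ((n - ℓ) * e))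
        Filter.atTop (nhds L_S) ∧
      Filter.Tendsto
        (fun e : ℕ =>
          (HKfun k (n - ℓ + 1) p e (A1poly k (n - ℓ)) : ℝ) / (p : ℝ) ^ ((n - ℓ) * e))
        Filter.atTop (nhds L_R) ∧
      L_S > L_R ∧
      Filter.liminf
        (fun e : ℕ =>
          (Module.finrank k
            (MvPowerSeries (Fin n) k ⧸
              Ideal.span (Set.range f ∪ Set.range
                (fun i : Fin n =>
                  (MvPowerSeries.X i : MvPowerSeries (Fin n) k) ^ p ^ e))) : ℝ) /
            (p : ℝ) ^ ((n - ℓ) * e))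
        Filter.atTop ≥ L_S := by
  have : Fact p.Prime := ⟨hp⟩
  have hlen : ∀ e, Module.finrank k (MvPowerSeries (Fin n) k ⧸
              Ideal.span (Set.range f ∪ Set.range
                (fun i : Fin n =>
                  (MvPowerSeries.X i : MvPowerSeries (Fin n) k) ^ p ^ e))) =
      SWY.len (p ^ e) (Ideal.span (Set.range f)) := by
    intro e
    unfold SWY.len SWY.fr
    rw [Ideal.span_union]
  simp only [hlen]
  exact SWY.main_d p n ℓ (n - ℓ) (by omega) hℓ hd f hf hreg
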